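/- arXiv:2211.08716 — 4 statements merged into one kernel-verified Lean document; each statement's English description precedes it below -/
import Mathlib

section
/- There is an absolute constant C > 0 such that the following holds. Let N > 1 and let 1 ≤ n_0 ≤ n_1 ≤ … ≤ n_K ≤ N be real numbers, let a_0, …, a_K be complex numbers, and set S(t) = ∑_{k=0}^{K} a_k n_k^{-it}. Then for every T_0 ∈ ℝ, T > 0, and η > 0, ∫_{T_0}^{T_0+T} |S(t)|² dt ≤ C (T + 1/η) ∑_{k=0}^{K} χ(n_k, ηN) |a_k|². -/
open MeasureTheory

/-- The quadratic form with kernel `1 / (1 + (m k - m l) ^ 2)` is bounded, up to a constant, by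
the diagonal form weighted by the sizes of the fibres of `m`. -/
lemma sum_sum_div_one_add_sq_le {ι : Type*} (s : Finset ι) (m : ι → ℤ) (x : ι → ℝ) {G : ℝ}
    (hG : ∀ u : Finset ℤ, ∑ d ∈ u, 1 / (1 + (d : ℝ) ^ 2) ≤ G) :
    ∑ k ∈ s, ∑ l ∈ s, x k * x l * (1 / (1 + ((m k - m l : ℤ) : ℝ) ^ 2)) ≤
      G * ∑ k ∈ s, ((s.filter fun l => m l = m k).card : ℝ) * x k ^ 2 := by
  classical
  set r : ι → ℝ := fun k => ((s.filter fun l => m l = m k).card : ℝ) with hr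
  set g : ℤ → ℝ := fun d => 1 / (1 + (d : ℝ) ^ 2) with hg
  have hgneg (d : ℤ) : g (-d) = g d := by simp [hg]
  have hg0 (d : ℤ) : 0 ≤ g d := by simp only [hg]; positivity
  have hr0 {k : ι} (hk : k ∈ s) : 0 < r k := by
    simp only [hr, Nat.cast_pos, Finset.card_pos]
    exact ⟨k, by simp [hk]⟩
  have hrow (k : ι) : ∑ l ∈ s, g (m k - m l) / r l ≤ G := by
    have h := Finset.sum_comp (s := s)
      (fun b : ℤ => g (m k - b) / ((s.filter fun l => m l = b).card : ℝ)) m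
    simp only [hr]
    rw [h]
    calc _ = ∑ b ∈ s.image m, g (m k - b) := by
          refine Finset.sum_congr rfl fun b hb => ?_
          obtain ⟨l, hl, rfl⟩ := Finset.mem_image.1 hb
          have := hr0 hl
          simp only [hr] at this
          rw [nsmul_eq_mul]
          field_simp
      _ = ∑ d ∈ (s.image m).image (fun b => m k - b), g d := by
          refine (Finset.sum_image fun a _ b _ h => ?_).symm
          simpa using h
      _ ≤ G := hG _
  have hamgm {k l : ι} (hk : k ∈ s) (hl : l ∈ s) :
      x k * x l ≤ (r k * x k ^ 2 / r l + r l * x l ^ 2 / r k) / 2 := by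
    have h1 := hr0 hk
    have h2 := hr0 hl
    rw [div_add_div _ _ h2.ne' h1.ne', div_div, le_div_iff₀ (by positivity)]
    nlinarith [sq_nonneg (r k * x k - r l * x l)]
  have hhalf : ∑ k ∈ s, ∑ l ∈ s, r k * x k ^ 2 / r l * g (m k - m l) ≤
      G * ∑ k ∈ s, r k * x k ^ 2 := by
    rw [Finset.mul_sum]
    refine Finset.sum_le_sum fun k hk => ?_
    have h1 := hr0 hk
    calc _ = r k * x k ^ 2 * ∑ l ∈ s, g (m k - m l) / r l := by
          rw [Finset.mul_sum]
          exact Finset.sum_congr rfl fun l _ => by ring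
      _ ≤ r k * x k ^ 2 * G := by gcongr; exact hrow k
      _ = _ := mul_comm _ _
  have hswap : ∑ k ∈ s, ∑ l ∈ s, r l * x l ^ 2 / r k * g (m k - m l) =
      ∑ k ∈ s, ∑ l ∈ s, r k * x k ^ 2 / r l * g (m k - m l) := by
    rw [Finset.sum_comm]
    refine Finset.sum_congr rfl fun k _ => Finset.sum_congr rfl fun l _ => ?_
    rw [← hgneg (m k - m l), neg_sub]
  calc _ ≤ ∑ k ∈ s, ∑ l ∈ s,
        (r k * x k ^ 2 / r l * g (m k - m l) + r l * x l ^ 2 / r k * g (m k - m l)) / 2 := by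
        refine Finset.sum_le_sum fun k hk => Finset.sum_le_sum fun l hl => ?_
        have := mul_le_mul_of_nonneg_right (hamgm hk hl) (hg0 (m k - m l))
        simp only [hg] at this ⊢
        linarith
    _ ≤ _ := by
        simp only [← Finset.sum_div, Finset.sum_add_distrib]
        rw [hswap]
        linarith

lemma summable_one_div_one_add_int_sq : Summable fun d : ℤ => 1 / (1 + (d : ℝ) ^ 2) := by
  have h : Summable fun d : ℤ => 1 / (d : ℝ) ^ 2 + (Pi.single 0 1 : ℤ → ℝ) d :=
    (Real.summable_one_div_int_pow.2 one_lt_two).add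
      (summable_of_ne_finset_zero (s := {0}) fun d hd => by
        simp only [Finset.mem_singleton] at hd
        simp [hd])
  refine h.of_nonneg_of_le (fun d => by positivity) fun d => ?_
  rcases eq_or_ne d 0 with rfl | hd
  · simp
  · have : (d : ℝ) ≠ 0 := by exact_mod_cast hd
    simp only [Pi.single_eq_of_ne hd, add_zero]
    gcongr
    linarith

/-- Gaussian decay in terms of the distance between the integer parts. -/
lemma exp_neg_sq_div_four_le (x y : ℝ) :
    Real.exp (-(x - y) ^ 2 / 4) ≤ 8 * (1 / (1 + ((⌊x⌋ - ⌊y⌋ : ℤ) : ℝ) ^ 2)) := by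
  have h1 : Real.exp (-(x - y) ^ 2 / 4) ≤ 1 / (1 + (x - y) ^ 2 / 4) := by
    rw [neg_div, Real.exp_neg, ← one_div]
    gcongr
    linarith [Real.add_one_le_exp ((x - y) ^ 2 / 4)]
  refine h1.trans ?_
  have h2 : ((⌊x⌋ - ⌊y⌋ : ℤ) : ℝ) = (x - y) - (Int.fract x - Int.fract y) := by
    push_cast
    rw [Int.fract, Int.fract]
    ring
  have h3 : (Int.fract x - Int.fract y) ^ 2 ≤ 1 := by
    rw [sq_le_one_iff_abs_le_one, abs_le]
    constructor <;>
      linarith [Int.fract_nonneg x, Int.fract_nonneg y, Int.fract_lt_one x, Int.fract_lt_one y]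
  rw [h2, mul_one_div, div_le_div_iff₀ (by positivity) (by positivity)]
  nlinarith [sq_nonneg ((x - y) + (Int.fract x - Int.fract y))]

lemma integrable_exp_mul_gaussian {b : ℝ} (hb : 0 < b) (ξ : ℝ) :
    Integrable fun t : ℝ => Complex.exp (Complex.I * ξ * t) * Complex.exp (-(b : ℂ) * t ^ 2) := by
  simpa [← Complex.exp_add, add_comm] using
    integrable_cexp_quadratic (b := (b : ℂ)) (by simpa using hb) (Complex.I * ξ) 0

lemma norm_integral_exp_mul_gaussian {b : ℝ} (hb : 0 < b) (ξ : ℝ) :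
    ‖∫ t : ℝ, Complex.exp (Complex.I * ξ * t) * Complex.exp (-(b : ℂ) * t ^ 2)‖ =
      √(Real.pi / b) * Real.exp (-ξ ^ 2 / (4 * b)) := by
  rw [fourierIntegral_gaussian (by simpa using hb), norm_mul, Real.sqrt_eq_rpow,
    ← Complex.ofReal_div, Complex.norm_cpow_eq_rpow_re_of_pos (by positivity), Complex.norm_exp]
  congr 2
  · norm_num
  · rw [← Complex.ofReal_re (-ξ ^ 2 / (4 * b))]
    push_cast
    rfl

lemma normSq_exp_sum_mul_gaussian {ι : Type*} (s : Finset ι) (a : ι → ℂ) (ν : ι → ℝ) (b t : ℝ) :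
    ((Real.exp (-b * t ^ 2) * ‖∑ k ∈ s, a k * Complex.exp (Complex.I * ν k * t)‖ ^ 2 : ℝ) : ℂ) =
      ∑ k ∈ s, ∑ l ∈ s, a k * (starRingEnd ℂ) (a l) *
        (Complex.exp (Complex.I * (ν k - ν l : ℝ) * t) * Complex.exp (-(b : ℂ) * t ^ 2)) := by
  push_cast
  rw [← Complex.mul_conj', map_sum, Finset.sum_mul_sum, Finset.mul_sum]
  refine Finset.sum_congr rfl fun k _ => ?_
  rw [Finset.mul_sum]
  refine Finset.sum_congr rfl fun l _ => ?_
  have : Complex.exp (Complex.I * (ν k - ν l) * t) = Complex.exp (Complex.I * ν k * t) *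
      (starRingEnd ℂ) (Complex.exp (Complex.I * ν l * t)) := by
    rw [← Complex.exp_conj, ← Complex.exp_add]
    congr 1
    simp
    ring
  rw [this, map_mul]
  ring

lemma integrable_gaussian_mul_normSq_exp_sum {ι : Type*} (s : Finset ι) (a : ι → ℂ) (ν : ι → ℝ)
    {b : ℝ} (hb : 0 < b) :
    Integrable fun t : ℝ =>
      Real.exp (-b * t ^ 2) * ‖∑ k ∈ s, a k * Complex.exp (Complex.I * ν k * t)‖ ^ 2 := by
  have h : Integrable fun t : ℝ =>
      ((Real.exp (-b * t ^ 2) * ‖∑ k ∈ s, a k * Complex.exp (Complex.I * ν k * t)‖ ^ 2 : ℝ) : ℂ) := by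
    simp only [normSq_exp_sum_mul_gaussian]
    exact integrable_finsetSum _ fun k _ => integrable_finsetSum _ fun l _ =>
      (integrable_exp_mul_gaussian hb _).const_mul _
  exact h.re

lemma integral_gaussian_mul_normSq_exp_sum_le {ι : Type*} (s : Finset ι) (a : ι → ℂ) (ν : ι → ℝ)
    {b : ℝ} (hb : 0 < b) :
    ∫ t : ℝ, Real.exp (-b * t ^ 2) * ‖∑ k ∈ s, a k * Complex.exp (Complex.I * ν k * t)‖ ^ 2 ≤
      √(Real.pi / b) *
        ∑ k ∈ s, ∑ l ∈ s, ‖a k‖ * ‖a l‖ * Real.exp (-(ν k - ν l) ^ 2 / (4 * b)) := by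
  refine (Real.le_norm_self _).trans ?_
  rw [← Complex.norm_real, ← integral_complex_ofReal]
  simp only [normSq_exp_sum_mul_gaussian]
  have hint (k l : ι) := (integrable_exp_mul_gaussian hb (ν k - ν l)).const_mul
    (a k * (starRingEnd ℂ) (a l))
  rw [integral_finsetSum _ fun k _ => integrable_finsetSum _ fun l _ => hint k l, Finset.mul_sum]
  refine (norm_sum_le _ _).trans (Finset.sum_le_sum fun k _ => ?_)
  rw [integral_finsetSum _ fun l _ => hint k l, Finset.mul_sum]
  refine (norm_sum_le _ _).trans (Finset.sum_le_sum fun l _ => le_of_eq ?_)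
  rw [integral_const_mul, norm_mul, norm_integral_exp_mul_gaussian hb, norm_mul, RCLike.norm_conj]
  ring

/-- Mean value estimate for an exponential sum over `[0, T]` with `T ≤ 1 / δ`. -/
lemma integral_normSq_exp_sum_le {ι : Type*} (s : Finset ι) (a : ι → ℂ) (ν : ι → ℝ)
    {T δ : ℝ} (hT : 0 ≤ T) (hδ : 0 < δ) (hTδ : T * δ ≤ 1) :
    ∫ t in (0 : ℝ)..T, ‖∑ k ∈ s, a k * Complex.exp (Complex.I * ν k * t)‖ ^ 2 ≤
      8 * Real.exp 1 * √Real.pi * (∑' d : ℤ, 1 / (1 + (d : ℝ) ^ 2)) * (1 / δ) *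
        ∑ k ∈ s, ((s.filter fun l => |ν k - ν l| ≤ δ).card : ℝ) * ‖a k‖ ^ 2 := by
  set G : ℝ := ∑' d : ℤ, 1 / (1 + (d : ℝ) ^ 2)
  set F : ℝ → ℝ := fun t => ‖∑ k ∈ s, a k * Complex.exp (Complex.I * ν k * t)‖ ^ 2
  have hG0 : 0 ≤ G := tsum_nonneg fun d => by positivity
  have hb : 0 < δ ^ 2 := by positivity
  have hint := integrable_gaussian_mul_normSq_exp_sum s a ν hb
  have hwindow : ∫ t in (0 : ℝ)..T, F t ≤
      Real.exp 1 * ∫ t : ℝ, Real.exp (-δ ^ 2 * t ^ 2) * F t := by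
    rw [← integral_const_mul, intervalIntegral.integral_of_le hT]
    calc _ ≤ ∫ t in Set.Ioc 0 T, Real.exp 1 * (Real.exp (-δ ^ 2 * t ^ 2) * F t) := by
          refine setIntegral_mono_on ?_ (hint.const_mul _).integrableOn measurableSet_Ioc ?_
          · exact (Continuous.integrableOn_Icc (by fun_prop)).mono_set Set.Ioc_subset_Icc_self
          · intro t ht
            have h1 : t * δ ≤ 1 := (mul_le_mul_of_nonneg_right ht.2 hδ.le).trans hTδ
            have h2 : 0 ≤ t * δ := mul_nonneg ht.1.le hδ.le
            have h3 : 1 ≤ Real.exp 1 * Real.exp (-δ ^ 2 * t ^ 2) := by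
              rw [← Real.exp_add]
              exact Real.one_le_exp (by nlinarith)
            have h4 : 0 ≤ F t := by positivity
            nlinarith
      _ ≤ _ := setIntegral_le_integral (hint.const_mul _) (ae_of_all _ fun t => by positivity)
  have hquad : ∑ k ∈ s, ∑ l ∈ s, ‖a k‖ * ‖a l‖ * Real.exp (-(ν k - ν l) ^ 2 / (4 * δ ^ 2)) ≤
      8 * (G * ∑ k ∈ s, ((s.filter fun l => |ν k - ν l| ≤ δ).card : ℝ) * ‖a k‖ ^ 2) := by
    calc _ ≤ 8 * ∑ k ∈ s, ∑ l ∈ s, ‖a k‖ * ‖a l‖ *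
          (1 / (1 + ((⌊ν k / δ⌋ - ⌊ν l / δ⌋ : ℤ) : ℝ) ^ 2)) := by
          simp only [Finset.mul_sum]
          refine Finset.sum_le_sum fun k _ => Finset.sum_le_sum fun l _ => ?_
          have h := exp_neg_sq_div_four_le (ν k / δ) (ν l / δ)
          have he : -(ν k / δ - ν l / δ) ^ 2 / 4 = -(ν k - ν l) ^ 2 / (4 * δ ^ 2) := by
            field_simp
          rw [he] at h
          rw [mul_left_comm]
          gcongr
      _ ≤ 8 * (G * ∑ k ∈ s, ((s.filter fun l => ⌊ν l / δ⌋ = ⌊ν k / δ⌋).card : ℝ) *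
          ‖a k‖ ^ 2) := by
          gcongr
          exact sum_sum_div_one_add_sq_le s _ _ fun u =>
            summable_one_div_one_add_int_sq.sum_le_tsum u fun d _ => by positivity
      _ ≤ _ := by
          gcongr with k _ l _
          intro h
          have h1 := (Int.abs_sub_lt_one_of_floor_eq_floor h).le
          rw [← sub_div, abs_div, abs_of_pos hδ, div_le_one hδ] at h1
          rwa [abs_sub_comm]
  have hsqrt : √(Real.pi / δ ^ 2) = √Real.pi * (1 / δ) := by
    rw [Real.sqrt_div Real.pi_pos.le, Real.sqrt_sq hδ.le, mul_one_div]
  have hmain := integral_gaussian_mul_normSq_exp_sum_le s a ν hb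
  rw [hsqrt] at hmain
  calc _ ≤ _ := hwindow
    _ ≤ Real.exp 1 * (√Real.pi * (1 / δ) *
        (8 * (G * ∑ k ∈ s, ((s.filter fun l => |ν k - ν l| ≤ δ).card : ℝ) * ‖a k‖ ^ 2))) := by
        gcongr
        exact hmain.trans (by gcongr)
    _ = _ := by ring

lemma abs_sub_le_mul_abs_log_sub {x y N : ℝ} (hx : 0 < x) (hy : 0 < y) (hxN : x ≤ N)
    (hyN : y ≤ N) : |x - y| ≤ N * |Real.log x - Real.log y| := by
  wlog hxy : y ≤ x generalizing x y
  · rw [abs_sub_comm, abs_sub_comm (Real.log x)]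
    exact this hy hx hyN hxN (le_of_not_ge hxy)
  have hlog := Real.log_le_log hy hxy
  rw [abs_of_nonneg (sub_nonneg.2 hxy), abs_of_nonneg (sub_nonneg.2 hlog)]
  have h := Real.one_sub_inv_le_log_of_pos (div_pos hx hy)
  rw [Real.log_div hx.ne' hy.ne', inv_div] at h
  have h1 : x - y = x * (1 - y / x) := by field_simp
  rw [h1]
  calc _ ≤ x * (Real.log x - Real.log y) := by gcongr
    _ ≤ _ := by gcongr

/-- **Mean value theorem for generalized Dirichlet polynomials.**
There is an absolute constant `C > 0` such that for all real `1 ≤ n 0 ≤ ⋯ ≤ n K ≤ N`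
(`N > 1`), complex coefficients `a k`, and the generalized Dirichlet polynomial
`S(t) = ∑_{k ≤ K} a k * (n k)^(-i t)`, one has for all `T₀ ∈ ℝ`, `T > 0`, `η > 0`:
`∫_{T₀}^{T₀+T} |S(t)|² dt ≤ C (T + 1/η) ∑_{k ≤ K} χ(n k, η N) |a k|²`,
where `χ(x, λ) = #{l ≤ K : |x - n l| ≤ λ}`. -/
theorem mean_value_theorem_generalized_dirichlet :
    ∃ C : ℝ, 0 < C ∧
      ∀ (N : ℝ) (K : ℕ) (n : ℕ → ℝ) (a : ℕ → ℂ),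
        1 < N → 1 ≤ n 0 → (∀ k, k < K → n k ≤ n (k + 1)) → n K ≤ N →
        ∀ T₀ T η : ℝ, 0 < T → 0 < η →
          (∫ t in T₀..T₀ + T,
              ‖∑ k ∈ Finset.range (K + 1), a k * (n k : ℂ) ^ (-(t : ℂ) * Complex.I)‖ ^ 2)
            ≤ C * (T + 1 / η) *
              ∑ k ∈ Finset.range (K + 1),
                (Set.ncard {l : ℕ | l ≤ K ∧ |n k - n l| ≤ η * N} : ℝ) * ‖a k‖ ^ 2 := by
  obtain ⟨A, hA⟩ : ∃ A : ℝ,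
      A = 8 * Real.exp 1 * √Real.pi * ∑' d : ℤ, 1 / (1 + (d : ℝ) ^ 2) := ⟨_, rfl⟩
  have hA0 : 0 ≤ A := by
    rw [hA]
    exact mul_nonneg (by positivity) (tsum_nonneg fun d => by positivity)
  refine ⟨A + 1, by linarith, ?_⟩
  intro N K n a hN h0 hmono hK T₀ T η hT hη
  have hlow : ∀ k ≤ K, 1 ≤ n k := by
    intro k
    induction k with
    | zero => exact fun _ => h0
    | succ k ih => exact fun hk => (ih (by omega)).trans (hmono k (by omega))
  have hup : ∀ k ≤ K, n k ≤ N := by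
    intro k hk
    induction hk using Nat.decreasingInduction with
    | self => exact hK
    | of_succ k hk ih => exact (hmono k hk).trans ih
  set δ : ℝ := 1 / (T + 1 / η) with hδ_def
  have hη' : 0 < 1 / η := by positivity
  have hδ : 0 < δ := by positivity
  have hTδ : T * δ ≤ 1 := by
    rw [hδ_def, mul_one_div, div_le_one (by positivity)]
    linarith
  have hδη : δ ≤ η := by
    rw [hδ_def, one_div_le (by positivity) hη]
    linarith
  set c : ℕ → ℂ := fun k => a k * (n k : ℂ) ^ (-(T₀ : ℂ) * Complex.I) with hc
  have hcnorm : ∀ k ≤ K, ‖c k‖ = ‖a k‖ := by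
    intro k hk
    have : 0 < n k := by linarith [hlow k hk]
    simp [hc, Complex.norm_cpow_eq_rpow_re_of_pos this]
  have hshift : (∫ t in T₀..T₀ + T,
      ‖∑ k ∈ Finset.range (K + 1), a k * (n k : ℂ) ^ (-(t : ℂ) * Complex.I)‖ ^ 2) =
      ∫ t in (0 : ℝ)..T, ‖∑ k ∈ Finset.range (K + 1),
        c k * Complex.exp (Complex.I * (-Real.log (n k) : ℝ) * t)‖ ^ 2 := by
    have h := intervalIntegral.integral_comp_add_right (a := 0) (b := T) (fun t : ℝ =>
      ‖∑ k ∈ Finset.range (K + 1), a k * (n k : ℂ) ^ (-(t : ℂ) * Complex.I)‖ ^ 2) T₀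
    rw [zero_add, add_comm T T₀] at h
    rw [← h]
    congr 1
    funext t
    congr 2
    refine Finset.sum_congr rfl fun k hk => ?_
    have hpos : 0 < n k := by linarith [hlow k (by simpa [Nat.lt_succ_iff] using hk)]
    have hne : (n k : ℂ) ≠ 0 := by exact_mod_cast hpos.ne'
    simp only [hc]
    rw [mul_assoc, Complex.cpow_def_of_ne_zero hne, Complex.cpow_def_of_ne_zero hne,
      ← Complex.exp_add, ← Complex.ofReal_log hpos.le]
    push_cast
    ring_nf
  rw [hshift]
  have hinv : 1 / δ = T + 1 / η := by rw [hδ_def, one_div_one_div]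
  have hmain := integral_normSq_exp_sum_le (Finset.range (K + 1)) c
    (fun k => -Real.log (n k)) hT.le hδ hTδ
  rw [← hA, hinv] at hmain
  refine hmain.trans ?_
  refine mul_le_mul (mul_le_mul_of_nonneg_right (by linarith) (by positivity))
    (Finset.sum_le_sum fun k hk => ?_) (Finset.sum_nonneg fun k _ => by positivity)
    (mul_nonneg (by linarith) (by positivity))
  have hkK : k ≤ K := by simpa [Nat.lt_succ_iff] using hk
  rw [hcnorm k hkK]
  refine mul_le_mul_of_nonneg_right (Nat.cast_le.2 ?_) (by positivity)
  rw [← Set.ncard_coe_finset]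
  refine Set.ncard_le_ncard ?_ ((Set.finite_Iic K).subset fun l hl => hl.1)
  intro l hl
  simp only [Finset.coe_filter, Finset.mem_range, Set.mem_ofPred_eq, Nat.lt_succ_iff] at hl
  obtain ⟨hlK, hl⟩ := hl
  refine ⟨hlK, (abs_sub_le_mul_abs_log_sub (N := N) (by linarith [hlow k hkK])
    (by linarith [hlow l hlK]) (hup k hkK) (hup l hlK)).trans ?_⟩
  rw [mul_comm η]
  gcongr
  rw [← abs_neg, neg_sub]
  refine le_trans (le_of_eq ?_) (hl.trans hδη)
  congr 1
  ring
end

section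
/- There is an absolute constant C > 0 such that the following holds. Let N > 1 and let 1 ≤ n_0 ≤ n_1 ≤ … ≤ n_K ≤ N be real numbers, let a_0, …, a_K be complex numbers, and set S(t) = ∑_{k=0}^{K} a_k n_k^{-it}. Let T_0 ∈ ℝ, T > 0, δ > 0, and let 𝒯 ⊆ [T_0 + δ/2, T_0 + T − δ/2] be a finite set of δ-well-spaced points, i.e. |t − t'| ≥ δ for all distinct t, t' ∈ 𝒯. Then for every η > 0, ∑_{t ∈ 𝒯} |S(t)|² ≤ C (T + 1/η)(log N + 1/δ) ∑_{k=0}^{K} χ(n_k, ηN) |a_k|². -/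
open MeasureTheory Finset

theorem norm_sq_le_integral_nhd {f f' : ℝ → ℂ} (hf : ∀ u, HasDerivAt f (f' u) u)
    (hf' : Continuous f') (t : ℝ) {δ : ℝ} (hδ : 0 < δ) :
    ‖f t‖ ^ 2 ≤ ∫ u in Set.Ioc (t - δ / 2) (t + δ / 2),
      (1 / δ * ‖f u‖ ^ 2 + 2 * (‖f u‖ * ‖f' u‖)) := by
  have hc : Continuous f := continuous_iff_continuousAt.2 fun u => (hf u).continuousAt
  have hle : t - δ / 2 ≤ t + δ / 2 := by linarith
  have hG : Continuous fun u => 2 * (‖f u‖ * ‖f' u‖) := by fun_prop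
  have hF : Continuous fun u => ‖f u‖ ^ 2 := by fun_prop
  have hI : Continuous fun u => 2 * inner ℝ (f u) (f' u) := by fun_prop
  set J := ∫ u in (t - δ / 2)..(t + δ / 2), 2 * (‖f u‖ * ‖f' u‖) with hJ
  have key : ∀ u ∈ Set.Icc (t - δ / 2) (t + δ / 2), ‖f t‖ ^ 2 - J ≤ ‖f u‖ ^ 2 := by
    intro u hu
    have h1 : ∫ v in u..t, 2 * inner ℝ (f v) (f' v) = ‖f t‖ ^ 2 - ‖f u‖ ^ 2 :=
      intervalIntegral.integral_eq_sub_of_hasDerivAt (fun v _ => (hf v).norm_sq)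
        (hI.intervalIntegrable _ _)
    have h2 : ‖∫ v in u..t, 2 * inner ℝ (f v) (f' v)‖ ≤ J := by
      refine intervalIntegral.norm_integral_le_integral_norm_uIoc.trans ?_
      rw [hJ, intervalIntegral.integral_of_le hle]
      have hsub : Set.uIoc u t ⊆ Set.Ioc (t - δ / 2) (t + δ / 2) := by
        intro v hv
        rcases Set.mem_uIoc.1 hv with h | h
        · exact ⟨by linarith [hu.1, h.1], by linarith [h.2]⟩
        · exact ⟨by linarith [h.1], by linarith [h.2, hu.2]⟩
      refine (setIntegral_mono_on (hI.norm.integrableOn_uIoc) (hG.integrableOn_uIoc)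
        measurableSet_uIoc fun v _ => ?_).trans
        (setIntegral_mono_set hG.integrableOn_Ioc
          (Filter.Eventually.of_forall fun v => by positivity) hsub.eventuallyLE)
      rw [norm_mul, Real.norm_ofNat]
      gcongr
      exact norm_inner_le_norm _ _
    have h3 := le_of_abs_le (h1 ▸ h2 : ‖‖f t‖ ^ 2 - ‖f u‖ ^ 2‖ ≤ J)
    linarith
  have h4 : ∫ _ in (t - δ / 2)..(t + δ / 2), (‖f t‖ ^ 2 - J) ≤
      ∫ u in (t - δ / 2)..(t + δ / 2), ‖f u‖ ^ 2 :=
    intervalIntegral.integral_mono_on hle (by simp) (hF.intervalIntegrable _ _) key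
  rw [intervalIntegral.integral_const, smul_eq_mul] at h4
  rw [← intervalIntegral.integral_of_le hle, intervalIntegral.integral_add
    ((hF.const_mul _).intervalIntegrable _ _) (hG.intervalIntegrable _ _),
    intervalIntegral.integral_const_mul, ← hJ]
  have h5 : ‖f t‖ ^ 2 - J ≤ 1 / δ * ∫ u in (t - δ / 2)..(t + δ / 2), ‖f u‖ ^ 2 := by
    rw [one_div, ← div_eq_inv_mul, le_div_iff₀ hδ]
    linarith
  linarith

theorem gaussian_mul_cexp_eq (c R y t : ℝ) (hR : 0 < R) :
    ((Real.exp (-((t - c) / R) ^ 2) : ℝ) : ℂ) * Complex.exp (t * y * Complex.I) =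
      Complex.exp ((-(1 / R ^ 2) : ℂ) * t ^ 2 + (2 * c / R ^ 2 + y * Complex.I) * t +
        (-(c ^ 2 / R ^ 2))) := by
  have : (R : ℂ) ≠ 0 := by exact_mod_cast hR.ne'
  rw [Complex.ofReal_exp, ← Complex.exp_add]
  congr 1
  push_cast
  field_simp
  ring

theorem inv_sq_re_pos {R : ℝ} (hR : 0 < R) : 0 < (1 / R ^ 2 : ℂ).re := by
  have : (1 / R ^ 2 : ℂ) = ((1 / R ^ 2 : ℝ) : ℂ) := by push_cast; rfl
  rw [this, Complex.ofReal_re]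
  positivity

theorem integrable_gaussian_mul_cexp (c y : ℝ) {R : ℝ} (hR : 0 < R) :
    Integrable fun t : ℝ =>
      ((Real.exp (-((t - c) / R) ^ 2) : ℝ) : ℂ) * Complex.exp (t * y * Complex.I) := by
  simp_rw [fun t => gaussian_mul_cexp_eq c R y t hR]
  exact integrable_cexp_quadratic (inv_sq_re_pos hR) _ _

theorem norm_integral_gaussian_mul_cexp (c y : ℝ) {R : ℝ} (hR : 0 < R) :
    ‖∫ t : ℝ, ((Real.exp (-((t - c) / R) ^ 2) : ℝ) : ℂ) * Complex.exp (t * y * Complex.I)‖ =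
      √Real.pi * R * Real.exp (-(R * y) ^ 2 / 4) := by
  have hR' : (R : ℂ) ≠ 0 := by exact_mod_cast hR.ne'
  simp_rw [fun t => gaussian_mul_cexp_eq c R y t hR]
  rw [integral_cexp_quadratic (by simpa using inv_sq_re_pos hR), norm_mul, Complex.norm_exp]
  congr 1
  · have : (Real.pi : ℂ) / -(-(1 / R ^ 2)) = ((Real.pi * R ^ 2 : ℝ) : ℂ) := by
      push_cast; field_simp
    rw [this, Complex.norm_cpow_eq_rpow_re_of_pos (by positivity)]
    rw [show ((1 / 2 : ℂ)).re = 1 / 2 by norm_num, ← Real.sqrt_eq_rpow,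
      Real.sqrt_mul Real.pi_pos.le, Real.sqrt_sq hR.le]
  · congr 1
    have : (-(c ^ 2 / R ^ 2) - (2 * c / R ^ 2 + y * Complex.I) ^ 2 / (4 * -(1 / R ^ 2)) : ℂ) =
      ((-(R * y) ^ 2 / 4 : ℝ) : ℂ) + ((c * y : ℝ) : ℂ) * Complex.I := by
      push_cast
      field_simp
      ring_nf
      simp only [Complex.I_sq]
      ring
    rw [this, Complex.add_re, Complex.ofReal_re, Complex.re_ofReal_mul, Complex.I_re, mul_zero,
      add_zero]

theorem gaussian_le_two_pow_floor (y z : ℝ) :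
    Real.exp (-(y - z) ^ 2 / 4) ≤ 4 * (1 / 2) ^ (⌊y⌋ - ⌊z⌋).natAbs := by
  set m := (⌊y⌋ - ⌊z⌋).natAbs with hm
  have hmy : (m : ℝ) ≤ |y - z| + 1 := by
    have : (m : ℝ) = |(⌊y⌋ : ℝ) - ⌊z⌋| := by
      rw [hm, Nat.cast_natAbs]; push_cast; rfl
    rw [this, abs_le]
    have := Int.floor_le y
    have := Int.floor_le z
    have := Int.lt_floor_add_one y
    have := Int.lt_floor_add_one z
    have := neg_abs_le (y - z)
    have := le_abs_self (y - z)
    constructor <;> linarith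
  have h2 : (1 / 2 : ℝ) ^ m = Real.exp (-(m * Real.log 2)) := by
    rw [Real.exp_neg, Real.exp_nat_mul, Real.exp_log two_pos, one_div, inv_pow]
  have h4 : (4 : ℝ) = Real.exp (2 * Real.log 2) := by
    rw [two_mul, Real.exp_add, Real.exp_log two_pos]; norm_num
  have h4m : (4 : ℝ) * (1 / 2) ^ m = Real.exp (2 * Real.log 2 + -(m * Real.log 2)) := by
    rw [h2, Real.exp_add, ← h4]
  rw [h4m, Real.exp_le_exp]
  have hl : Real.log 2 ≤ 1 := by linarith [Real.log_two_lt_d9]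
  have hl0 : 0 < Real.log 2 := Real.log_pos one_lt_two
  have := mul_le_mul_of_nonneg_right hmy hl0.le
  nlinarith [sq_nonneg (|y - z| - 2 * Real.log 2), sq_abs (y - z)]

theorem summable_half_pow_natAbs : Summable fun m : ℤ => (1 / 2 : ℝ) ^ m.natAbs := by
  apply Summable.of_nat_of_neg <;> simpa using summable_geometric_two

theorem sum_mul_two_pow_natAbs_le (F : Finset ℤ) (A : ℤ → ℝ) :
    ∑ i ∈ F, ∑ j ∈ F, A i * A j * (1 / 2) ^ (i - j).natAbs ≤
      (∑' m : ℤ, (1 / 2 : ℝ) ^ m.natAbs) * ∑ i ∈ F, A i ^ 2 := by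
  have hrow (i : ℤ) : ∑ j ∈ F, (1 / 2 : ℝ) ^ (i - j).natAbs ≤ ∑' m : ℤ, (1 / 2 : ℝ) ^ m.natAbs := by
    rw [← (Equiv.subLeft i).tsum_eq fun m : ℤ => (1 / 2 : ℝ) ^ m.natAbs]
    exact ((Equiv.subLeft i).summable_iff.2 summable_half_pow_natAbs).sum_le_tsum F
      fun _ _ => by positivity
  have hswap : ∑ i ∈ F, ∑ j ∈ F, A j ^ 2 / 2 * (1 / 2 : ℝ) ^ (i - j).natAbs =
      ∑ i ∈ F, ∑ j ∈ F, A i ^ 2 / 2 * (1 / 2 : ℝ) ^ (i - j).natAbs := by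
    rw [Finset.sum_comm]
    refine Finset.sum_congr rfl fun i _ => Finset.sum_congr rfl fun j _ => ?_
    rw [← Int.natAbs_neg, neg_sub]
  calc ∑ i ∈ F, ∑ j ∈ F, A i * A j * (1 / 2 : ℝ) ^ (i - j).natAbs
      ≤ ∑ i ∈ F, ∑ j ∈ F, (A i ^ 2 / 2 * (1 / 2 : ℝ) ^ (i - j).natAbs +
          A j ^ 2 / 2 * (1 / 2 : ℝ) ^ (i - j).natAbs) := by
        gcongr with i _ j _
        rw [← add_mul]
        gcongr
        linarith [two_mul_le_add_sq (A i) (A j)]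
    _ = ∑ i ∈ F, A i ^ 2 * ∑ j ∈ F, (1 / 2 : ℝ) ^ (i - j).natAbs := by
        simp_rw [Finset.sum_add_distrib]
        rw [hswap, ← Finset.sum_add_distrib]
        refine Finset.sum_congr rfl fun i _ => ?_
        rw [← Finset.mul_sum, ← add_mul, add_halves]
    _ ≤ _ := by
        rw [mul_comm, Finset.sum_mul]
        gcongr with i _
        exact hrow i

theorem sum_mul_gaussian_le {ι : Type*} (s : Finset ι) (y α : ι → ℝ) (hα : ∀ k, 0 ≤ α k) :
    ∑ k ∈ s, ∑ l ∈ s, α k * α l * Real.exp (-(y k - y l) ^ 2 / 4) ≤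
      4 * (∑' m : ℤ, (1 / 2 : ℝ) ^ m.natAbs) *
        ∑ k ∈ s, (#{l ∈ s | |y k - y l| ≤ 1} : ℝ) * α k ^ 2 := by
  set F := s.image fun k => ⌊y k⌋
  have hmaps : ∀ k ∈ s, ⌊y k⌋ ∈ F := fun k hk => Finset.mem_image_of_mem _ hk
  set A : ℤ → ℝ := fun i => ∑ k ∈ s with ⌊y k⌋ = i, α k with hA
  have hbins : ∑ k ∈ s, ∑ l ∈ s, α k * α l * (1 / 2 : ℝ) ^ (⌊y k⌋ - ⌊y l⌋).natAbs =
      ∑ i ∈ F, ∑ j ∈ F, A i * A j * (1 / 2) ^ (i - j).natAbs := by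
    rw [← Finset.sum_fiberwise_of_maps_to hmaps
      fun k => ∑ l ∈ s, α k * α l * (1 / 2 : ℝ) ^ (⌊y k⌋ - ⌊y l⌋).natAbs]
    refine Finset.sum_congr rfl fun i _ => ?_
    simp_rw [hA, Finset.sum_mul_sum, Finset.sum_mul]
    refine Eq.trans (Finset.sum_congr rfl fun k hk => ?_) Finset.sum_comm
    rw [← Finset.sum_fiberwise_of_maps_to hmaps
      fun l => α k * α l * (1 / 2 : ℝ) ^ (⌊y k⌋ - ⌊y l⌋).natAbs]
    refine Finset.sum_congr rfl fun j _ => Finset.sum_congr rfl fun l hl => ?_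
    rw [(Finset.mem_filter.1 hk).2, (Finset.mem_filter.1 hl).2]
  have hsq : ∑ i ∈ F, A i ^ 2 ≤ ∑ k ∈ s, (#{l ∈ s | |y k - y l| ≤ 1} : ℝ) * α k ^ 2 := by
    rw [← Finset.sum_fiberwise_of_maps_to hmaps]
    gcongr with i _
    refine sq_sum_le_card_mul_sum_sq.trans ?_
    rw [Finset.mul_sum]
    gcongr with k hk l hl
    intro hli
    rw [← (Finset.mem_filter.1 hk).2] at hli
    exact (Int.abs_sub_lt_one_of_floor_eq_floor hli.symm).le
  calc _ ≤ ∑ k ∈ s, ∑ l ∈ s, 4 * (α k * α l * (1 / 2 : ℝ) ^ (⌊y k⌋ - ⌊y l⌋).natAbs) := by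
        refine Finset.sum_le_sum fun k _ => Finset.sum_le_sum fun l _ => ?_
        have := mul_le_mul_of_nonneg_left (gaussian_le_two_pow_floor (y k) (y l))
          (mul_nonneg (hα k) (hα l))
        linarith
    _ = 4 * ∑ i ∈ F, ∑ j ∈ F, A i * A j * (1 / 2) ^ (i - j).natAbs := by
        rw [← hbins]
        simp_rw [Finset.mul_sum]
    _ ≤ 4 * ((∑' m : ℤ, (1 / 2 : ℝ) ^ m.natAbs) *
        ∑ k ∈ s, (#{l ∈ s | |y k - y l| ≤ 1} : ℝ) * α k ^ 2) := by
        gcongr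
        refine (sum_mul_two_pow_natAbs_le F A).trans ?_
        gcongr
    _ = _ := by ring

theorem gaussian_mul_norm_sq_eq {ι : Type*} (s : Finset ι) (x : ι → ℝ) (b : ι → ℂ) (c R t : ℝ) :
    ((Real.exp (-((t - c) / R) ^ 2) *
        ‖∑ k ∈ s, b k * Complex.exp (-(t * x k) * Complex.I)‖ ^ 2 : ℝ) : ℂ) =
      ∑ k ∈ s, ∑ l ∈ s, b k * (starRingEnd ℂ) (b l) *
        (((Real.exp (-((t - c) / R) ^ 2) : ℝ) : ℂ) *
          Complex.exp (t * ((x l - x k : ℝ) : ℂ) * Complex.I)) := by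
  rw [Complex.ofReal_mul, Complex.ofReal_pow, ← Complex.mul_conj', map_sum, Finset.sum_mul_sum,
    Finset.mul_sum]
  refine Finset.sum_congr rfl fun k _ => ?_
  rw [Finset.mul_sum]
  refine Finset.sum_congr rfl fun l _ => ?_
  rw [map_mul, ← Complex.exp_conj]
  have : Complex.exp (t * ((x l - x k : ℝ) : ℂ) * Complex.I) =
      Complex.exp (-(t * x k) * Complex.I) *
        Complex.exp ((starRingEnd ℂ) (-(t * x l) * Complex.I)) := by
    rw [← Complex.exp_add]
    congr 1
    simp
    ring
  rw [this]
  ring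

theorem integrable_gaussian_mul_norm_sq {ι : Type*} (s : Finset ι) (x : ι → ℝ) (b : ι → ℂ)
    (c : ℝ) {R : ℝ} (hR : 0 < R) :
    Integrable fun t : ℝ => Real.exp (-((t - c) / R) ^ 2) *
        ‖∑ k ∈ s, b k * Complex.exp (-(t * x k) * Complex.I)‖ ^ 2 := by
  have h : Integrable fun t : ℝ => ((Real.exp (-((t - c) / R) ^ 2) *
        ‖∑ k ∈ s, b k * Complex.exp (-(t * x k) * Complex.I)‖ ^ 2 : ℝ) : ℂ) := by
    simp_rw [gaussian_mul_norm_sq_eq]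
    exact integrable_finsetSum _ fun k _ => integrable_finsetSum _ fun l _ =>
      (integrable_gaussian_mul_cexp c _ hR).const_mul _
  exact h.re

theorem integral_gaussian_mul_norm_sq_le {ι : Type*} (s : Finset ι) (x : ι → ℝ) (b : ι → ℂ)
    (c : ℝ) {R : ℝ} (hR : 0 < R) :
    ∫ t : ℝ, Real.exp (-((t - c) / R) ^ 2) *
        ‖∑ k ∈ s, b k * Complex.exp (-(t * x k) * Complex.I)‖ ^ 2 ≤
      √Real.pi * R * (4 * (∑' m : ℤ, (1 / 2 : ℝ) ^ m.natAbs) *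
        ∑ k ∈ s, (#{l ∈ s | |R * x k - R * x l| ≤ 1} : ℝ) * ‖b k‖ ^ 2) := by
  refine (le_abs_self _).trans ?_
  rw [← Real.norm_eq_abs, ← Complex.norm_real, ← integral_complex_ofReal]
  simp_rw [gaussian_mul_norm_sq_eq]
  have hint (k l : ι) := (integrable_gaussian_mul_cexp c (x l - x k) hR).const_mul
    (b k * (starRingEnd ℂ) (b l))
  rw [integral_finsetSum _ fun k _ => integrable_finsetSum _ fun l _ => hint k l]
  simp_rw [fun k => integral_finsetSum s fun l _ => hint k l, integral_const_mul]
  calc _ ≤ ∑ k ∈ s, ∑ l ∈ s, √Real.pi * R *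
        (‖b k‖ * ‖b l‖ * Real.exp (-(R * x k - R * x l) ^ 2 / 4)) := by
        refine (norm_sum_le _ _).trans (Finset.sum_le_sum fun k _ =>
          (norm_sum_le _ _).trans (Finset.sum_le_sum fun l _ => le_of_eq ?_))
        rw [norm_mul, norm_integral_gaussian_mul_cexp c _ hR, norm_mul, RCLike.norm_conj,
          show (R * (x l - x k)) ^ 2 = (R * x k - R * x l) ^ 2 by ring]
        ring
    _ = √Real.pi * R * ∑ k ∈ s, ∑ l ∈ s,
        (‖b k‖ * ‖b l‖ * Real.exp (-(R * x k - R * x l) ^ 2 / 4)) := by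
        simp_rw [Finset.mul_sum]
    _ ≤ _ := by
        gcongr
        exact sum_mul_gaussian_le s (fun k => R * x k) _ fun k => norm_nonneg _

theorem hasDerivAt_dirichlet_sum {ι : Type*} (s : Finset ι) (x : ι → ℝ) (b : ι → ℂ) (t : ℝ) :
    HasDerivAt (fun u : ℝ => ∑ k ∈ s, b k * Complex.exp (-(u * x k) * Complex.I))
      (∑ k ∈ s, (-(b k * x k * Complex.I)) * Complex.exp (-(t * x k) * Complex.I)) t := by
  refine HasDerivAt.fun_sum fun k _ => ?_
  have h : HasDerivAt (fun u : ℝ => -((u : ℂ) * x k) * Complex.I) (-(1 * x k) * Complex.I) t :=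
    ((Complex.ofRealCLM.hasDerivAt (x := t)).mul_const (x k : ℂ)).neg.mul_const Complex.I
  refine (h.cexp.const_mul (b k)).congr_deriv ?_
  ring

theorem sum_norm_sq_le_integral_gaussian {f f' : ℝ → ℂ} (hf : ∀ u, HasDerivAt f (f' u) u)
    (hf' : Continuous f') {c R T₀ T δ L : ℝ} (hR : 0 < R) (hδ : 0 < δ) (hL : 0 < L)
    (hc : c = T₀ + T / 2) (hTR : T ≤ R)
    (hi : Integrable fun t => Real.exp (-((t - c) / R) ^ 2) * ‖f t‖ ^ 2)
    (hi' : Integrable fun t => Real.exp (-((t - c) / R) ^ 2) * ‖f' t‖ ^ 2)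
    (P : Finset ℝ) (hP : ∀ t ∈ P, t ∈ Set.Icc (T₀ + δ / 2) (T₀ + T - δ / 2))
    (hsep : ∀ t ∈ P, ∀ t' ∈ P, t ≠ t' → δ ≤ |t - t'|) :
    ∑ t ∈ P, ‖f t‖ ^ 2 ≤ Real.exp 1 *
      ((1 / δ + L) * ∫ t, Real.exp (-((t - c) / R) ^ 2) * ‖f t‖ ^ 2) +
      Real.exp 1 * (1 / L * ∫ t, Real.exp (-((t - c) / R) ^ 2) * ‖f' t‖ ^ 2) := by
  have hfc : Continuous f := continuous_iff_continuousAt.2 fun u => (hf u).continuousAt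
  have hg : Continuous fun u => 1 / δ * ‖f u‖ ^ 2 + 2 * (‖f u‖ * ‖f' u‖) := by fun_prop
  set G : ℝ → ℝ := fun u => Real.exp 1 *
      ((1 / δ + L) * (Real.exp (-((u - c) / R) ^ 2) * ‖f u‖ ^ 2)) +
      Real.exp 1 * (1 / L * (Real.exp (-((u - c) / R) ^ 2) * ‖f' u‖ ^ 2)) with hG
  have hG1 := (hi.const_mul (1 / δ + L)).const_mul (Real.exp 1)
  have hG2 := (hi'.const_mul (1 / L)).const_mul (Real.exp 1)
  have hGi : Integrable G := hG1.add hG2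
  have hG0 : ∀ u, 0 ≤ G u := fun u => by positivity
  have hle : ∀ u ∈ Set.Icc T₀ (T₀ + T), 1 / δ * ‖f u‖ ^ 2 + 2 * (‖f u‖ * ‖f' u‖) ≤ G u := by
    intro u hu
    have hw : 1 ≤ Real.exp 1 * Real.exp (-((u - c) / R) ^ 2) := by
      rw [← Real.exp_add, Real.one_le_exp_iff]
      have : ((u - c) / R) ^ 2 ≤ 1 := by
        rw [sq_le_one_iff_abs_le_one, abs_div, abs_of_pos hR, div_le_one hR, abs_le]
        constructor <;> linarith [hu.1, hu.2]
      linarith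
    have hag : 2 * (‖f u‖ * ‖f' u‖) ≤ L * ‖f u‖ ^ 2 + 1 / L * ‖f' u‖ ^ 2 := by
      have h := mul_nonneg (one_div_pos.2 hL).le (sq_nonneg (L * ‖f u‖ - ‖f' u‖))
      have h' : 1 / L * (L * ‖f u‖ - ‖f' u‖) ^ 2 =
          L * ‖f u‖ ^ 2 + 1 / L * ‖f' u‖ ^ 2 - 2 * (‖f u‖ * ‖f' u‖) := by
        field_simp
        ring
      linarith
    have hnn : 0 ≤ (1 / δ + L) * ‖f u‖ ^ 2 + 1 / L * ‖f' u‖ ^ 2 := by positivity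
    have := mul_le_mul_of_nonneg_right hw hnn
    simp only [hG]
    linarith
  have hdisj : (P : Set ℝ).Pairwise
      (Function.onFun Disjoint fun t => Set.Ioc (t - δ / 2) (t + δ / 2)) := by
    intro t ht t' ht' hne
    rw [Function.onFun, Set.disjoint_left]
    intro u hu hu'
    have h := hsep t ht t' ht' hne
    have : |t - t'| < δ := abs_lt.2 ⟨by linarith [hu.2, hu'.1], by linarith [hu.1, hu'.2]⟩
    linarith
  calc ∑ t ∈ P, ‖f t‖ ^ 2 ≤ ∑ t ∈ P, ∫ u in Set.Ioc (t - δ / 2) (t + δ / 2), G u := by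
        refine Finset.sum_le_sum fun t ht => (norm_sq_le_integral_nhd hf hf' t hδ).trans ?_
        refine setIntegral_mono_on hg.integrableOn_Ioc hGi.integrableOn measurableSet_Ioc
          fun u hu => hle u ⟨?_, ?_⟩
        · linarith [(hP t ht).1, hu.1]
        · linarith [(hP t ht).2, hu.2]
    _ = ∫ u in ⋃ t ∈ P, Set.Ioc (t - δ / 2) (t + δ / 2), G u :=
        (integral_biUnion_finset P (fun _ _ => measurableSet_Ioc) hdisj
          fun _ _ => hGi.integrableOn).symm
    _ ≤ ∫ u, G u := setIntegral_le_integral hGi (Filter.Eventually.of_forall hG0)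
    _ = _ := by
        rw [hG, integral_add hG1 hG2]
        simp_rw [integral_const_mul]

theorem abs_sub_le_mul_abs_log_sub_s1 {p q N : ℝ} (hp : 0 < p) (hq : 0 < q) (hpN : p ≤ N)
    (hqN : q ≤ N) : |p - q| ≤ N * |Real.log p - Real.log q| := by
  wlog h : q ≤ p generalizing p q
  · rw [abs_sub_comm, abs_sub_comm (Real.log p)]
    exact this hq hp hqN hpN (le_of_not_ge h)
  have hl := Real.log_le_log hq h
  rw [abs_of_nonneg (sub_nonneg.2 h), abs_of_nonneg (sub_nonneg.2 hl)]
  have h1 := Real.log_le_sub_one_of_pos (div_pos hq hp)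
  rw [Real.log_div hq.ne' hp.ne'] at h1
  have h2 : p * (1 - q / p) = p - q := by field_simp
  have h3 : p * (1 - q / p) ≤ p * (Real.log p - Real.log q) :=
    mul_le_mul_of_nonneg_left (by linarith) hp.le
  have h4 : p * (Real.log p - Real.log q) ≤ N * (Real.log p - Real.log q) := by gcongr
  linarith

/-- **Discrete mean value theorem for generalized Dirichlet polynomials.**
There is an absolute constant `C > 0` such that for all real `1 ≤ n 0 ≤ ⋯ ≤ n K ≤ N`
(`N > 1`), complex coefficients `a k`, the generalized Dirichlet polynomial
`S(t) = ∑_{k ≤ K} a k * (n k)^(-i t)`, all `T₀ ∈ ℝ`, `T > 0`, `δ > 0`, every finite set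
`𝒯 ⊆ [T₀ + δ/2, T₀ + T - δ/2]` of `δ`-well-spaced points, and every `η > 0`:
`∑_{t ∈ 𝒯} |S(t)|² ≤ C (T + 1/η)(log N + 1/δ) ∑_{k ≤ K} χ(n k, η N) |a k|²`,
where `χ(x, λ) = #{l ≤ K : |x - n l| ≤ λ}`. -/
theorem discrete_mean_value_theorem_generalized_dirichlet :
    ∃ C : ℝ, 0 < C ∧
      ∀ (N : ℝ) (K : ℕ) (n : ℕ → ℝ) (a : ℕ → ℂ),
        1 < N → 1 ≤ n 0 → (∀ k, k < K → n k ≤ n (k + 1)) → n K ≤ N →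
        ∀ T₀ T δ : ℝ, 0 < T → 0 < δ →
        ∀ 𝒯 : Finset ℝ,
          (∀ t ∈ 𝒯, t ∈ Set.Icc (T₀ + δ / 2) (T₀ + T - δ / 2)) →
          (∀ t ∈ 𝒯, ∀ t' ∈ 𝒯, t ≠ t' → δ ≤ |t - t'|) →
        ∀ η : ℝ, 0 < η →
          (∑ t ∈ 𝒯,
              ‖∑ k ∈ Finset.range (K + 1), a k * (n k : ℂ) ^ (-(t : ℂ) * Complex.I)‖ ^ 2)
            ≤ C * (T + 1 / η) * (Real.log N + 1 / δ) *
              ∑ k ∈ Finset.range (K + 1),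
                (Set.ncard {l : ℕ | l ≤ K ∧ |n k - n l| ≤ η * N} : ℝ) * ‖a k‖ ^ 2 := by
  set M := ∑' m : ℤ, (1 / 2 : ℝ) ^ m.natAbs
  have hM0 : 0 < M := summable_half_pow_natAbs.tsum_pos (fun _ => by positivity) 0 (by simp)
  refine ⟨Real.exp 1 * √Real.pi * (4 * M) * 2, by positivity, ?_⟩
  intro N K n a hN hn0 hmono hnK T₀ T δ hT hδ P hP hsep η hη
  have hmono' : ∀ k l, k ≤ l → l ≤ K → n k ≤ n l := by
    intro k l hkl
    induction l, hkl using Nat.le_induction with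
    | base => exact fun _ => le_rfl
    | succ l _ ih => exact fun hl => (ih (by omega)).trans (hmono l hl)
  have hn1 : ∀ k ∈ range (K + 1), 1 ≤ n k := fun k hk =>
    hn0.trans (hmono' 0 k k.zero_le (Nat.lt_succ_iff.1 (mem_range.1 hk)))
  have hnN : ∀ k ∈ range (K + 1), n k ≤ N := fun k hk =>
    (hmono' k K (Nat.lt_succ_iff.1 (mem_range.1 hk)) le_rfl).trans hnK
  set x : ℕ → ℝ := fun k => Real.log (n k) with hx
  have hL : 0 < Real.log N := Real.log_pos hN
  set L := Real.log N
  set R := T + 1 / η with hR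
  have hη' : 0 < 1 / η := by positivity
  have hR0 : 0 < R := by positivity
  have hTR : T ≤ R := by linarith
  set X := ∑ k ∈ range (K + 1),
    (Set.ncard {l : ℕ | l ≤ K ∧ |n k - n l| ≤ η * N} : ℝ) * ‖a k‖ ^ 2 with hX
  have hS : ∀ t : ℝ, ∑ k ∈ range (K + 1), a k * (n k : ℂ) ^ (-(t : ℂ) * Complex.I) =
      ∑ k ∈ range (K + 1), a k * Complex.exp (-(t * x k) * Complex.I) := by
    intro t
    refine Finset.sum_congr rfl fun k hk => ?_
    have hk0 : 0 < n k := one_pos.trans_le (hn1 k hk)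
    rw [Complex.cpow_def_of_ne_zero (by exact_mod_cast hk0.ne'), ← Complex.ofReal_log hk0.le]
    congr 2
    ring
  simp_rw [hS]
  have hcard : ∀ k ∈ range (K + 1), (#{l ∈ range (K + 1) | |R * x k - R * x l| ≤ 1} : ℝ) ≤
      Set.ncard {l : ℕ | l ≤ K ∧ |n k - n l| ≤ η * N} := by
    intro k hk
    rw [← Set.ncard_coe_finset]
    refine Nat.cast_le.2 (Set.ncard_le_ncard ?_ ((Set.finite_Iic K).subset fun l hl => hl.1))
    intro l hl
    obtain ⟨hlK, hl⟩ := Finset.mem_filter.1 (Finset.mem_coe.1 hl)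
    refine ⟨Nat.lt_succ_iff.1 (mem_range.1 hlK), ?_⟩
    rw [← mul_sub, abs_mul, abs_of_pos hR0] at hl
    have h1 := abs_sub_le_mul_abs_log_sub_s1 (one_pos.trans_le (hn1 k hk))
      (one_pos.trans_le (hn1 l hlK)) (hnN k hk) (hnN l hlK)
    have h2 : 1 / η * |x k - x l| ≤ 1 :=
      (mul_le_mul_of_nonneg_right (by linarith) (abs_nonneg _)).trans hl
    have h3 : |x k - x l| ≤ η := by
      rwa [one_div, ← div_eq_inv_mul, div_le_one hη] at h2
    calc |n k - n l| ≤ N * |x k - x l| := h1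
      _ ≤ N * η := by gcongr
      _ = η * N := mul_comm _ _
  have hdb : ∀ k ∈ range (K + 1), ‖-(a k * x k * Complex.I)‖ ^ 2 ≤ L ^ 2 * ‖a k‖ ^ 2 := by
    intro k hk
    have h0 : 0 ≤ x k := Real.log_nonneg (hn1 k hk)
    have h1 : x k ≤ L := Real.log_le_log (one_pos.trans_le (hn1 k hk)) (hnN k hk)
    rw [norm_neg, norm_mul, norm_mul, Complex.norm_I, mul_one, Complex.norm_real, mul_pow,
      Real.norm_of_nonneg h0, mul_comm]
    gcongr
  have h1 := integral_gaussian_mul_norm_sq_le (range (K + 1)) x a (T₀ + T / 2) hR0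
  have h2 := integral_gaussian_mul_norm_sq_le (range (K + 1)) x
    (fun k => -(a k * x k * Complex.I)) (T₀ + T / 2) hR0
  have hX1 : ∑ k ∈ range (K + 1),
      (#{l ∈ range (K + 1) | |R * x k - R * x l| ≤ 1} : ℝ) * ‖a k‖ ^ 2 ≤ X := by
    rw [hX]
    exact Finset.sum_le_sum fun k hk => mul_le_mul_of_nonneg_right (hcard k hk) (by positivity)
  have hX2 : ∑ k ∈ range (K + 1), (#{l ∈ range (K + 1) | |R * x k - R * x l| ≤ 1} : ℝ) *
      ‖-(a k * x k * Complex.I)‖ ^ 2 ≤ L ^ 2 * X := by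
    rw [hX, Finset.mul_sum]
    refine Finset.sum_le_sum fun k hk => ?_
    rw [mul_left_comm]
    exact mul_le_mul (hcard k hk) (hdb k hk) (by positivity) (by positivity)
  have hX0 : 0 ≤ X := by positivity
  calc _ ≤ _ := sum_norm_sq_le_integral_gaussian
        (hasDerivAt_dirichlet_sum (range (K + 1)) x a) (by fun_prop) hR0 hδ hL rfl hTR
        (integrable_gaussian_mul_norm_sq _ x a _ hR0) (integrable_gaussian_mul_norm_sq _ x _ _ hR0)
        P hP hsep
    _ ≤ Real.exp 1 * ((1 / δ + L) * (√Real.pi * R * (4 * M * X))) +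
        Real.exp 1 * (1 / L * (√Real.pi * R * (4 * M * (L ^ 2 * X)))) := by
      gcongr
      · exact h1.trans (by gcongr)
      · exact h2.trans (by gcongr)
    _ = Real.exp 1 * √Real.pi * (4 * M) * R * (1 / δ + 2 * L) * X := by
      field_simp
      ring
    _ ≤ Real.exp 1 * √Real.pi * (4 * M) * R * (2 * (L + 1 / δ)) * X := by
      gcongr
      linarith [one_div_pos.2 hδ]
    _ = _ := by ring
end

section
/- There is an absolute constant C > 0 such that the following holds. Let N > 1 and let 1 ≤ n_0 ≤ n_1 ≤ … ≤ n_K ≤ N be real numbers, let a_0, …, a_K be complex numbers, and set S(t) = ∑_{k=0}^{K} a_k n_k^{-it}. Let T_0 ∈ ℝ, T > 0, δ > 0, and let 𝒯 ⊆ [T_0 + δ/2, T_0 + T − δ/2] be a finite set of δ-well-spaced points, i.e. |t − t'| ≥ δ for all distinct t, t' ∈ 𝒯. If V > 0 is such that |S(t)| ≥ V for every t ∈ 𝒯, then for every η > 0, |𝒯| ≤ C V^{-2} (T + 1/η)(log N + 1/δ) ∑_{k=0}^{K} χ(n_k, ηN) |a_k|². -/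
lemma exists_sum_exp_neg_abs_sub_le :
    ∃ G : ℝ, 0 < G ∧ ∀ (J : Finset ℤ) (i : ℤ),
      ∑ j ∈ J, Real.exp (-|((i - j : ℤ) : ℝ)|) ≤ G := by
  have h : Summable fun j : ℤ => Real.exp (-|(j : ℝ)|) := by
    have h0 : Summable fun j : ℕ => Real.exp (-(j : ℝ)) := Real.summable_exp_neg_nat
    refine Summable.of_nat_of_neg ?_ ?_ <;> simpa using h0
  have hG : 0 < ∑' j : ℤ, Real.exp (-|(j : ℝ)|) :=
    h.tsum_pos (fun _ => (Real.exp_pos _).le) 0 (Real.exp_pos _)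
  refine ⟨_, hG, fun J i => ?_⟩
  have hinj : Function.Injective fun j : ℤ => i - j := sub_right_injective
  calc ∑ j ∈ J, Real.exp (-|((i - j : ℤ) : ℝ)|)
      = ∑ j ∈ J.map ⟨_, hinj⟩, Real.exp (-|(j : ℝ)|) := by simp
    _ ≤ _ := h.sum_le_tsum _ fun _ _ => (Real.exp_pos _).le

lemma gaussian_le_exp_neg_abs_floor_sub {η : ℝ} (hη : 0 < η) (x y : ℝ) :
    Real.exp (-(x - y) ^ 2 / (4 * η ^ 2))
      ≤ Real.exp 2 * Real.exp (-|((⌊x / η⌋ - ⌊y / η⌋ : ℤ) : ℝ)|) := by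
  rw [← Real.exp_add, Real.exp_le_exp]
  have key : |((⌊x / η⌋ - ⌊y / η⌋ : ℤ) : ℝ)| ≤ |x / η - y / η| + 1 := by
    have h1 := Int.floor_le (x / η)
    have h2 := Int.lt_floor_add_one (x / η)
    have h3 := Int.floor_le (y / η)
    have h4 := Int.lt_floor_add_one (y / η)
    have h5 := le_abs_self (x / η - y / η)
    have h6 := neg_abs_le (x / η - y / η)
    push_cast
    rw [abs_le]
    constructor <;> linarith
  have e : -(x - y) ^ 2 / (4 * η ^ 2) = -|x / η - y / η| ^ 2 / 4 := by
    rw [sq_abs]; field_simp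
  rw [e]
  nlinarith [sq_nonneg (|x / η - y / η| - 2)]

lemma sum_mul_mul_le_of_row_sum_le {J : Finset ℤ} {A : ℤ → ℝ} {E : ℤ → ℤ → ℝ} {G : ℝ}
    (hE : ∀ i j, 0 ≤ E i j) (hsymm : ∀ i j, E i j = E j i)
    (hG : ∀ i, ∑ j ∈ J, E i j ≤ G) :
    ∑ i ∈ J, ∑ j ∈ J, A i * A j * E i j ≤ G * ∑ i ∈ J, A i ^ 2 := by
  have h1 : ∑ i ∈ J, ∑ j ∈ J, A i ^ 2 * E i j ≤ G * ∑ i ∈ J, A i ^ 2 := by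
    rw [Finset.mul_sum]
    refine Finset.sum_le_sum fun i _ => ?_
    rw [← Finset.mul_sum, mul_comm]
    exact mul_le_mul_of_nonneg_right (hG i) (sq_nonneg _)
  have h2 : ∑ i ∈ J, ∑ j ∈ J, A j ^ 2 * E i j = ∑ i ∈ J, ∑ j ∈ J, A i ^ 2 * E i j := by
    rw [Finset.sum_comm]
    exact Finset.sum_congr rfl fun i _ => Finset.sum_congr rfl fun j _ => by rw [hsymm]
  have h3 : ∑ i ∈ J, ∑ j ∈ J, A i * A j * E i j
      ≤ ∑ i ∈ J, ∑ j ∈ J, (A i ^ 2 * E i j + A j ^ 2 * E i j) / 2 := by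
    refine Finset.sum_le_sum fun i _ => Finset.sum_le_sum fun j _ => ?_
    nlinarith [mul_nonneg (sq_nonneg (A i - A j)) (hE i j)]
  simp only [← Finset.sum_div, Finset.sum_add_distrib] at h3
  linarith

lemma exists_sum_mul_mul_gaussian_le :
    ∃ G : ℝ, 0 < G ∧ ∀ {ι : Type} (s : Finset ι) (b ν : ι → ℝ) (η : ℝ), 0 < η →
      (∀ k, 0 ≤ b k) →
      ∑ k ∈ s, ∑ l ∈ s, b k * b l * Real.exp (-(ν k - ν l) ^ 2 / (4 * η ^ 2))
        ≤ G * ∑ k ∈ s, ((s.filter fun l => |ν k - ν l| ≤ η).card : ℝ) * b k ^ 2 := by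
  obtain ⟨G, hG0, hG⟩ := exists_sum_exp_neg_abs_sub_le
  refine ⟨Real.exp 2 * G, by positivity, fun {ι} s b ν η hη hb => ?_⟩
  classical
  set c : ι → ℤ := fun k => ⌊ν k / η⌋ with hc
  set E : ℤ → ℤ → ℝ := fun i j => Real.exp (-|((i - j : ℤ) : ℝ)|) with hE
  set J := s.image c
  set B : ℤ → Finset ι := fun i => s.filter fun k => c k = i with hB
  set A : ℤ → ℝ := fun i => ∑ k ∈ B i, b k with hA
  have hmaps : ∀ k ∈ s, c k ∈ J := fun k hk => Finset.mem_image_of_mem c hk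
  have h1 : ∑ k ∈ s, ∑ l ∈ s, b k * b l * Real.exp (-(ν k - ν l) ^ 2 / (4 * η ^ 2))
      ≤ Real.exp 2 * ∑ k ∈ s, ∑ l ∈ s, b k * b l * E (c k) (c l) := by
    simp only [Finset.mul_sum]
    refine Finset.sum_le_sum fun k _ => Finset.sum_le_sum fun l _ => ?_
    have := mul_le_mul_of_nonneg_left (gaussian_le_exp_neg_abs_floor_sub hη (ν k) (ν l))
      (mul_nonneg (hb k) (hb l))
    simp only [hE, hc]
    linarith
  have h2 : ∑ k ∈ s, ∑ l ∈ s, b k * b l * E (c k) (c l)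
      = ∑ i ∈ J, ∑ j ∈ J, A i * A j * E i j := by
    rw [← Finset.sum_fiberwise_of_maps_to hmaps]
    refine Finset.sum_congr rfl fun i _ => ?_
    have : ∀ k ∈ B i, ∑ l ∈ s, b k * b l * E (c k) (c l) = b k * ∑ j ∈ J, A j * E i j := by
      intro k hk
      rw [← Finset.sum_fiberwise_of_maps_to hmaps, Finset.mul_sum]
      refine Finset.sum_congr rfl fun j _ => ?_
      rw [hA, Finset.sum_mul, Finset.mul_sum]
      refine Finset.sum_congr rfl fun l hl => ?_
      rw [(Finset.mem_filter.1 hk).2, (Finset.mem_filter.1 hl).2, mul_assoc]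
    rw [Finset.sum_congr rfl this, ← Finset.sum_mul, Finset.mul_sum]
    exact Finset.sum_congr rfl fun j _ => by rw [mul_assoc]
  have h3 : ∑ i ∈ J, ∑ j ∈ J, A i * A j * E i j ≤ G * ∑ i ∈ J, A i ^ 2 :=
    sum_mul_mul_le_of_row_sum_le (fun _ _ => (Real.exp_pos _).le)
      (fun i j => by simp only [hE, Int.cast_sub, abs_sub_comm]) fun i => hG J i
  have h4 : ∑ i ∈ J, A i ^ 2
      ≤ ∑ k ∈ s, ((s.filter fun l => |ν k - ν l| ≤ η).card : ℝ) * b k ^ 2 := by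
    rw [← Finset.sum_fiberwise_of_maps_to hmaps]
    refine Finset.sum_le_sum fun i _ => (sq_sum_le_card_mul_sum_sq).trans ?_
    rw [Finset.mul_sum]
    refine Finset.sum_le_sum fun k hk => ?_
    refine mul_le_mul_of_nonneg_right ?_ (sq_nonneg _)
    norm_cast
    refine Finset.card_le_card fun l hl => ?_
    have hk' := (Finset.mem_filter.1 hk).2
    obtain ⟨hls, hl'⟩ := Finset.mem_filter.1 hl
    refine Finset.mem_filter.2 ⟨hls, ?_⟩
    have h5 : |ν k / η - ν l / η| < 1 := Int.abs_sub_lt_one_of_floor_eq_floor (hk'.trans hl'.symm)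
    rw [← sub_div, abs_div, abs_of_pos hη, div_lt_one hη] at h5
    exact h5.le
  calc _ ≤ Real.exp 2 * ∑ k ∈ s, ∑ l ∈ s, b k * b l * E (c k) (c l) := h1
    _ ≤ Real.exp 2 * (G * ∑ i ∈ J, A i ^ 2) := by rw [h2]; gcongr
    _ ≤ _ := by rw [mul_assoc]; gcongr

/-- The exponential sum `∑ k ∈ s, a k * exp (-i t ν k)`. -/
noncomputable def expSum {ι : Type} (s : Finset ι) (a : ι → ℂ) (ν : ι → ℝ) (t : ℝ) : ℂ :=
  ∑ k ∈ s, a k * Complex.exp (-(t : ℂ) * ν k * Complex.I)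

lemma hasDerivAt_expSum {ι : Type} (s : Finset ι) (a : ι → ℂ) (ν : ι → ℝ) (t : ℝ) :
    HasDerivAt (expSum s a ν) (expSum s (fun k => a k * (-ν k * Complex.I)) ν t) t := by
  unfold expSum
  refine HasDerivAt.fun_sum fun k _ => ?_
  have h1 : HasDerivAt (fun t : ℝ => -(t : ℂ) * ν k * Complex.I) (-1 * ν k * Complex.I) t :=
    ((Complex.ofRealCLM.hasDerivAt.neg).mul_const _).mul_const _
  exact (h1.cexp.const_mul (a k)).congr_deriv (by ring)

lemma continuous_expSum {ι : Type} (s : Finset ι) (a : ι → ℂ) (ν : ι → ℝ) :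
    Continuous (expSum s a ν) := by
  unfold expSum
  fun_prop

lemma expSum_add {ι : Type} (s : Finset ι) (a : ι → ℂ) (ν : ι → ℝ) (t u : ℝ) :
    expSum s a ν (t + u)
      = expSum s (fun k => a k * Complex.exp (-(u : ℂ) * ν k * Complex.I)) ν t := by
  refine Finset.sum_congr rfl fun k _ => ?_
  beta_reduce
  rw [mul_assoc (a k), ← Complex.exp_add]
  push_cast
  ring_nf

lemma ofReal_norm_expSum_sq_mul_gaussian {ι : Type} (s : Finset ι) (a : ι → ℂ) (ν : ι → ℝ)
    (b t : ℝ) :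
    ((‖expSum s a ν t‖ ^ 2 * Real.exp (-b * t ^ 2) : ℝ) : ℂ)
      = ∑ k ∈ s, ∑ l ∈ s, a k * star (a l) *
          (Complex.exp (Complex.I * ((ν l - ν k : ℝ) : ℂ) * t) *
            Complex.exp (-(b : ℂ) * (t : ℂ) ^ 2)) := by
  push_cast
  rw [← Complex.mul_conj', expSum, map_sum, Finset.sum_mul_sum, Finset.sum_mul]
  refine Finset.sum_congr rfl fun k _ => ?_
  rw [Finset.sum_mul]
  refine Finset.sum_congr rfl fun l _ => ?_
  have h : Complex.exp (Complex.I * ((ν l : ℂ) - ν k) * t)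
      = Complex.exp (-(t : ℂ) * ν k * Complex.I) * Complex.exp (-(t : ℂ) * ν l * -Complex.I) := by
    rw [← Complex.exp_add]
    ring_nf
  simp only [map_mul, ← Complex.exp_conj, map_neg, Complex.conj_ofReal, Complex.conj_I]
  rw [h, Complex.star_def]
  ring

lemma integrable_gaussian_character {b : ℝ} (hb : 0 < b) (ξ : ℝ) :
    MeasureTheory.Integrable fun t : ℝ =>
      Complex.exp (Complex.I * (ξ : ℂ) * t) * Complex.exp (-(b : ℂ) * (t : ℂ) ^ 2) := by
  have := integrable_cexp_quadratic' (b := -(b : ℂ)) (by simpa using hb)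
    (Complex.I * ξ) 0
  refine this.congr (Filter.Eventually.of_forall fun t => ?_)
  simp only [← Complex.exp_add]
  ring_nf

lemma integrable_norm_expSum_sq_mul_gaussian {ι : Type} (s : Finset ι) (a : ι → ℂ) (ν : ι → ℝ)
    {b : ℝ} (hb : 0 < b) :
    MeasureTheory.Integrable fun t : ℝ => ‖expSum s a ν t‖ ^ 2 * Real.exp (-b * t ^ 2) := by
  have h : MeasureTheory.Integrable fun t : ℝ =>
      ((‖expSum s a ν t‖ ^ 2 * Real.exp (-b * t ^ 2) : ℝ) : ℂ) := by
    simp only [ofReal_norm_expSum_sq_mul_gaussian]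
    exact MeasureTheory.integrable_finsetSum _ fun k _ =>
      MeasureTheory.integrable_finsetSum _ fun l _ =>
        (integrable_gaussian_character hb _).const_mul _
  simpa only [RCLike.re_eq_complex_re, Complex.ofReal_re] using h.re

lemma norm_integral_gaussian_character {η : ℝ} (hη : 0 < η) (ξ : ℝ) :
    ‖∫ t : ℝ, Complex.exp (Complex.I * (ξ : ℂ) * t) *
        Complex.exp (-((η ^ 2 : ℝ) : ℂ) * (t : ℂ) ^ 2)‖
      = √Real.pi / η * Real.exp (-ξ ^ 2 / (4 * η ^ 2)) := by
  rw [fourierIntegral_gaussian (by rw [Complex.ofReal_re]; positivity), norm_mul]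
  congr 1
  · rw [← Complex.ofReal_div, Complex.norm_cpow_eq_rpow_re_of_pos (by positivity)]
    have : ((1 / 2 : ℂ)).re = 1 / 2 := by norm_num
    rw [this, ← Real.sqrt_eq_rpow, Real.sqrt_div Real.pi_pos.le, Real.sqrt_sq hη.le]
  · rw [Complex.norm_exp]
    congr 1
    norm_cast

lemma integral_norm_expSum_sq_mul_gaussian_le {ι : Type} (s : Finset ι) (a : ι → ℂ) (ν : ι → ℝ)
    {η : ℝ} (hη : 0 < η) :
    ∫ t : ℝ, ‖expSum s a ν t‖ ^ 2 * Real.exp (-η ^ 2 * t ^ 2)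
      ≤ √Real.pi / η *
        ∑ k ∈ s, ∑ l ∈ s, ‖a k‖ * ‖a l‖ * Real.exp (-(ν k - ν l) ^ 2 / (4 * η ^ 2)) := by
  have hb : 0 < η ^ 2 := by positivity
  have h0 : ∫ t : ℝ, ‖expSum s a ν t‖ ^ 2 * Real.exp (-η ^ 2 * t ^ 2)
      ≤ ‖∫ t : ℝ, ((‖expSum s a ν t‖ ^ 2 * Real.exp (-η ^ 2 * t ^ 2) : ℝ) : ℂ)‖ := by
    rw [integral_complex_ofReal, Complex.norm_real]
    exact Real.le_norm_self _
  refine h0.trans ?_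
  simp only [ofReal_norm_expSum_sq_mul_gaussian]
  rw [MeasureTheory.integral_finsetSum _ fun k _ => MeasureTheory.integrable_finsetSum _ fun l _ =>
    (integrable_gaussian_character hb _).const_mul _, Finset.mul_sum]
  refine (norm_sum_le _ _).trans (Finset.sum_le_sum fun k _ => ?_)
  rw [MeasureTheory.integral_finsetSum _ fun l _ =>
    (integrable_gaussian_character hb _).const_mul _, Finset.mul_sum]
  refine (norm_sum_le _ _).trans (Finset.sum_le_sum fun l _ => le_of_eq ?_)
  rw [MeasureTheory.integral_const_mul, norm_mul, norm_integral_gaussian_character hη, norm_mul,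
    norm_star, ← neg_sub (ν k) (ν l), neg_sq]
  ring

/-- The mean value theorem for exponential sums. -/
lemma exists_integral_norm_expSum_sq_le :
    ∃ C : ℝ, 0 < C ∧ ∀ {ι : Type} (s : Finset ι) (a : ι → ℂ) (ν : ι → ℝ) (T₀ T η : ℝ),
      0 < T → 0 < η →
      ∫ t in Set.Ioc T₀ (T₀ + T), ‖expSum s a ν t‖ ^ 2
        ≤ C * (T + 1 / η) *
          ∑ k ∈ s, ((s.filter fun l => |ν k - ν l| ≤ η).card : ℝ) * ‖a k‖ ^ 2 := by
  obtain ⟨G, hG0, hG⟩ := exists_sum_mul_mul_gaussian_le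
  refine ⟨Real.exp 1 * √Real.pi * G, by positivity, fun {ι} s a ν T₀ T η hT hη => ?_⟩
  set a' : ι → ℂ := fun k => a k * Complex.exp (-(T₀ : ℂ) * ν k * Complex.I) with ha'
  have hnorm : ∀ k, ‖a' k‖ = ‖a k‖ := by
    intro k
    have : -(T₀ : ℂ) * ν k * Complex.I = ((-T₀ * ν k : ℝ) : ℂ) * Complex.I := by push_cast; ring
    rw [ha', norm_mul, this, Complex.norm_exp_ofReal_mul_I, mul_one]
  set θ : ℝ := (T + 1 / η)⁻¹ with hθ
  have hsum : 0 < T + 1 / η := by positivity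
  have hθ0 : 0 < θ := by positivity
  have hθη : θ ≤ η := by
    rw [hθ]
    refine inv_le_of_inv_le₀ hη ?_
    rw [← one_div]
    linarith
  have hθT : θ * T ≤ 1 := by
    rw [hθ, inv_mul_le_iff₀ hsum]
    have : 0 < 1 / η := by positivity
    linarith
  have hshift : ∫ t in Set.Ioc T₀ (T₀ + T), ‖expSum s a ν t‖ ^ 2
      = ∫ t in Set.Ioc 0 T, ‖expSum s a' ν t‖ ^ 2 := by
    rw [← intervalIntegral.integral_of_le (by linarith), ← intervalIntegral.integral_of_le hT.le]
    have := intervalIntegral.integral_comp_add_right (a := 0) (b := T)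
      (fun t => ‖expSum s a ν t‖ ^ 2) T₀
    simp only [expSum_add, zero_add] at this
    rw [this, add_comm]
  have hcont : Continuous fun t => ‖expSum s a' ν t‖ ^ 2 := (continuous_expSum s a' ν).norm.pow 2
  have hint := integrable_norm_expSum_sq_mul_gaussian s a' ν (b := θ ^ 2) (by positivity)
  have h1 : ∫ t in Set.Ioc 0 T, ‖expSum s a' ν t‖ ^ 2
      ≤ ∫ t in Set.Ioc 0 T, Real.exp 1 * (‖expSum s a' ν t‖ ^ 2 * Real.exp (-θ ^ 2 * t ^ 2)) := by
    refine MeasureTheory.setIntegral_mono_on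
      (hcont.integrableOn_Icc.mono_set Set.Ioc_subset_Icc_self)
      (hint.const_mul _).integrableOn measurableSet_Ioc fun t ht => ?_
    have h2 : 1 ≤ Real.exp 1 * Real.exp (-θ ^ 2 * t ^ 2) := by
      rw [← Real.exp_add, Real.one_le_exp_iff]
      have h3 : θ * t ≤ 1 := (mul_le_mul_of_nonneg_left ht.2 hθ0.le).trans hθT
      have h4 : 0 ≤ θ * t := mul_nonneg hθ0.le ht.1.le
      nlinarith
    nlinarith [sq_nonneg ‖expSum s a' ν t‖]
  have h2 : ∫ t in Set.Ioc 0 T, Real.exp 1 * (‖expSum s a' ν t‖ ^ 2 * Real.exp (-θ ^ 2 * t ^ 2))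
      ≤ Real.exp 1 * ∫ t : ℝ, ‖expSum s a' ν t‖ ^ 2 * Real.exp (-θ ^ 2 * t ^ 2) := by
    rw [MeasureTheory.integral_const_mul]
    refine mul_le_mul_of_nonneg_left ?_ (Real.exp_pos _).le
    exact MeasureTheory.setIntegral_le_integral hint
      (Filter.Eventually.of_forall fun t => by positivity)
  have h3 := integral_norm_expSum_sq_mul_gaussian_le s a' ν hθ0
  simp only [hnorm] at h3
  have h4 := hG s (fun k => ‖a k‖) ν θ hθ0 fun k => norm_nonneg _
  have h5 : ∑ k ∈ s, ((s.filter fun l => |ν k - ν l| ≤ θ).card : ℝ) * ‖a k‖ ^ 2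
      ≤ ∑ k ∈ s, ((s.filter fun l => |ν k - ν l| ≤ η).card : ℝ) * ‖a k‖ ^ 2 := by
    refine Finset.sum_le_sum fun k _ => mul_le_mul_of_nonneg_right ?_ (sq_nonneg _)
    exact_mod_cast Finset.card_le_card
      (Finset.monotone_filter_right s fun l _ (hl : |ν k - ν l| ≤ θ) => hl.trans hθη)
  rw [hshift]
  refine (h1.trans h2).trans ?_
  calc _ ≤ Real.exp 1 * (√Real.pi / θ * (G *
        ∑ k ∈ s, ((s.filter fun l => |ν k - ν l| ≤ η).card : ℝ) * ‖a k‖ ^ 2)) := by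
        gcongr
        refine h3.trans ?_
        gcongr
        exact h4.trans (by gcongr)
    _ = _ := by rw [hθ, div_inv_eq_mul]; ring

/-- Gallagher's inequality on a single interval. -/
lemma mul_le_setIntegral_add_abs_deriv {f f' : ℝ → ℝ} (hf : ∀ t, HasDerivAt f (f' t) t)
    (hf' : Continuous f') {δ : ℝ} (hδ : 0 < δ) (t : ℝ) :
    f t ≤ ∫ u in Set.Ioc (t - δ / 2) (t + δ / 2), (1 / δ * f u + |f' u|) := by
  set I := Set.Ioc (t - δ / 2) (t + δ / 2) with hI
  have hfc : Continuous f := continuous_iff_continuousAt.2 fun u => (hf u).continuousAt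
  have intOn : ∀ {g : ℝ → ℝ}, Continuous g → MeasureTheory.IntegrableOn g I := fun hg =>
    hg.integrableOn_Icc.mono_set Set.Ioc_subset_Icc_self
  have hvol : MeasureTheory.volume.real I = δ := by
    rw [hI, MeasureTheory.measureReal_def, Real.volume_Ioc, ENNReal.toReal_ofReal] <;> linarith
  have hfin : MeasureTheory.volume I ≠ ⊤ := measure_Ioc_lt_top.ne
  set D := ∫ u in I, |f' u| with hD
  have hpt : ∀ u ∈ I, f t ≤ f u + D := by
    intro u hu
    have hFTC : ∫ x in u..t, f' x = f t - f u :=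
      intervalIntegral.integral_eq_sub_of_hasDerivAt (fun x _ => hf x)
        (hf'.intervalIntegrable _ _)
    have h1 : |∫ x in u..t, f' x| ≤ ∫ x in Set.uIoc u t, |f' x| := by
      simpa only [Real.norm_eq_abs] using
        intervalIntegral.norm_integral_le_integral_norm_uIoc (f := f') (a := u) (b := t)
          (μ := MeasureTheory.volume)
    have ht : t ∈ I := ⟨by linarith, by linarith⟩
    have hsub : Set.uIoc u t ⊆ I := fun x hx =>
      ⟨(lt_min hu.1 ht.1).trans hx.1, hx.2.trans (max_le hu.2 ht.2)⟩
    have h2 : ∫ x in Set.uIoc u t, |f' x| ≤ D :=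
      MeasureTheory.setIntegral_mono_set (intOn hf'.abs)
        (Filter.Eventually.of_forall fun _ => abs_nonneg _) hsub.eventuallyLE
    linarith [le_abs_self (∫ x in u..t, f' x)]
  have h3 : ∫ _ in I, f t ≤ ∫ u in I, (f u + D) :=
    MeasureTheory.setIntegral_mono_on (MeasureTheory.integrableOn_const hfin)
      ((intOn hfc).add (MeasureTheory.integrableOn_const hfin)) measurableSet_Ioc hpt
  rw [MeasureTheory.setIntegral_const, MeasureTheory.integral_add (intOn hfc)
    (MeasureTheory.integrableOn_const hfin), MeasureTheory.setIntegral_const, hvol, smul_eq_mul,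
    smul_eq_mul] at h3
  rw [MeasureTheory.integral_add ((intOn hfc).const_mul _) (intOn hf'.abs),
    MeasureTheory.integral_const_mul]
  have h4 : f t - D ≤ 1 / δ * ∫ u in I, f u := by
    rw [one_div, le_inv_mul_iff₀ hδ]
    linarith
  linarith

/-- Gallagher's inequality summed over a well-spaced set. -/
lemma sum_le_setIntegral_add_abs_deriv {f f' : ℝ → ℝ} (hf : ∀ t, HasDerivAt f (f' t) t)
    (hf' : Continuous f') (hf0 : ∀ t, 0 ≤ f t) {T₀ T δ : ℝ} (hδ : 0 < δ) {P : Finset ℝ}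
    (hP : ∀ t ∈ P, t ∈ Set.Icc (T₀ + δ / 2) (T₀ + T - δ / 2))
    (hsep : ∀ t ∈ P, ∀ t' ∈ P, t ≠ t' → δ ≤ |t - t'|) :
    ∑ t ∈ P, f t ≤ ∫ u in Set.Ioc T₀ (T₀ + T), (1 / δ * f u + |f' u|) := by
  have hfc : Continuous f := continuous_iff_continuousAt.2 fun u => (hf u).continuousAt
  have hg : Continuous fun u => 1 / δ * f u + |f' u| := by fun_prop
  have intOn : ∀ a b : ℝ, MeasureTheory.IntegrableOn (fun u => 1 / δ * f u + |f' u|)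
      (Set.Ioc a b) := fun _ _ => hg.integrableOn_Icc.mono_set Set.Ioc_subset_Icc_self
  have hdisj : Set.Pairwise (P : Set ℝ)
      (Function.onFun Disjoint fun t => Set.Ioc (t - δ / 2) (t + δ / 2)) := by
    intro t ht t' ht' hne
    refine Set.disjoint_left.2 fun x hx hx' => ?_
    have h1 := hsep t ht t' ht' hne
    have h2 : |t - t'| < δ := by
      rw [abs_lt]
      constructor <;> linarith [hx.1, hx.2, hx'.1, hx'.2]
    linarith
  refine (Finset.sum_le_sum fun t _ => mul_le_setIntegral_add_abs_deriv hf hf' hδ t).trans ?_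
  rw [← MeasureTheory.integral_biUnion_finset P (fun _ _ => measurableSet_Ioc) hdisj
    fun _ _ => intOn _ _]
  refine MeasureTheory.setIntegral_mono_set (intOn _ _)
    (Filter.Eventually.of_forall fun u => ?_) (LE.le.eventuallyLE ?_)
  · have := hf0 u
    change 0 ≤ 1 / δ * f u + |f' u|
    positivity
  · refine Set.iUnion₂_subset fun t ht x hx => ?_
    have := hP t ht
    exact ⟨by linarith [this.1, hx.1], by linarith [this.2, hx.2]⟩

lemma sum_norm_expSum_sq_le {ι : Type} (s : Finset ι) (a : ι → ℂ) (ν : ι → ℝ)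
    {T₀ T δ L : ℝ} (hδ : 0 < δ) (hL : 0 < L) {P : Finset ℝ}
    (hP : ∀ t ∈ P, t ∈ Set.Icc (T₀ + δ / 2) (T₀ + T - δ / 2))
    (hsep : ∀ t ∈ P, ∀ t' ∈ P, t ≠ t' → δ ≤ |t - t'|) :
    ∑ t ∈ P, ‖expSum s a ν t‖ ^ 2
      ≤ (1 / δ + L) * (∫ t in Set.Ioc T₀ (T₀ + T), ‖expSum s a ν t‖ ^ 2)
        + 1 / L * ∫ t in Set.Ioc T₀ (T₀ + T),
            ‖expSum s (fun k => a k * (-ν k * Complex.I)) ν t‖ ^ 2 := by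
  set F := expSum s a ν
  set F' := expSum s (fun k => a k * (-ν k * Complex.I)) ν
  have hFc : Continuous F := continuous_expSum _ _ _
  have hFc' : Continuous F' := continuous_expSum _ _ _
  have hd : ∀ t, HasDerivAt (fun t => ‖F t‖ ^ 2) (2 * inner ℝ (F t) (F' t)) t := fun t =>
    (hasDerivAt_expSum s a ν t).norm_sq
  have intOn : ∀ {g : ℝ → ℝ}, Continuous g →
      MeasureTheory.IntegrableOn g (Set.Ioc T₀ (T₀ + T)) := fun hg =>
    hg.integrableOn_Icc.mono_set Set.Ioc_subset_Icc_self
  refine (sum_le_setIntegral_add_abs_deriv hd (by fun_prop) (fun t => sq_nonneg _) hδ hP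
    hsep).trans ?_
  rw [← MeasureTheory.integral_const_mul, ← MeasureTheory.integral_const_mul,
    ← MeasureTheory.integral_add (intOn (by fun_prop)) (intOn (by fun_prop))]
  refine MeasureTheory.setIntegral_mono_on (intOn (by fun_prop)) (intOn (by fun_prop))
    measurableSet_Ioc fun t _ => ?_
  have h1 : |2 * inner ℝ (F t) (F' t)| ≤ 2 * (‖F t‖ * ‖F' t‖) := by
    rw [abs_mul, abs_two]
    exact mul_le_mul_of_nonneg_left (abs_real_inner_le_norm _ _) zero_le_two
  have h2 : 2 * (‖F t‖ * ‖F' t‖) ≤ L * ‖F t‖ ^ 2 + 1 / L * ‖F' t‖ ^ 2 := by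
    have h3 : L * ‖F t‖ ^ 2 + 1 / L * ‖F' t‖ ^ 2 - 2 * (‖F t‖ * ‖F' t‖)
        = 1 / L * (L * ‖F t‖ - ‖F' t‖) ^ 2 := by field_simp; ring
    have : 0 ≤ 1 / L * (L * ‖F t‖ - ‖F' t‖) ^ 2 := by positivity
    linarith
  linarith

lemma abs_sub_le_mul_of_abs_log_sub_le {x y N η : ℝ} (hx : 0 < x) (hy : 0 < y) (hxN : x ≤ N)
    (hyN : y ≤ N) (h : |Real.log x - Real.log y| ≤ η) : |x - y| ≤ η * N := by
  have hη : 0 ≤ η := (abs_nonneg _).trans h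
  have key : ∀ {u v : ℝ}, 0 < u → 0 < v → u ≤ N → Real.log u - Real.log v ≤ η →
      u - v ≤ η * N := by
    intro u v hu hv huN huv
    have h1 := Real.log_le_sub_one_of_pos (div_pos hv hu)
    rw [Real.log_div hv.ne' hu.ne'] at h1
    have h2 : 1 - η ≤ v / u := by linarith
    rw [le_div_iff₀ hu] at h2
    nlinarith
  obtain ⟨h1, h2⟩ := abs_le.1 h
  rw [abs_le]
  constructor
  · linarith [key hy hx hyN (by linarith)]
  · exact key hx hy hxN h2

/-- **Large values estimate for generalized Dirichlet polynomials.**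
There is an absolute constant `C > 0` such that for all real `1 ≤ n 0 ≤ ⋯ ≤ n K ≤ N`
(`N > 1`), complex coefficients `a k`, the generalized Dirichlet polynomial
`S(t) = ∑_{k ≤ K} a k * (n k)^(-i t)`, all `T₀ ∈ ℝ`, `T > 0`, `δ > 0`, every finite set
`𝒯 ⊆ [T₀ + δ/2, T₀ + T - δ/2]` of `δ`-well-spaced points on which `|S(t)| ≥ V > 0`,
and every `η > 0`:
`|𝒯| ≤ C V⁻² (T + 1/η)(log N + 1/δ) ∑_{k ≤ K} χ(n k, η N) |a k|²`,
where `χ(x, λ) = #{l ≤ K : |x - n l| ≤ λ}`. -/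
theorem large_values_generalized_dirichlet :
    ∃ C : ℝ, 0 < C ∧
      ∀ (N : ℝ) (K : ℕ) (n : ℕ → ℝ) (a : ℕ → ℂ),
        1 < N → 1 ≤ n 0 → (∀ k, k < K → n k ≤ n (k + 1)) → n K ≤ N →
        ∀ T₀ T δ : ℝ, 0 < T → 0 < δ →
        ∀ 𝒯 : Finset ℝ,
          (∀ t ∈ 𝒯, t ∈ Set.Icc (T₀ + δ / 2) (T₀ + T - δ / 2)) →
          (∀ t ∈ 𝒯, ∀ t' ∈ 𝒯, t ≠ t' → δ ≤ |t - t'|) →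
        ∀ V : ℝ, 0 < V →
          (∀ t ∈ 𝒯,
            V ≤ ‖∑ k ∈ Finset.range (K + 1), a k * (n k : ℂ) ^ (-(t : ℂ) * Complex.I)‖) →
        ∀ η : ℝ, 0 < η →
          (𝒯.card : ℝ)
            ≤ C * V⁻¹ ^ 2 * (T + 1 / η) * (Real.log N + 1 / δ) *
              ∑ k ∈ Finset.range (K + 1),
                (Set.ncard {l : ℕ | l ≤ K ∧ |n k - n l| ≤ η * N} : ℝ) * ‖a k‖ ^ 2 := by
  obtain ⟨C, hC0, hC⟩ := exists_integral_norm_expSum_sq_le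
  refine ⟨2 * C, by positivity, ?_⟩
  intro N K n a hN hn0 hmono hnK T₀ T δ hT hδ P hP hsep V hV hlarge η hη
  set s := Finset.range (K + 1) with hs
  have hMono : MonotoneOn n (Set.Iic K) := monotoneOn_of_le_add_one Set.ordConnected_Iic
    fun k _ _ hk => hmono k hk
  have hn1 : ∀ k ≤ K, 1 ≤ n k := fun k hk =>
    hn0.trans (hMono (Nat.zero_le K) hk (Nat.zero_le k))
  have hnN : ∀ k ≤ K, n k ≤ N := fun k hk => (hMono hk Set.self_mem_Iic hk).trans hnK
  set ν : ℕ → ℝ := fun k => Real.log (n k) with hν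
  set L := Real.log N with hL
  have hL0 : 0 < L := Real.log_pos hN
  set X := ∑ k ∈ s,
    (Set.ncard {l : ℕ | l ≤ K ∧ |n k - n l| ≤ η * N} : ℝ) * ‖a k‖ ^ 2 with hX
  have hmem : ∀ k ∈ s, k ≤ K := fun k hk => Nat.lt_succ_iff.1 (Finset.mem_range.1 hk)
  have hS : ∀ t : ℝ, ∑ k ∈ s, a k * (n k : ℂ) ^ (-(t : ℂ) * Complex.I) = expSum s a ν t := by
    intro t
    refine Finset.sum_congr rfl fun k hk => ?_
    have hpos : 0 < n k := zero_lt_one.trans_le (hn1 k (hmem k hk))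
    rw [Complex.cpow_def_of_ne_zero (by exact_mod_cast hpos.ne'), ← Complex.ofReal_log hpos.le]
    simp only [hν]
    ring_nf
  have hcard : ∀ k ∈ s, (s.filter fun l => |ν k - ν l| ≤ η).card
      ≤ Set.ncard {l : ℕ | l ≤ K ∧ |n k - n l| ≤ η * N} := by
    intro k hk
    rw [← Set.ncard_coe_finset]
    refine Set.ncard_le_ncard ?_ ((Set.finite_Iic K).subset fun l hl => hl.1)
    intro l hl
    obtain ⟨hls, hl'⟩ := Finset.mem_filter.1 (Finset.mem_coe.1 hl)
    have hkK := hmem k hk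
    have hlK := hmem l hls
    exact ⟨hlK, abs_sub_le_mul_of_abs_log_sub_le (zero_lt_one.trans_le (hn1 k hkK))
      (zero_lt_one.trans_le (hn1 l hlK)) (hnN k hkK) (hnN l hlK) hl'⟩
  have hsumT : 0 < T + 1 / η := by positivity
  have h1 : ∫ t in Set.Ioc T₀ (T₀ + T), ‖expSum s a ν t‖ ^ 2 ≤ C * (T + 1 / η) * X := by
    refine (hC s a ν T₀ T η hT hη).trans ?_
    refine mul_le_mul_of_nonneg_left (Finset.sum_le_sum fun k hk => ?_) (by positivity)
    exact mul_le_mul_of_nonneg_right (by exact_mod_cast hcard k hk) (sq_nonneg _)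
  have h2 : ∫ t in Set.Ioc T₀ (T₀ + T), ‖expSum s (fun k => a k * (-ν k * Complex.I)) ν t‖ ^ 2
      ≤ C * (T + 1 / η) * (L ^ 2 * X) := by
    refine (hC s _ ν T₀ T η hT hη).trans ?_
    rw [hX, Finset.mul_sum s _ (L ^ 2)]
    refine mul_le_mul_of_nonneg_left (Finset.sum_le_sum fun k hk => ?_) (by positivity)
    have hkK := hmem k hk
    have hν0 : 0 ≤ ν k := Real.log_nonneg (hn1 k hkK)
    have hνL : ν k ≤ L := Real.log_le_log (zero_lt_one.trans_le (hn1 k hkK)) (hnN k hkK)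
    have hnorm : ‖a k * (-ν k * Complex.I)‖ = ν k * ‖a k‖ := by
      rw [norm_mul, norm_mul, norm_neg, Complex.norm_I, Complex.norm_real, Real.norm_of_nonneg hν0]
      ring
    rw [hnorm, mul_pow, mul_left_comm]
    have := hcard k hk
    gcongr
  have h3 := sum_norm_expSum_sq_le s a ν hδ hL0 hP hsep
  have h4 : (P.card : ℝ) * V ^ 2 ≤ ∑ t ∈ P, ‖expSum s a ν t‖ ^ 2 := by
    rw [← nsmul_eq_mul]
    refine Finset.card_nsmul_le_sum _ _ _ fun t ht => ?_
    have := hlarge t ht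
    rw [hS] at this
    gcongr
  have h5 : (P.card : ℝ) * V ^ 2 ≤ 2 * C * (T + 1 / η) * (L + 1 / δ) * X := by
    have hX0 : 0 ≤ X := Finset.sum_nonneg fun k _ => by positivity
    have hδ' : 0 < 1 / δ := by positivity
    calc (P.card : ℝ) * V ^ 2
        ≤ (1 / δ + L) * (C * (T + 1 / η) * X) + 1 / L * (C * (T + 1 / η) * (L ^ 2 * X)) := by
          refine (h4.trans h3).trans ?_
          gcongr
      _ = C * (T + 1 / η) * X * (1 / δ + 2 * L) := by
          have : 1 / L * (C * (T + 1 / η) * (L ^ 2 * X)) = L * (C * (T + 1 / η) * X) := by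
            rw [pow_two, one_div]
            linear_combination (C * (T + 1 / η) * L * X) * inv_mul_cancel₀ hL0.ne'
          rw [this]
          ring
      _ ≤ C * (T + 1 / η) * X * (2 * (L + 1 / δ)) := by
          gcongr
          linarith
      _ = _ := by ring
  have hV2 : 0 < V ^ 2 := by positivity
  rw [← le_div_iff₀ hV2] at h5
  refine h5.trans (le_of_eq ?_)
  rw [inv_pow, div_eq_mul_inv]
  ring
end

section
/- If (𝒫, 𝒩) is a Beurling generalized number system with θ-well-behaved integers (N(x) = Ax + O(x^θ) for some A > 0 and θ ∈ [0,1)), then for every α > (θ + 2)/3 one has N(α, T) = o(T) as T → ∞. -/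
open Filter Topology

/-- A Beurling generalized prime number system: a nondecreasing sequence of
generalized primes, each `> 1`, tending to infinity. -/
structure BeurlingSystem where
  p : ℕ → ℝ
  one_lt_p : ∀ k, 1 < p k
  p_mono : Monotone p
  p_tendsto : Filter.Tendsto p Filter.atTop Filter.atTop

namespace BeurlingSystem

variable (S : BeurlingSystem)

/-- The numerical value of a generalized integer, encoded as the finitely supported
vector of exponents of the generalized primes. -/
noncomputable def val (n : ℕ →₀ ℕ) : ℝ := n.prod fun k e => S.p k ^ e

/-- The integer counting function `N(x)`. -/
noncomputable def cnt (x : ℝ) : ℝ := (Set.ncard {n : ℕ →₀ ℕ | S.val n ≤ x} : ℝ)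

/-- `χ(x, λ)`: the number of generalized integers within distance `λ` of `x`. -/
noncomputable def chi (x lam : ℝ) : ℝ := (Set.ncard {n : ℕ →₀ ℕ | |x - S.val n| ≤ lam} : ℝ)

/-- The integers are `θ`-well-behaved with density `A` and implied constant `K₀`:
`N(x) = A x + O(x^θ)`. -/
def WellBehaved (A θ K₀ : ℝ) : Prop :=
  0 < A ∧ 0 ≤ θ ∧ θ < 1 ∧ 0 ≤ K₀ ∧ ∀ x : ℝ, 1 ≤ x → |S.cnt x - A * x| ≤ K₀ * x ^ θ

/-- `ζ` is (the unique) analytic continuation of the Beurling zeta function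
to `{Re s > θ} \ {1}`. -/
def IsZeta (θ : ℝ) (ζ : ℂ → ℂ) : Prop :=
  DifferentiableOn ℂ ζ {s : ℂ | θ < s.re ∧ s ≠ 1} ∧
  ∀ s : ℂ, 1 < s.re → ζ s = ∑' n : ℕ →₀ ℕ, (S.val n : ℂ) ^ (-s)

/-- The von Mangoldt function: `log p` on prime powers `p^m`, `0` otherwise. -/
noncomputable def vonMangoldt (n : ℕ →₀ ℕ) : ℝ :=
  ∑ k ∈ n.support, if n.support = {k} then Real.log (S.p k) else 0

/-- The Chebyshev function `ψ(x)`. -/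
noncomputable def psi (x : ℝ) : ℝ :=
  ∑ᶠ n ∈ {n : ℕ →₀ ℕ | S.val n ≤ x}, S.vonMangoldt n

end BeurlingSystem

/-- The generalized divisor function: the number of ordered pairs of generalized
integers whose formal product equals `n`. -/
noncomputable def gDivisor (n : ℕ →₀ ℕ) : ℝ :=
  (Set.ncard {q : (ℕ →₀ ℕ) × (ℕ →₀ ℕ) | q.1 + q.2 = n} : ℝ)

/-- The generalized Möbius function. -/
noncomputable def gMoebius (n : ℕ →₀ ℕ) : ℝ :=
  if ∀ k ∈ n.support, n k ≤ 1 then (-1 : ℝ) ^ n.support.card else 0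

/-- The zero-counting function `N(α, T)` of the (continued) zeta function. -/
noncomputable def zeroCount (ζ : ℂ → ℂ) (α T : ℝ) : ℝ :=
  (Set.ncard {ρ : ℂ | ζ ρ = 0 ∧ ρ ≠ 1 ∧ α ≤ ρ.re ∧ |ρ.im| ≤ T} : ℝ)

theorem log_norm_one_add_le (z : ℂ) : Real.log ‖1 + z‖ ≤ z.re + ‖z‖ ^ 2 := by
  rcases eq_or_ne (1 + z) 0 with h | h
  · have hz : z = -1 := by linear_combination h
    simp [hz]
  · have h1 : 0 < ‖1 + z‖ := norm_pos_iff.2 h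
    have h2 : ‖1 + z‖ ^ 2 = 1 + 2 * z.re + ‖z‖ ^ 2 := by
      rw [Complex.sq_norm, Complex.sq_norm, Complex.normSq_apply, Complex.normSq_apply]
      simp; ring
    have h3 := Real.log_le_sub_one_of_pos (pow_pos h1 2)
    rw [Real.log_pow, h2] at h3
    push_cast at h3
    nlinarith [sq_nonneg ‖z‖]

theorem neg_log_norm_one_add_le (z : ℂ) (hz : ‖z‖ ≤ 1 / 2) :
    -Real.log ‖1 + z‖ ≤ -z.re + 13 * ‖z‖ ^ 2 := by
  have hre : |z.re| ≤ ‖z‖ := Complex.abs_re_le_norm z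
  have h0 := norm_nonneg z
  have h2 : ‖1 + z‖ ^ 2 = 1 + 2 * z.re + ‖z‖ ^ 2 := by
    rw [Complex.sq_norm, Complex.sq_norm, Complex.normSq_apply, Complex.normSq_apply]
    simp; ring
  have h1 : 1 / 2 ≤ ‖1 + z‖ := by
    have := norm_sub_norm_le (1 : ℂ) (-z)
    simp at this
    linarith
  have hw : 1 / 4 ≤ ‖1 + z‖ ^ 2 := by nlinarith
  have h3 := Real.one_sub_inv_le_log_of_pos (x := ‖1 + z‖ ^ 2) (by positivity)
  rw [Real.log_pow] at h3
  push_cast at h3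
  set u := 2 * z.re + ‖z‖ ^ 2 with hu
  have hwu : ‖1 + z‖ ^ 2 = 1 + u := by rw [h2]; ring
  have h4 : (‖1 + z‖ ^ 2)⁻¹ - 1 ≤ -u + 4 * u ^ 2 := by
    rw [hwu] at hw ⊢
    have hp : 0 < 1 + u := by linarith
    rw [sub_le_iff_le_add, inv_le_iff_one_le_mul₀ hp]
    nlinarith [sq_nonneg u, mul_nonneg (sq_nonneg u) (by linarith : 0 ≤ 4 * u + 3)]
  have h5 : u ^ 2 ≤ (25 / 4) * ‖z‖ ^ 2 := by
    have : |u| ≤ 5 / 2 * ‖z‖ := by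
      rw [abs_le] at hre ⊢
      constructor <;> nlinarith
    calc u ^ 2 = |u| ^ 2 := (sq_abs u).symm
      _ ≤ (5 / 2 * ‖z‖) ^ 2 := by gcongr
      _ = _ := by ring
  nlinarith

/-- A form of the Jensen inequality: the number of zeros of `g` in a disc is controlled by the mean
square of `g - 1` on a larger circle. -/
theorem card_zeros_mul_log_le_circleAverage {g : ℂ → ℂ} {c : ℂ} {r R : ℝ} (hr : 0 < r) (hrR : r < R)
    (hg : AnalyticOnNhd ℂ g (Metric.closedBall c R)) (hc : ‖g c - 1‖ ≤ 1 / 2) (F : Finset ℂ)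
    (hF : ∀ ρ ∈ F, g ρ = 0 ∧ ‖ρ - c‖ ≤ r) :
    F.card * Real.log (R / r) ≤ 14 * Real.circleAverage (fun z => ‖g z - 1‖ ^ 2) c R := by
  have hR : 0 < R := hr.trans hrR
  have habs : |R| = R := abs_of_pos hR
  have hgc : g c ≠ 0 := by
    intro h; rw [h] at hc; norm_num at hc
  rw [← habs] at hg
  have hJ := hg.circleAverage_log_norm hR.ne' hgc
  have hcont : ContinuousOn g (Metric.closedBall c |R|) := hg.continuousOn
  have hS : Metric.sphere c |R| ⊆ Metric.closedBall c |R| := Metric.sphere_subset_closedBall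
  have hd : DifferentiableOn ℂ g (Metric.closedBall c |R|) := hg.differentiableOn
  have hdc1 : DiffContOnCl ℂ (fun z => g z - 1) (Metric.ball c |R|) := by
    apply DifferentiableOn.diffContOnCl
    rw [closure_ball c (by positivity)]
    exact hd.sub_const 1
  have hdc2 : DiffContOnCl ℂ (fun z => (g z - 1) ^ 2) (Metric.ball c |R|) := by
    apply DifferentiableOn.diffContOnCl
    rw [closure_ball c (by positivity)]
    exact (hd.sub_const 1).pow 2
  have hint1 : CircleIntegrable (fun z => g z - 1) c R :=
    ContinuousOn.circleIntegrable' ((hcont.mono hS).sub continuousOn_const)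
  have hintre : CircleIntegrable (fun z => (g z - 1).re) c R :=
    ContinuousOn.circleIntegrable'
      (Complex.continuous_re.comp_continuousOn ((hcont.mono hS).sub continuousOn_const))
  have hintsq : CircleIntegrable (fun z => ‖g z - 1‖ ^ 2) c R :=
    ContinuousOn.circleIntegrable' (((hcont.mono hS).sub continuousOn_const).norm.pow 2)
  set V := Real.circleAverage (fun z => ‖g z - 1‖ ^ 2) c R with hV
  have hmean1 : Real.circleAverage (fun z => (g z - 1).re) c R = (g c - 1).re := by
    have h := Complex.reCLM.circleAverage_comp_comm hint1
    have h' := hdc1.circleAverage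
    rw [h'] at h
    exact h
  have hmean2 : ‖g c - 1‖ ^ 2 ≤ V := by
    have h' := hdc2.circleAverage
    rw [← norm_pow, ← h', Real.circleAverage_def, hV, Real.circleAverage_def, norm_smul, smul_eq_mul,
      Real.norm_of_nonneg (by positivity)]
    gcongr
    refine (intervalIntegral.norm_integral_le_integral_norm (by positivity)).trans (le_of_eq ?_)
    simp
  have hup : Real.circleAverage (fun z => Real.log ‖g z‖) c R ≤ (g c - 1).re + V := by
    rw [← hmean1, hV, ← Real.circleAverage_fun_add hintre hintsq]
    refine Real.circleAverage_mono (hg.mono hS).meromorphicOn.circleIntegrable_log_norm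
      (hintre.add hintsq) fun z _ => ?_
    have := log_norm_one_add_le (g z - 1)
    simpa using this
  have hlow : F.card * Real.log (R / r) ≤
      ∑ᶠ u, MeromorphicOn.divisor g (Metric.closedBall c |R|) u * Real.log (R * ‖c - u‖⁻¹) := by
    have hfin := (MeromorphicOn.divisor g (Metric.closedBall c |R|)).finiteSupport
      (isCompact_closedBall ..)
    have hnn : ∀ u, 0 ≤ (MeromorphicOn.divisor g (Metric.closedBall c |R|) u : ℝ) *
        Real.log (R * ‖c - u‖⁻¹) := by
      intro u
      by_cases hu : u ∈ Metric.closedBall c |R|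
      · apply mul_nonneg
        · exact_mod_cast (MeromorphicOn.AnalyticOnNhd.divisor_nonneg hg) u
        · rcases eq_or_ne c u with h | h
          · simp [h]
          · apply Real.log_nonneg
            have h1 : 0 < ‖c - u‖ := norm_pos_iff.2 (sub_ne_zero.2 h)
            rw [← div_eq_mul_inv, le_div_iff₀ h1, one_mul, norm_sub_rev, ← dist_eq_norm]
            simpa [habs] using hu
      · simp [hu]
    set T := hfin.toFinset ∪ F
    rw [finsum_eq_sum_of_support_subset (s := T)]
    · rw [← nsmul_eq_mul]
      refine (Finset.card_nsmul_le_sum F _ _ ?_).trans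
        (Finset.sum_le_sum_of_subset_of_nonneg Finset.subset_union_right fun u _ _ => hnn u)
      intro u hu
      obtain ⟨h0, hd⟩ := hF u hu
      have hu' : u ∈ Metric.closedBall c |R| := by
        rw [Metric.mem_closedBall, dist_eq_norm, habs]; linarith
      have hne : c ≠ u := by rintro rfl; exact hgc h0
      have hpos : 0 < ‖c - u‖ := norm_pos_iff.2 (sub_ne_zero.2 hne)
      have hlog : Real.log (R / r) ≤ Real.log (R * ‖c - u‖⁻¹) := by
        rw [div_eq_mul_inv]
        gcongr
        rwa [norm_sub_rev]
      have hlog0 : 0 ≤ Real.log (R / r) := Real.log_nonneg (by rw [le_div_iff₀ hr]; linarith)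
      have hord : (1 : ℝ) ≤ MeromorphicOn.divisor g (Metric.closedBall c |R|) u := by
        have hne_top : analyticOrderAt g u ≠ ⊤ := by
          apply hg.analyticOrderAt_ne_top_of_isPreconnected
            (convex_closedBall c |R|).isPreconnected (x := c) (by simp) hu'
          rw [(hg c (by simp)).analyticOrderAt_eq_zero.mpr hgc]; simp
        have hne0 : analyticOrderAt g u ≠ 0 := by
          rw [Ne, (hg u hu').analyticOrderAt_eq_zero]; simpa using h0
        rw [MeromorphicOn.AnalyticOnNhd.divisor_apply hg hu', ← Nat.cast_analyticOrderNatAt hne_top]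
        rw [← Nat.cast_analyticOrderNatAt hne_top] at hne0
        have h1 : analyticOrderNatAt g u ≠ 0 := fun h => hne0 (by simp [h])
        have h2 : ((ENat.map (fun n : ℕ => (n : ℤ)) (analyticOrderNatAt g u : ℕ∞)).untop₀ : ℤ) =
            (analyticOrderNatAt g u : ℤ) := by simp
        rw [h2]
        exact_mod_cast Nat.one_le_iff_ne_zero.2 h1
      calc Real.log (R / r) = 1 * Real.log (R / r) := (one_mul _).symm
        _ ≤ _ := mul_le_mul hord hlog hlog0 (by linarith)
    · intro u hu
      have : u ∈ hfin.toFinset := by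
        simp only [Set.Finite.mem_toFinset, Function.mem_support]
        intro h; simp [h] at hu
      exact Finset.mem_coe.2 (Finset.mem_union_left _ this)
  have hneg := neg_log_norm_one_add_le (g c - 1) hc
  rw [add_sub_cancel] at hneg
  linarith

theorem setIntegral_Ioi_ite_le {E : Type*} [NormedAddCommGroup E] [NormedSpace ℝ E] (a c : ℝ)
    (f : ℝ → E) :
    ∫ u in Set.Ioi c, (if a ≤ u then f u else 0) = ∫ u in Set.Ioi (max a c), f u := by
  have heq : (fun u : ℝ => if a ≤ u then f u else 0) = (Set.Ici a).indicator f := by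
    ext u; simp [Set.indicator_apply]
  rw [heq, MeasureTheory.setIntegral_indicator measurableSet_Ici, ← Set.Ioi_inter_Ioi, Set.inter_comm]
  exact MeasureTheory.setIntegral_congr_set
    (MeasureTheory.Ioi_ae_eq_Ici.symm.inter (MeasureTheory.ae_eq_refl _))

theorem integrableOn_Ioi_ite_le {E : Type*} [NormedAddCommGroup E] {a c : ℝ}
    {f : ℝ → E} (hf : MeasureTheory.IntegrableOn f (Set.Ioi c)) :
    MeasureTheory.IntegrableOn (fun u => if a ≤ u then f u else 0) (Set.Ioi c) := by
  have heq : (fun u : ℝ => if a ≤ u then f u else 0) = (Set.Ici a).indicator f := by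
    ext u; simp [Set.indicator_apply]
  rw [heq]
  exact hf.indicator measurableSet_Ici

theorem integral_Ioi_rpow_neg_sub_one {σ a : ℝ} (hσ : 0 < σ) (ha : 0 < a) :
    ∫ u in Set.Ioi a, u ^ (-σ - 1) = a ^ (-σ) / σ := by
  rw [integral_Ioi_rpow_of_lt (by linarith) ha, show -σ - 1 + 1 = -σ by ring, neg_div_neg_eq]

theorem summable_rpow_of_ncard_le {ι : Type*} {v : ι → ℝ} (hv : ∀ i, 1 ≤ v i)
    (hfin : ∀ x, {i | v i ≤ x}.Finite) {B : ℝ}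
    (hB : ∀ x, 1 ≤ x → (Set.ncard {i | v i ≤ x} : ℝ) ≤ B * x) {σ : ℝ} (hσ : 1 < σ) :
    Summable fun i => v i ^ (-σ) := by
  have hσ0 : 0 < σ := by linarith
  refine summable_of_sum_le (c := σ * ∫ u in Set.Ioi (1 : ℝ), B * u ^ (-σ))
    (fun i => Real.rpow_nonneg (by linarith [hv i]) _) fun F => ?_
  have h1 : ∀ i, v i ^ (-σ) =
      σ * ∫ u in Set.Ioi (1 : ℝ), (if v i ≤ u then u ^ (-σ - 1) else 0) := fun i => by
    rw [setIntegral_Ioi_ite_le, max_eq_left (hv i),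
      integral_Ioi_rpow_neg_sub_one hσ0 (by linarith [hv i])]
    field_simp
  have hint : ∀ i, MeasureTheory.IntegrableOn
      (fun u : ℝ => if v i ≤ u then u ^ (-σ - 1) else 0) (Set.Ioi 1) := fun i =>
    integrableOn_Ioi_ite_le (integrableOn_Ioi_rpow_of_lt (by linarith) one_pos)
  simp_rw [h1]
  rw [← Finset.mul_sum, ← MeasureTheory.integral_finsetSum F
    fun i _ => hint i]
  refine mul_le_mul_of_nonneg_left ?_ hσ0.le
  refine MeasureTheory.setIntegral_mono_on (MeasureTheory.integrable_finsetSum F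
    fun i _ => hint i)
    ((integrableOn_Ioi_rpow_of_lt (by linarith : -σ < -1) one_pos).const_mul B) measurableSet_Ioi
    fun u hu => ?_
  have hu0 : 0 < u := one_pos.trans hu
  classical
  rw [← Finset.sum_filter, Finset.sum_const, nsmul_eq_mul]
  have h2 : ((F.filter fun i => v i ≤ u).card : ℝ) ≤ B * u := by
    refine le_trans ?_ (hB u (le_of_lt hu))
    rw [← Set.ncard_coe_finset]
    have hsub : ((F.filter fun i => v i ≤ u : Finset ι) : Set ι) ⊆ {i | v i ≤ u} :=
      fun i hi => (Finset.mem_filter.1 (Finset.mem_coe.1 hi)).2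
    exact_mod_cast Set.ncard_le_ncard hsub (hfin u)
  calc _ ≤ B * u * u ^ (-σ - 1) := by gcongr
    _ = B * u ^ (-σ) := by
      rw [mul_assoc, ← Real.rpow_one_add' hu0.le (by linarith)]
      congr 2; ring

theorem abs_ncard_sub_le {ι : Type*} {v : ι → ℝ} (hv : ∀ i, 1 ≤ v i) {A θ K : ℝ} (hA : 0 ≤ A)
    (hK : 0 ≤ K) (hθ : 0 ≤ θ)
    (hcnt : ∀ x, 1 ≤ x → |(Set.ncard {i | v i ≤ x} : ℝ) - A * x| ≤ K * x ^ θ)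
    {x z : ℝ} (hx : 0 ≤ x) (hxz : x ≤ z) (hz : 1 ≤ z) :
    |(Set.ncard {i | v i ≤ x} : ℝ) - A * x| ≤ (K + A) * z ^ θ := by
  have hz1 : 1 ≤ z ^ θ := Real.one_le_rpow hz hθ
  rcases le_or_gt 1 x with h | h
  · refine (hcnt x h).trans ?_
    have : x ^ θ ≤ z ^ θ := by gcongr
    nlinarith
  · have : {i | v i ≤ x} = ∅ := by
      ext i; simp; linarith [hv i]
    rw [this]
    simp only [Set.ncard_empty, Nat.cast_zero, zero_sub, abs_neg]
    rw [abs_of_nonneg (by positivity)]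
    nlinarith

theorem card_log_window_le {ι : Type*} {v : ι → ℝ} (hv : ∀ i, 1 ≤ v i)
    (hfin : ∀ x, {i | v i ≤ x}.Finite) {A θ K : ℝ} (hA : 0 ≤ A)
    (hK : 0 ≤ K) (hθ : 0 ≤ θ) (hθ1 : θ ≤ 1)
    (hcnt : ∀ x, 1 ≤ x → |(Set.ncard {i | v i ≤ x} : ℝ) - A * x| ≤ K * x ^ θ)
    (F : Finset ι) {y T j : ℝ} (hy : 1 ≤ y) (hT : 1 ≤ T) (hj : 0 ≤ j)
    (hF : ∀ i ∈ F, |T * (Real.log (v i) - Real.log y)| < j) :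
    (F.card : ℝ) ≤ 2 * (K + A) * (y / T + y ^ θ) * Real.exp (2 * j) := by
  set h := j / T with hh
  have hT0 : 0 < T := by linarith
  have hy0 : 0 < y := by linarith
  have hh0 : 0 ≤ h := by positivity
  have hhj : h ≤ j := div_le_self hj hT
  set a := y * Real.exp (-h) with ha
  set b := y * Real.exp h with hb
  have hab : a ≤ b := by rw [ha, hb]; gcongr; linarith
  have hsub : (F : Set ι) ⊆ {i | v i ≤ b} \ {i | v i ≤ a} := by
    intro i hi
    have h1 := hF i hi
    have hvi : 0 < v i := by linarith [hv i]
    rw [abs_lt] at h1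
    have h2 : Real.log (v i) - Real.log y < h := by
      rw [hh, lt_div_iff₀ hT0]; linarith [h1.2]
    have h3 : -h < Real.log (v i) - Real.log y := by
      rw [hh, ← neg_div, div_lt_iff₀ hT0]; linarith [h1.1]
    have hve : v i = y * Real.exp (Real.log (v i) - Real.log y) := by
      rw [Real.exp_sub, Real.exp_log hvi, Real.exp_log hy0]; field_simp
    simp only [Set.mem_sdiff, Set.mem_ofPred_eq, not_le]
    rw [hve, ha, hb]
    constructor
    · gcongr
    · gcongr
  have hcard : (F.card : ℝ) ≤ (Set.ncard {i | v i ≤ b} : ℝ) - Set.ncard {i | v i ≤ a} := by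
    have h1 : F.card ≤ ({i | v i ≤ b} \ {i | v i ≤ a}).ncard := by
      rw [← Set.ncard_coe_finset]
      exact Set.ncard_le_ncard hsub ((hfin b).subset Set.sdiff_subset)
    have h2 := Set.ncard_sdiff_add_ncard_of_subset
      (show {i | v i ≤ a} ⊆ {i | v i ≤ b} from fun i hi => le_trans hi hab) (hfin b)
    have h3 : (({i | v i ≤ b} \ {i | v i ≤ a}).ncard : ℝ) + ({i | v i ≤ a}.ncard : ℝ) =
      ({i | v i ≤ b}.ncard : ℝ) := by exact_mod_cast h2
    have h4 : (F.card : ℝ) ≤ ({i | v i ≤ b} \ {i | v i ≤ a}).ncard := by exact_mod_cast h1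
    linarith
  have hej : 1 ≤ Real.exp j := Real.one_le_exp hj
  have hz1 : 1 ≤ y * Real.exp j := by nlinarith
  have hbz : b ≤ y * Real.exp j := by rw [hb]; gcongr
  have h1 := abs_ncard_sub_le hv hA hK hθ hcnt (by positivity : 0 ≤ b) hbz hz1
  have h2 := abs_ncard_sub_le hv hA hK hθ hcnt (by positivity : 0 ≤ a) (hab.trans hbz) hz1
  rw [abs_le] at h1 h2
  have hzθ : (y * Real.exp j) ^ θ ≤ y ^ θ * Real.exp (2 * j) := by
    rw [Real.mul_rpow hy0.le (Real.exp_pos _).le, ← Real.exp_mul]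
    exact mul_le_mul_of_nonneg_left (Real.exp_le_exp.2 (by nlinarith)) (by positivity)
  have hba : b - a ≤ 2 * (y / T) * Real.exp (2 * j) := by
    have e1 : Real.exp (-h) = Real.exp h * Real.exp (-(2 * h)) := by
      rw [← Real.exp_add]; ring_nf
    have e2 : 1 - 2 * h ≤ Real.exp (-(2 * h)) := by
      have := Real.add_one_le_exp (-(2 * h)); linarith
    have e3 : Real.exp h ≤ Real.exp j := Real.exp_le_exp.2 hhj
    have e4 : j ≤ Real.exp j := by have := Real.add_one_le_exp j; linarith
    calc b - a = y * (Real.exp h * (1 - Real.exp (-(2 * h)))) := by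
          rw [ha, hb, e1]; ring
      _ ≤ y * (Real.exp h * (2 * h)) := by gcongr; linarith
      _ = 2 * (y / T) * (Real.exp h * j) := by rw [hh]; field_simp
      _ ≤ 2 * (y / T) * (Real.exp j * Real.exp j) := by gcongr
      _ = _ := by rw [← Real.exp_add]; ring_nf
  have hKA : 0 ≤ K + A := by linarith
  calc (F.card : ℝ) ≤ A * (b - a) + 2 * ((K + A) * (y * Real.exp j) ^ θ) := by linarith
    _ ≤ (K + A) * (2 * (y / T) * Real.exp (2 * j)) +
        2 * ((K + A) * (y ^ θ * Real.exp (2 * j))) := by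
      gcongr
      · linarith
    _ = _ := by ring

theorem sum_gaussian_log_le {ι : Type*} {v : ι → ℝ} (hv : ∀ i, 1 ≤ v i)
    (hfin : ∀ x, {i | v i ≤ x}.Finite) {A θ K : ℝ} (hA : 0 ≤ A)
    (hK : 0 ≤ K) (hθ : 0 ≤ θ) (hθ1 : θ ≤ 1)
    (hcnt : ∀ x, 1 ≤ x → |(Set.ncard {i | v i ≤ x} : ℝ) - A * x| ≤ K * x ^ θ)
    (F : Finset ι) {y T : ℝ} (hy : 1 ≤ y) (hT : 1 ≤ T) :
    ∑ i ∈ F, Real.exp (-(T * (Real.log (v i) - Real.log y)) ^ 2 / 4) ≤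
      4 * Real.exp 12 * (K + A) * (y / T + y ^ θ) := by
  classical
  set Y : ι → ℝ := fun i => T * (Real.log (v i) - Real.log y) with hY
  set m : ι → ℕ := fun i => ⌊|Y i|⌋₊ + 1 with hm
  set J := F.sup m + 1 with hJ
  have hterm : ∀ i ∈ F, Real.exp (-(Y i) ^ 2 / 4) ≤
      ∑ j ∈ Finset.range J, if |Y i| < j then Real.exp (12 - 3 * j) else 0 := by
    intro i hi
    have hmem : m i ∈ Finset.range J := Finset.mem_range.2 (Nat.lt_succ_of_le (Finset.le_sup hi))
    refine le_trans ?_ (Finset.single_le_sum (f := fun j : ℕ =>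
      if |Y i| < j then Real.exp (12 - 3 * j) else 0) (fun j _ => by positivity) hmem)
    have h1 : |Y i| < m i := by simpa [hm] using Nat.lt_floor_add_one |Y i|
    have h2 : (m i : ℝ) ≤ |Y i| + 1 := by
      have := Nat.floor_le (abs_nonneg (Y i)); simp only [hm]; push_cast; linarith
    simp only [h1, if_true]
    apply Real.exp_le_exp.2
    rw [← sq_abs (Y i)]
    nlinarith [sq_nonneg (|Y i| / 2 - 3)]
  have hKA : 0 ≤ K + A := by linarith
  have hy0 : 0 < y := by linarith
  have hT0 : 0 < T := by linarith
  calc _ ≤ ∑ i ∈ F, ∑ j ∈ Finset.range J, if |Y i| < j then Real.exp (12 - 3 * j) else 0 :=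
        Finset.sum_le_sum hterm
    _ = ∑ j ∈ Finset.range J, ∑ i ∈ F, if |Y i| < j then Real.exp (12 - 3 * j) else 0 :=
        Finset.sum_comm
    _ ≤ ∑ j ∈ Finset.range J, 2 * Real.exp 12 * (K + A) * (y / T + y ^ θ) * (1 / 2) ^ j := by
        apply Finset.sum_le_sum
        intro j _
        rw [← Finset.sum_filter, Finset.sum_const, nsmul_eq_mul]
        have hc := card_log_window_le hv hfin hA hK hθ hθ1 hcnt (F.filter fun i => |Y i| < j) hy hT
          (Nat.cast_nonneg j) (fun i hi => (Finset.mem_filter.1 hi).2)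
        have he : Real.exp (-(j : ℝ)) ≤ (1 / 2) ^ j := by
          rw [show -(j : ℝ) = j * (-1) by ring, Real.exp_nat_mul]
          gcongr
          have := Real.exp_one_gt_d9
          rw [Real.exp_neg, one_div]
          gcongr
          linarith
        calc _ ≤ 2 * (K + A) * (y / T + y ^ θ) * Real.exp (2 * j) * Real.exp (12 - 3 * j) := by
              gcongr
          _ = 2 * Real.exp 12 * (K + A) * (y / T + y ^ θ) * Real.exp (-(j : ℝ)) := by
              have : Real.exp (2 * j) * Real.exp (12 - 3 * j) = Real.exp 12 * Real.exp (-(j : ℝ)) := by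
                rw [← Real.exp_add, ← Real.exp_add]; ring_nf
              rw [mul_assoc _ (Real.exp (2 * j)), this]; ring
          _ ≤ _ := by gcongr
    _ ≤ _ := by
        rw [← Finset.mul_sum]
        have := sum_geometric_two_le J
        have h0 : 0 ≤ 2 * Real.exp 12 * (K + A) * (y / T + y ^ θ) := by positivity
        nlinarith

theorem integral_gaussian_mul_normSq_sum {ι : Type*} (F : Finset ι) (a lam : ι → ℝ) {T : ℝ}
    (hT : 0 < T) :
    MeasureTheory.Integrable (fun t : ℝ => Real.exp (-(t / T) ^ 2) *
      ‖∑ i ∈ F, (a i : ℂ) * Complex.exp (-(Complex.I * t * lam i))‖ ^ 2) ∧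
    ∫ t : ℝ, Real.exp (-(t / T) ^ 2) *
      ‖∑ i ∈ F, (a i : ℂ) * Complex.exp (-(Complex.I * t * lam i))‖ ^ 2 =
    T * √Real.pi * ∑ i ∈ F, ∑ j ∈ F,
      a i * a j * Real.exp (-(T * (lam j - lam i)) ^ 2 / 4) := by
  have hb : (0 : ℝ) < ((1 / T ^ 2 : ℝ) : ℂ).re := by rw [Complex.ofReal_re]; positivity
  have key : ∀ t : ℝ, ((Real.exp (-(t / T) ^ 2) *
      ‖∑ i ∈ F, (a i : ℂ) * Complex.exp (-(Complex.I * t * lam i))‖ ^ 2 : ℝ) : ℂ) =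
      ∑ i ∈ F, ∑ j ∈ F, (a i : ℂ) * a j * (Complex.exp (Complex.I * ((lam j - lam i : ℝ) : ℂ) * t) *
        Complex.exp (-((1 / T ^ 2 : ℝ) : ℂ) * t ^ 2)) := by
    intro t
    push_cast
    rw [← Complex.mul_conj', map_sum, Finset.sum_mul_sum, Finset.mul_sum]
    refine Finset.sum_congr rfl fun i _ => ?_
    rw [Finset.mul_sum]
    refine Finset.sum_congr rfl fun j _ => ?_
    have h1 : (starRingEnd ℂ) ((a j : ℂ) * Complex.exp (-(Complex.I * t * lam j))) =
        a j * Complex.exp (Complex.I * t * lam j) := by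
      rw [map_mul, Complex.conj_ofReal, ← Complex.exp_conj]
      simp
    rw [h1]
    have h2 : Complex.exp (-(Complex.I * t * lam i)) * Complex.exp (Complex.I * t * lam j) =
        Complex.exp (Complex.I * (lam j - lam i) * t) := by
      rw [← Complex.exp_add]; ring_nf
    have h3 : Complex.exp (-((t : ℂ) / T) ^ 2) = Complex.exp (-(1 / (T : ℂ) ^ 2) * t ^ 2) := by
      ring_nf
    rw [← h2, h3]
    ring
  have hint : ∀ i j, MeasureTheory.Integrable fun t : ℝ => (a i : ℂ) * a j *
      (Complex.exp (Complex.I * ((lam j - lam i : ℝ) : ℂ) * t) *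
        Complex.exp (-((1 / T ^ 2 : ℝ) : ℂ) * t ^ 2)) := by
    intro i j
    apply MeasureTheory.Integrable.const_mul
    have := integrable_cexp_quadratic hb (Complex.I * ((lam j - lam i : ℝ) : ℂ)) 0
    refine this.congr (Filter.Eventually.of_forall fun t => ?_)
    simp only
    rw [← Complex.exp_add]
    ring_nf
  have hintC : MeasureTheory.Integrable fun t : ℝ => ((Real.exp (-(t / T) ^ 2) *
      ‖∑ i ∈ F, (a i : ℂ) * Complex.exp (-(Complex.I * t * lam i))‖ ^ 2 : ℝ) : ℂ) := by
    simp_rw [key]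
    exact MeasureTheory.integrable_finsetSum _ fun i _ =>
      MeasureTheory.integrable_finsetSum _ fun j _ => hint i j
  refine ⟨hintC.re, ?_⟩
  apply Complex.ofReal_injective
  rw [← integral_complex_ofReal]
  simp_rw [key]
  rw [MeasureTheory.integral_finsetSum _ fun i _ =>
      MeasureTheory.integrable_finsetSum _ fun j _ => hint i j]
  push_cast at hint ⊢
  rw [Finset.mul_sum]
  refine Finset.sum_congr rfl fun i _ => ?_
  rw [MeasureTheory.integral_finsetSum _ fun j _ => hint i j, Finset.mul_sum]
  refine Finset.sum_congr rfl fun j _ => ?_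
  have hg := fourierIntegral_gaussian hb ((lam j - lam i : ℝ) : ℂ)
  push_cast at hg
  rw [MeasureTheory.integral_const_mul, hg]
  have h1 : ((Real.pi : ℂ) / (1 / (T : ℂ) ^ 2)) ^ (1 / 2 : ℂ) = T * (√Real.pi : ℝ) := by
    have : (Real.pi : ℂ) / (1 / (T : ℂ) ^ 2) = ((Real.pi * T ^ 2 : ℝ) : ℂ) := by
      push_cast; field_simp
    rw [this, show (1 / 2 : ℂ) = ((1 / 2 : ℝ) : ℂ) by push_cast; rfl,
      ← Complex.ofReal_cpow (by positivity), ← Real.sqrt_eq_rpow,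
      Real.sqrt_mul (by positivity), Real.sqrt_sq hT.le]
    push_cast; ring
  rw [h1]
  have h2 : -((lam j : ℂ) - lam i) ^ 2 / (4 * (1 / (T : ℂ) ^ 2)) =
      -((T : ℂ) * (lam j - lam i)) ^ 2 / 4 := by
    field_simp
  rw [h2]
  ring

/-- A large-sieve type mean value estimate for general Dirichlet polynomials. -/
theorem integral_normSq_sum_le {ι : Type*} (F : Finset ι) (a lam : ι → ℝ) {T : ℝ} (hT : 0 < T)
    (W : ι → ℝ)
    (hW : ∀ i ∈ F, ∑ j ∈ F, Real.exp (-(T * (lam j - lam i)) ^ 2 / 4) ≤ W i) :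
    ∫ t in (-T)..T, ‖∑ i ∈ F, (a i : ℂ) * Complex.exp (-(Complex.I * t * lam i))‖ ^ 2 ≤
      Real.exp 1 * √Real.pi * T * ∑ i ∈ F, a i ^ 2 * W i := by
  obtain ⟨hint, heq⟩ := integral_gaussian_mul_normSq_sum F a lam hT
  set f : ℝ → ℝ := fun t => ‖∑ i ∈ F, (a i : ℂ) * Complex.exp (-(Complex.I * t * lam i))‖ ^ 2
    with hf
  have hfc : Continuous f := by rw [hf]; fun_prop
  have h1 : ∫ t in (-T)..T, f t ≤ Real.exp 1 * ∫ t, Real.exp (-(t / T) ^ 2) * f t := by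
    rw [← MeasureTheory.integral_const_mul, intervalIntegral.integral_of_le (by linarith)]
    refine le_trans (MeasureTheory.setIntegral_mono_on (hfc.integrableOn_Ioc)
      (hint.const_mul _).integrableOn measurableSet_Ioc fun t ht => ?_)
      (MeasureTheory.setIntegral_le_integral (hint.const_mul _)
        (Filter.Eventually.of_forall fun t => by simp only [Pi.zero_apply]; positivity))
    rw [← mul_assoc, ← Real.exp_add]
    refine le_mul_of_one_le_left (by positivity) (Real.one_le_exp ?_)
    have : (t / T) ^ 2 ≤ 1 := by
      rw [div_pow, div_le_one (by positivity)]
      exact sq_le_sq' (by linarith [ht.1]) ht.2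
    linarith
  have h2 : ∑ i ∈ F, ∑ j ∈ F, a i * a j * Real.exp (-(T * (lam j - lam i)) ^ 2 / 4) ≤
      ∑ i ∈ F, a i ^ 2 * W i := by
    set E : ι → ι → ℝ := fun i j => Real.exp (-(T * (lam j - lam i)) ^ 2 / 4) with hE
    have hsymm : ∀ i j, E i j = E j i := fun i j => by simp only [hE]; ring_nf
    have h3 : ∑ i ∈ F, ∑ j ∈ F, a i * a j * E i j ≤
        ∑ i ∈ F, ∑ j ∈ F, (a i ^ 2 / 2 * E i j + a j ^ 2 / 2 * E j i) := by
      refine Finset.sum_le_sum fun i _ => Finset.sum_le_sum fun j _ => ?_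
      rw [← hsymm i j, ← add_mul]
      have : 0 ≤ E i j := (Real.exp_pos _).le
      gcongr
      nlinarith [sq_nonneg (a i - a j)]
    refine h3.trans ?_
    simp_rw [Finset.sum_add_distrib]
    rw [Finset.sum_comm (f := fun i j => a j ^ 2 / 2 * E j i), ← Finset.sum_add_distrib]
    refine Finset.sum_le_sum fun i hi => ?_
    rw [← Finset.mul_sum, ← add_mul, add_halves]
    exact mul_le_mul_of_nonneg_left (hW i hi) (sq_nonneg _)
  calc _ ≤ Real.exp 1 * ∫ t, Real.exp (-(t / T) ^ 2) * f t := h1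
    _ ≤ Real.exp 1 * (T * √Real.pi * ∑ i ∈ F, a i ^ 2 * W i) := by
      rw [heq]; gcongr
    _ = _ := by ring

theorem monotone_ncard_le {ι : Type*} {v : ι → ℝ} (hfin : ∀ x, {i | v i ≤ x}.Finite) :
    Monotone fun x => (Set.ncard {i | v i ≤ x} : ℝ) := fun x y hxy => by
  have : {i | v i ≤ x} ⊆ {i | v i ≤ y} := fun i hi => le_trans hi hxy
  exact Nat.cast_le.2 (Set.ncard_le_ncard this (hfin y))

theorem locallyIntegrable_ncard_sub
    {ι : Type*} {v : ι → ℝ} (hfin : ∀ x, {i | v i ≤ x}.Finite) {A : ℝ} :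
    MeasureTheory.LocallyIntegrable
      (fun u : ℝ => (((Set.ncard {i | v i ≤ u} : ℝ) - A * u : ℝ) : ℂ)) := by
  have h1 : MeasureTheory.LocallyIntegrable
      (fun u : ℝ => (Set.ncard {i | v i ≤ u} : ℝ) - A * u) :=
    (monotone_ncard_le hfin).locallyIntegrable.sub
      (continuous_const.mul continuous_id).locallyIntegrable
  rw [MeasureTheory.locallyIntegrable_iff] at h1 ⊢
  exact fun k hk => (h1 k hk).ofReal

theorem norm_ncard_sub_mul_cpow_le
    {ι : Type*} {v : ι → ℝ}
    {A θ K : ℝ}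
    (hcnt : ∀ x, 1 ≤ x → |(Set.ncard {i | v i ≤ x} : ℝ) - A * x| ≤ K * x ^ θ)
    {X : ℝ} (hX : 1 ≤ X) (s : ℂ) {u : ℝ} (hu : u ∈ Set.Ioi X) :
    ‖(((Set.ncard {i | v i ≤ u} : ℝ) - A * u : ℝ) : ℂ) * (u : ℂ) ^ (-s - 1)‖ ≤
      K * u ^ (-(s.re - θ) - 1) := by
  have hu1 : 1 ≤ u := hX.trans (le_of_lt hu)
  have hu0 : 0 < u := by linarith
  rw [norm_mul, Complex.norm_real, Real.norm_eq_abs, Complex.norm_cpow_eq_rpow_re_of_pos hu0]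
  calc _ ≤ K * u ^ θ * u ^ (-s - 1).re := by gcongr; exact hcnt u hu1
    _ = _ := by
      rw [mul_assoc, ← Real.rpow_add hu0]
      congr 2
      simp; ring

theorem integrableOn_ncard_sub_mul_cpow
    {ι : Type*} {v : ι → ℝ} (hfin : ∀ x, {i | v i ≤ x}.Finite)
    {A θ K : ℝ}
    (hcnt : ∀ x, 1 ≤ x → |(Set.ncard {i | v i ≤ x} : ℝ) - A * x| ≤ K * x ^ θ)
    {X : ℝ} (hX : 1 ≤ X) {s : ℂ} (hs : θ < s.re) :
    MeasureTheory.IntegrableOn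
      (fun u : ℝ => (((Set.ncard {i | v i ≤ u} : ℝ) - A * u : ℝ) : ℂ) * (u : ℂ) ^ (-s - 1))
      (Set.Ioi X) := by
  have hm : MeasureTheory.AEStronglyMeasurable
      (fun u : ℝ => (((Set.ncard {i | v i ≤ u} : ℝ) - A * u : ℝ) : ℂ) * (u : ℂ) ^ (-s - 1))
      (MeasureTheory.volume.restrict (Set.Ioi X)) := by
    refine ((locallyIntegrable_ncard_sub hfin).aestronglyMeasurable.restrict).mul ?_
    refine ContinuousOn.aestronglyMeasurable (fun t ht => ?_) measurableSet_Ioi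
    have ht0 : 0 < t := by linarith [Set.mem_Ioi.1 ht]
    exact (Complex.continuousAt_ofReal_cpow_const _ _ (Or.inr ht0.ne')).continuousWithinAt
  refine MeasureTheory.Integrable.mono'
    ((integrableOn_Ioi_rpow_of_lt (by linarith : -(s.re - θ) - 1 < -1)
      (by linarith : 0 < X)).const_mul K) hm ?_
  filter_upwards [MeasureTheory.ae_restrict_mem measurableSet_Ioi] with u hu
  exact norm_ncard_sub_mul_cpow_le hcnt hX s hu

theorem norm_integral_ncard_sub_le
    {ι : Type*} {v : ι → ℝ}
    {A θ K : ℝ}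
    (hcnt : ∀ x, 1 ≤ x → |(Set.ncard {i | v i ≤ x} : ℝ) - A * x| ≤ K * x ^ θ)
    {X : ℝ} (hX : 1 ≤ X) {s : ℂ} (hs : θ < s.re) :
    ‖∫ u in Set.Ioi X, (((Set.ncard {i | v i ≤ u} : ℝ) - A * u : ℝ) : ℂ) * (u : ℂ) ^ (-s - 1)‖ ≤
      K * (X ^ (θ - s.re) / (s.re - θ)) := by
  have hX0 : 0 < X := by linarith
  have h1 : ∫ u in Set.Ioi X, K * u ^ (-(s.re - θ) - 1) = K * (X ^ (θ - s.re) / (s.re - θ)) := by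
    rw [MeasureTheory.integral_const_mul, integral_Ioi_rpow_neg_sub_one (by linarith) hX0, neg_sub]
  rw [← h1]
  refine MeasureTheory.norm_integral_le_of_norm_le
    ((integrableOn_Ioi_rpow_of_lt (by linarith : -(s.re - θ) - 1 < -1) hX0).const_mul K) ?_
  filter_upwards [MeasureTheory.ae_restrict_mem measurableSet_Ioi] with u hu
  exact norm_ncard_sub_mul_cpow_le hcnt hX s hu

theorem differentiableAt_integral_ncard_sub
    {ι : Type*} {v : ι → ℝ} (hfin : ∀ x, {i | v i ≤ x}.Finite)
    {A θ K : ℝ}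
    (hcnt : ∀ x, 1 ≤ x → |(Set.ncard {i | v i ≤ x} : ℝ) - A * x| ≤ K * x ^ θ)
    {X : ℝ} (hX : 1 ≤ X) {s : ℂ} (hs : θ < s.re) :
    DifferentiableAt ℂ (fun s : ℂ => ∫ u in Set.Ioi X,
      (((Set.ncard {i | v i ≤ u} : ℝ) - A * u : ℝ) : ℂ) * (u : ℂ) ^ (-s - 1)) s := by
  have hX0 : 0 < X := by linarith
  set f : ℝ → ℂ := (Set.Ioi X).indicator
    fun u : ℝ => (((Set.ncard {i | v i ≤ u} : ℝ) - A * u : ℝ) : ℂ) with hf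
  have heq : (fun s : ℂ => ∫ u in Set.Ioi X,
      (((Set.ncard {i | v i ≤ u} : ℝ) - A * u : ℝ) : ℂ) * (u : ℂ) ^ (-s - 1)) =
      fun s => mellin f (-s) := by
    ext z
    rw [mellin]
    have : (fun t : ℝ => (t : ℂ) ^ (-z - 1) • f t) = (Set.Ioi X).indicator
      fun u : ℝ => (((Set.ncard {i | v i ≤ u} : ℝ) - A * u : ℝ) : ℂ) * (u : ℂ) ^ (-z - 1) := by
      ext t
      by_cases ht : t ∈ Set.Ioi X
      · simp only [hf, Set.indicator_of_mem ht, smul_eq_mul]; ring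
      · simp only [hf, Set.indicator_of_notMem ht, smul_zero]
    rw [this, MeasureTheory.setIntegral_indicator measurableSet_Ioi,
      Set.inter_eq_right.2 (Set.Ioi_subset_Ioi hX0.le)]
  rw [heq]
  have hfl : MeasureTheory.LocallyIntegrableOn f (Set.Ioi 0) :=
    ((locallyIntegrable_ncard_sub hfin).indicator measurableSet_Ioi).locallyIntegrableOn _
  have htop : f =O[atTop] fun t : ℝ => t ^ (-(-θ)) := by
    refine Asymptotics.IsBigO.of_bound K ?_
    filter_upwards [eventually_gt_atTop X] with t ht
    have ht1 : 1 ≤ t := by linarith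
    rw [hf, Set.indicator_of_mem (Set.mem_Ioi.2 ht), Complex.norm_real, neg_neg,
      Real.norm_eq_abs, Real.norm_of_nonneg (by positivity)]
    exact hcnt t ht1
  have hbot : f =O[𝓝[>] 0] fun t : ℝ => t ^ (-((-s).re - 1)) := by
    refine Asymptotics.IsBigO.of_bound 0 ?_
    filter_upwards [Ioo_mem_nhdsGT hX0] with t ht
    rw [hf, Set.indicator_of_notMem (by simpa using ht.2.le)]
    simp
  have hd : DifferentiableAt ℂ (mellin f) (-s) :=
    mellin_differentiableAt_of_isBigO_rpow hfl htop (by simpa using hs) hbot (by linarith)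
  exact hd.comp s differentiableAt_id.neg

/-- Partial summation for the Dirichlet series `∑ vᵢ⁻ˢ`. -/
theorem tsum_cpow_eq_sum_add_integral {ι : Type*} [Countable ι] {v : ι → ℝ} (hv : ∀ i, 1 ≤ v i)
    (hfin : ∀ x, {i | v i ≤ x}.Finite) {A θ K : ℝ} (hK : 0 ≤ K) (hθ : θ ≤ 1)
    (hcnt : ∀ x, 1 ≤ x → |(Set.ncard {i | v i ≤ x} : ℝ) - A * x| ≤ K * x ^ θ)
    {X : ℝ} (hX : 1 ≤ X) {s : ℂ} (hs : 1 < s.re) :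
    ∑' i, (v i : ℂ) ^ (-s) = ∑ i ∈ (hfin X).toFinset, (v i : ℂ) ^ (-s) -
      (((Set.ncard {i | v i ≤ X} : ℝ) - A * X : ℝ) : ℂ) * (X : ℂ) ^ (-s) +
      A * (X : ℂ) ^ (1 - s) / (s - 1) +
      s * ∫ u in Set.Ioi X,
        (((Set.ncard {i | v i ≤ u} : ℝ) - A * u : ℝ) : ℂ) * (u : ℂ) ^ (-s - 1) := by
  have hX0 : 0 < X := by linarith
  have hs0 : s ≠ 0 := by rintro rfl; simp at hs; linarith
  have hs1 : s - 1 ≠ 0 := by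
    intro h; rw [sub_eq_zero] at h; rw [h] at hs; simp at hs
  have hv0 : ∀ i, 0 < v i := fun i => by linarith [hv i]
  have hB : ∀ x, 1 ≤ x → (Set.ncard {i | v i ≤ x} : ℝ) ≤ (A + K) * x := by
    intro x hx
    have h1 := (abs_le.1 (hcnt x hx)).2
    have h2 : x ^ θ ≤ x := by
      calc x ^ θ ≤ x ^ (1 : ℝ) := Real.rpow_le_rpow_of_exponent_le hx hθ
        _ = x := Real.rpow_one x
    nlinarith
  have hsumR := summable_rpow_of_ncard_le hv hfin hB hs
  have hsum : Summable fun i => (v i : ℂ) ^ (-s) := by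
    refine Summable.of_norm (hsumR.congr fun i => ?_)
    rw [Complex.norm_cpow_eq_rpow_re_of_pos (hv0 i), Complex.neg_re]
  have hintc : MeasureTheory.IntegrableOn (fun u : ℝ => (u : ℂ) ^ (-s - 1)) (Set.Ioi X) :=
    integrableOn_Ioi_cpow_of_lt (by simp; linarith) hX0
  set f : ι → ℝ → ℂ := fun i u => if v i ≤ u then (u : ℂ) ^ (-s - 1) else 0 with hf
  have hf_int : ∀ i, MeasureTheory.IntegrableOn (f i) (Set.Ioi X) := fun i =>
    integrableOn_Ioi_ite_le hintc
  have hm : ∀ i, 0 < max (v i) X := fun i => lt_max_of_lt_right hX0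
  have hfi : ∀ i, ∫ u in Set.Ioi X, f i u = ((max (v i) X : ℝ) : ℂ) ^ (-s) / s := by
    intro i
    rw [hf]
    simp only
    rw [setIntegral_Ioi_ite_le, integral_Ioi_cpow_of_lt (by simp; linarith) (hm i), sub_add_cancel,
      neg_div_neg_eq]
  have hfn : ∀ i, ∫ u in Set.Ioi X, ‖f i u‖ = (max (v i) X) ^ (-s.re) / s.re := by
    intro i
    rw [← integral_Ioi_rpow_neg_sub_one (by linarith) (hm i), ← setIntegral_Ioi_ite_le]
    refine MeasureTheory.setIntegral_congr_fun measurableSet_Ioi fun u hu => ?_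
    have hu0 : 0 < u := hX0.trans hu
    simp only [hf]
    split_ifs
    · rw [Complex.norm_cpow_eq_rpow_re_of_pos hu0]; simp
    · simp
  have hfsum : Summable fun i => ∫ u in Set.Ioi X, ‖f i u‖ := by
    refine Summable.of_nonneg_of_le (fun i => by positivity) (fun i => ?_) (hsumR.div_const s.re)
    rw [hfn]
    gcongr ?_ / _
    exact Real.rpow_le_rpow_of_nonpos (hv0 i) (le_max_left _ _) (by linarith)
  have hmain := MeasureTheory.hasSum_integral_of_summable_integral_norm hf_int hfsum
  simp_rw [hfi] at hmain
  have htsum : ∀ u : ℝ, ∑' i, f i u = ((Set.ncard {i | v i ≤ u} : ℝ) : ℂ) * (u : ℂ) ^ (-s - 1) := by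
    intro u
    rw [tsum_eq_sum (s := (hfin u).toFinset) (fun i hi => by
      simp only [Set.Finite.mem_toFinset, Set.mem_ofPred_eq] at hi
      simp [hf, hi])]
    rw [Finset.sum_congr rfl (g := fun _ => (u : ℂ) ^ (-s - 1)) (fun i hi => by
      simp only [Set.Finite.mem_toFinset, Set.mem_ofPred_eq] at hi
      simp [hf, hi]), Finset.sum_const, nsmul_eq_mul, Set.ncard_eq_toFinset_card _ (hfin u)]
    simp
  have hsplit : ∫ u in Set.Ioi X, ∑' i, f i u =
      A * ((X : ℂ) ^ (1 - s) / (s - 1)) + ∫ u in Set.Ioi X,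
        (((Set.ncard {i | v i ≤ u} : ℝ) - A * u : ℝ) : ℂ) * (u : ℂ) ^ (-s - 1) := by
    have h1 : ∫ u in Set.Ioi X, (A : ℂ) * (u : ℂ) ^ (-s) =
        A * ((X : ℂ) ^ (1 - s) / (s - 1)) := by
      rw [MeasureTheory.integral_const_mul, integral_Ioi_cpow_of_lt (by simp; linarith) hX0]
      rw [show -s + 1 = 1 - s by ring, ← neg_div_neg_eq, neg_neg, neg_sub]
    rw [← h1, ← MeasureTheory.integral_add
      ((integrableOn_Ioi_cpow_of_lt (by simp; linarith) hX0).const_mul _)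
      (integrableOn_ncard_sub_mul_cpow hfin hcnt hX (by linarith))]
    refine MeasureTheory.setIntegral_congr_fun measurableSet_Ioi fun u hu => ?_
    have hu0 : (u : ℂ) ≠ 0 := by exact_mod_cast (hX0.trans hu).ne'
    rw [htsum, show -s = -s - 1 + 1 by ring, Complex.cpow_add _ _ hu0, Complex.cpow_one]
    push_cast
    ring_nf
  have hmax := hmain.mul_left s
  rw [hsplit] at hmax
  simp_rw [mul_div_cancel₀ _ hs0] at hmax
  have hdiff := hsum.hasSum.sub hmax
  have hfinite : HasSum (fun i => (v i : ℂ) ^ (-s) - ((max (v i) X : ℝ) : ℂ) ^ (-s))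
      (∑ i ∈ (hfin X).toFinset, ((v i : ℂ) ^ (-s) - ((max (v i) X : ℝ) : ℂ) ^ (-s))) := by
    refine hasSum_sum_of_ne_finset_zero fun i hi => ?_
    simp only [Set.Finite.mem_toFinset, Set.mem_ofPred_eq, not_le] at hi
    rw [max_eq_left hi.le, sub_self]
  have heq := hdiff.unique hfinite
  rw [Finset.sum_sub_distrib, Finset.sum_congr (s₁ := (hfin X).toFinset) rfl
    (g := fun _ => (X : ℂ) ^ (-s)) (f := fun i => ((max (v i) X : ℝ) : ℂ) ^ (-s)) (fun i hi => by
      simp only [Set.Finite.mem_toFinset, Set.mem_ofPred_eq] at hi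
      rw [max_eq_right hi]), Finset.sum_const, nsmul_eq_mul,
    ← Set.ncard_eq_toFinset_card _ (hfin X)] at heq
  have hXs : (X : ℂ) ^ (1 - s) = X * (X : ℂ) ^ (-s) := by
    rw [sub_eq_add_neg, Complex.cpow_add _ _ (by exact_mod_cast hX0.ne'), Complex.cpow_one]
  rw [eq_add_of_sub_eq heq, hXs]
  push_cast
  field_simp
  ring

theorem norm_continuation_sub_sum_le {ι : Type*} [Countable ι] {v : ι → ℝ} (hv : ∀ i, 1 ≤ v i)
    (hfin : ∀ x, {i | v i ≤ x}.Finite) {A θ K : ℝ} (hA : 0 ≤ A) (hK : 0 ≤ K) (hθ : θ ≤ 1)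
    (hcnt : ∀ x, 1 ≤ x → |(Set.ncard {i | v i ≤ x} : ℝ) - A * x| ≤ K * x ^ θ)
    {Z : ℂ → ℂ} (hZd : DifferentiableOn ℂ Z {s : ℂ | θ < s.re ∧ s ≠ 1})
    (hZ : ∀ s : ℂ, 1 < s.re → Z s = ∑' i, (v i : ℂ) ^ (-s))
    {X : ℝ} (hX : 1 ≤ X) {s : ℂ} (hs : θ < s.re) (hsim : s.im ≠ 0) :
    ‖Z s - ∑ i ∈ (hfin X).toFinset, (v i : ℂ) ^ (-s)‖ ≤
      K * X ^ (θ - s.re) + A * X ^ (1 - s.re) / |s.im| +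
        ‖s‖ * (K * (X ^ (θ - s.re) / (s.re - θ))) := by
  have hX0 : 0 < X := by linarith
  have hv0 : ∀ i, 0 < v i := fun i => by linarith [hv i]
  set H : ℂ → ℂ := fun s => ∑ i ∈ (hfin X).toFinset, (v i : ℂ) ^ (-s) -
      (((Set.ncard {i | v i ≤ X} : ℝ) - A * X : ℝ) : ℂ) * (X : ℂ) ^ (-s) +
      A * (X : ℂ) ^ (1 - s) / (s - 1) +
      s * ∫ u in Set.Ioi X,
        (((Set.ncard {i | v i ≤ u} : ℝ) - A * u : ℝ) : ℂ) * (u : ℂ) ^ (-s - 1) with hH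
  set U : Set ℂ := {z | θ < z.re ∧ 0 < s.im * z.im} with hU
  have hUo : IsOpen U := (isOpen_lt continuous_const Complex.continuous_re).inter
    (isOpen_lt continuous_const (continuous_const.mul Complex.continuous_im))
  have hUc : Convex ℝ U := by
    refine (convex_halfSpace_re_gt θ).inter ?_
    have := (convex_Ioi (0 : ℝ)).linear_preimage (s.im • Complex.imLm)
    exact this
  have hne1 : ∀ z ∈ U, z ≠ 1 := by
    rintro z hz rfl
    simp [hU] at hz
  have hHd : DifferentiableOn ℂ H U := by
    intro z hz
    refine DifferentiableAt.differentiableWithinAt ?_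
    have hcp : ∀ (a : ℝ), 0 < a → DifferentiableAt ℂ (fun s : ℂ => (a : ℂ) ^ (-s)) z := fun a ha =>
      differentiableAt_id.neg.const_cpow (Or.inl (by exact_mod_cast ha.ne'))
    have h1 : DifferentiableAt ℂ (fun s : ℂ => ∑ i ∈ (hfin X).toFinset, (v i : ℂ) ^ (-s)) z :=
      DifferentiableAt.fun_sum fun i _ => hcp _ (hv0 i)
    have h2 : DifferentiableAt ℂ (fun s : ℂ => A * (X : ℂ) ^ (1 - s) / (s - 1)) z := by
      refine DifferentiableAt.fun_div (DifferentiableAt.const_mul ?_ _) (by fun_prop)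
        (sub_ne_zero.2 (hne1 z hz))
      exact (differentiableAt_id.const_sub 1).const_cpow (Or.inl (by exact_mod_cast hX0.ne'))
    exact ((h1.sub ((hcp X hX0).const_mul _)).add h2).add
      (differentiableAt_id.mul (differentiableAt_integral_ncard_sub hfin hcnt hX hz.1))
  have hsU : s ∈ U := ⟨hs, mul_self_pos.2 hsim⟩
  set z0 : ℂ := ⟨2, s.im⟩
  have hz0 : z0 ∈ U := ⟨by simp only [z0]; linarith, mul_self_pos.2 hsim⟩
  have hev : Z =ᶠ[𝓝 z0] H := by
    filter_upwards [(isOpen_lt continuous_const Complex.continuous_re).mem_nhds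
      (show (1 : ℝ) < z0.re by simp [z0])] with z hz
    rw [hZ z hz, hH]
    exact tsum_cpow_eq_sum_add_integral hv hfin hK hθ hcnt hX hz
  have heq : Z s = H s := by
    refine AnalyticOnNhd.eqOn_of_preconnected_of_eventuallyEq (𝕜 := ℂ)
      ((hZd.mono fun z hz => ⟨hz.1, hne1 z hz⟩).analyticOnNhd hUo)
      (hHd.analyticOnNhd hUo) hUc.isPreconnected hz0 hev hsU
  have hrew : Z s - ∑ i ∈ (hfin X).toFinset, (v i : ℂ) ^ (-s) =
      -((((Set.ncard {i | v i ≤ X} : ℝ) - A * X : ℝ) : ℂ) * (X : ℂ) ^ (-s)) +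
      A * (X : ℂ) ^ (1 - s) / (s - 1) +
      s * ∫ u in Set.Ioi X,
        (((Set.ncard {i | v i ≤ u} : ℝ) - A * u : ℝ) : ℂ) * (u : ℂ) ^ (-s - 1) := by
    rw [heq, hH]; ring
  rw [hrew]
  refine (norm_add_le _ _).trans (add_le_add ((norm_add_le _ _).trans (add_le_add ?_ ?_)) ?_)
  · rw [norm_neg, norm_mul, Complex.norm_real, Real.norm_eq_abs,
      Complex.norm_cpow_eq_rpow_re_of_pos hX0]
    calc _ ≤ K * X ^ θ * X ^ (-s).re := by gcongr; exact hcnt X hX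
      _ = _ := by rw [mul_assoc, ← Real.rpow_add hX0]; rfl
  · rw [norm_div, norm_mul, Complex.norm_real, Real.norm_of_nonneg hA,
      Complex.norm_cpow_eq_rpow_re_of_pos hX0]
    have h1 : |s.im| ≤ ‖s - 1‖ := by simpa using Complex.abs_im_le_norm (s - 1)
    have h2 : 0 < |s.im| := abs_pos.2 hsim
    simp only [Complex.sub_re, Complex.one_re]
    gcongr
  · rw [norm_mul]
    gcongr
    exact norm_integral_ncard_sub_le hcnt hX hs

/-- The exponent vectors that do not involve the first `K` generalized primes. -/
def sieved (K : ℕ) : Set (ℕ →₀ ℕ) := {n | ∀ k < K, n k = 0}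

theorem sieved_zero : sieved 0 = Set.univ := by simp [sieved]

theorem sieved_eq_union (K : ℕ) :
    sieved K = sieved (K + 1) ∪ (· + Finsupp.single K 1) '' sieved K := by
  ext n
  constructor
  · intro hn
    by_cases h : n K = 0
    · refine Or.inl fun k hk => ?_
      rcases Nat.lt_succ_iff_lt_or_eq.1 hk with hk | rfl
      · exact hn k hk
      · exact h
    · refine Or.inr ⟨n - Finsupp.single K 1, fun k hk => ?_, Finsupp.sub_add_single_one_cancel h⟩
      simp [hn k hk]
  · rintro (hn | ⟨m, hm, rfl⟩) k hk
    · exact hn k (hk.trans K.lt_succ_self)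
    · simp [hm k hk, hk.ne']

theorem disjoint_sieved_image (K : ℕ) :
    Disjoint (sieved (K + 1)) ((· + Finsupp.single K 1) '' sieved K) := by
  rw [Set.disjoint_left]
  rintro _ hn ⟨m, -, rfl⟩
  simpa using hn K K.lt_succ_self

namespace BeurlingSystem

variable (S : BeurlingSystem)

theorem p_pos (k : ℕ) : 0 < S.p k := zero_lt_one.trans (S.one_lt_p k)

theorem one_le_val (n : ℕ →₀ ℕ) : 1 ≤ S.val n := by
  refine Finset.prod_induction (fun k => S.p k ^ n k) (1 ≤ ·) (fun a b ha hb => ?_) le_rfl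
    fun k _ => one_le_pow₀ (S.one_lt_p k).le
  exact one_le_mul_of_one_le_of_one_le ha hb

theorem val_pos (n : ℕ →₀ ℕ) : 0 < S.val n := zero_lt_one.trans_le (S.one_le_val n)

theorem val_zero : S.val 0 = 1 := by simp [val]

theorem val_add_single (n : ℕ →₀ ℕ) (k : ℕ) :
    S.val (n + Finsupp.single k 1) = S.val n * S.p k := by
  rw [val, Finsupp.prod_add_index' (by simp) (fun k => pow_add _),
    Finsupp.prod_single_index (by simp), pow_one, val]

theorem WellBehaved.finite_val_le {S : BeurlingSystem} {A θ K₀ : ℝ} (h : S.WellBehaved A θ K₀)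
    (x : ℝ) : {n | S.val n ≤ x}.Finite := by
  obtain ⟨hA, -, hθ, -, hc⟩ := h
  have h0 : Tendsto (fun y : ℝ => K₀ * y ^ (-(1 - θ))) atTop (𝓝 (K₀ * 0)) :=
    (tendsto_rpow_neg_atTop (sub_pos.2 hθ)).const_mul _
  rw [mul_zero] at h0
  obtain ⟨y, hy, hxy, hy1⟩ := ((h0.eventually_lt_const hA).and
    ((eventually_ge_atTop x).and (eventually_ge_atTop 1))).exists
  have hy0 : 0 < y := by linarith
  have h2 : K₀ * y ^ θ < A * y := by
    have : y ^ θ = y ^ (-(1 - θ)) * y := by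
      rw [← Real.rpow_add_one hy0.ne']; ring_nf
    rw [this, ← mul_assoc]
    gcongr
  have h3 : 0 < S.cnt y := by
    have := (abs_le.1 (hc y hy1)).1
    linarith
  refine (Set.finite_of_ncard_ne_zero (s := {n | S.val n ≤ y}) ?_).subset
    fun n hn => le_trans hn hxy
  intro h4
  rw [cnt, h4] at h3
  simp at h3

theorem WellBehaved.finite_val_sieved_le {S : BeurlingSystem} {A θ K₀ : ℝ}
    (h : S.WellBehaved A θ K₀) (K : ℕ) (x : ℝ) : {n : sieved K | S.val n ≤ x}.Finite :=
  (h.finite_val_le x).preimage Subtype.val_injective.injOn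

theorem ncard_sieved_succ (hfin : ∀ x, {n | S.val n ≤ x}.Finite) (K : ℕ) (x : ℝ) :
    (Set.ncard {n : sieved (K + 1) | S.val n ≤ x} : ℝ) =
      Set.ncard {n : sieved K | S.val n ≤ x} - Set.ncard {n : sieved K | S.val n ≤ x / S.p K} := by
  have key : ∀ (L : ℕ) (y : ℝ), Set.ncard {n : sieved L | S.val n ≤ y} =
      Set.ncard (sieved L ∩ {n | S.val n ≤ y}) := fun L y => by
    rw [← Set.ncard_image_of_injective _ Subtype.val_injective]
    congr 1
    ext n
    simp [and_comm]
  have hsplit : sieved K ∩ {n | S.val n ≤ x} = (sieved (K + 1) ∩ {n | S.val n ≤ x}) ∪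
      (· + Finsupp.single K 1) '' (sieved K ∩ {n | S.val n ≤ x / S.p K}) := by
    rw [sieved_eq_union K, Set.union_inter_distrib_right, ← sieved_eq_union K]
    congr 1
    ext n
    constructor
    · rintro ⟨⟨m, hm, rfl⟩, hn⟩
      refine ⟨m, ⟨hm, ?_⟩, rfl⟩
      rw [Set.mem_ofPred_eq, val_add_single] at hn
      exact (le_div_iff₀ (S.p_pos K)).2 hn
    · rintro ⟨m, ⟨hm, hx⟩, rfl⟩
      refine ⟨⟨m, hm, rfl⟩, ?_⟩
      rw [Set.mem_ofPred_eq, val_add_single]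
      exact (le_div_iff₀ (S.p_pos K)).1 hx
  have hcard := Set.ncard_union_eq (Disjoint.mono Set.inter_subset_left
    (Set.image_mono Set.inter_subset_left) (disjoint_sieved_image K))
    ((hfin x).inter_of_right (sieved (K + 1)))
    (((hfin (x / S.p K)).inter_of_right (sieved K)).image (· + Finsupp.single K 1))
  rw [← hsplit, Set.ncard_image_of_injective _ (add_left_injective _)] at hcard
  rw [key, key, key, hcard]
  push_cast
  ring

theorem WellBehaved.exists_sieved {S : BeurlingSystem} {A θ K₀ : ℝ} (h : S.WellBehaved A θ K₀)
    (K : ℕ) : ∃ A' ≥ 0, ∃ C ≥ 0, ∀ x : ℝ, 1 ≤ x →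
      |(Set.ncard {n : sieved K | S.val n ≤ x} : ℝ) - A' * x| ≤ C * x ^ θ := by
  have hfin := h.finite_val_le
  obtain ⟨hA, hθ, -, hK, hc⟩ := h
  induction K with
  | zero =>
    refine ⟨A, hA.le, K₀, hK, fun x hx => ?_⟩
    convert hc x hx using 4
    rw [cnt, ← Set.ncard_image_of_injective _ Subtype.val_injective]
    congr 2
    ext n
    simp [sieved_zero]
  | succ K ih =>
    obtain ⟨A', hA', C, hC, hb⟩ := ih
    have hp := S.one_lt_p K
    refine ⟨A' * (1 - (S.p K)⁻¹), mul_nonneg hA' (sub_nonneg.2 (inv_le_one_of_one_le₀ hp.le)),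
      C + (C + A'), by positivity, fun x hx => ?_⟩
    have hx0 : 0 ≤ x := by linarith
    have h1 := hb x hx
    have h2 := abs_ncard_sub_le (v := fun n : sieved K => S.val n) (fun n => S.one_le_val n) hA'
      hC hθ hb (x := x / S.p K) (z := x) (div_nonneg hx0 (S.p_pos K).le)
      (div_le_self hx0 hp.le) hx
    rw [S.ncard_sieved_succ hfin]
    calc _ = |((Set.ncard {n : sieved K | S.val n ≤ x} : ℝ) - A' * x) -
          ((Set.ncard {n : sieved K | S.val n ≤ x / S.p K} : ℝ) - A' * (x / S.p K))| := by
          congr 1; ring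
      _ ≤ _ := abs_sub _ _
      _ ≤ _ := by linarith

theorem WellBehaved.summable_val_rpow {S : BeurlingSystem} {A θ K₀ : ℝ}
    (h : S.WellBehaved A θ K₀) {σ : ℝ} (hσ : 1 < σ) : Summable fun n => S.val n ^ (-σ) := by
  have hfin := h.finite_val_le
  obtain ⟨hA, hθ, hθ1, hK, hc⟩ := h
  refine summable_rpow_of_ncard_le (B := A + K₀) S.one_le_val hfin (fun x hx => ?_) hσ
  have h1 := (abs_le.1 (hc x hx)).2
  have h2 : x ^ θ ≤ x := by
    simpa using Real.rpow_le_rpow_of_exponent_le hx hθ1.le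
  have h3 := mul_le_mul_of_nonneg_left h2 hK
  rw [cnt] at h1
  linarith

theorem WellBehaved.summable_val_cpow {S : BeurlingSystem} {A θ K₀ : ℝ}
    (h : S.WellBehaved A θ K₀) {s : ℂ} (hs : 1 < s.re) :
    Summable fun n => (S.val n : ℂ) ^ (-s) := by
  refine Summable.of_norm ((h.summable_val_rpow hs).congr fun n => ?_)
  rw [Complex.norm_cpow_eq_rpow_re_of_pos (S.val_pos n)]
  simp

theorem WellBehaved.tsum_sieved_succ {S : BeurlingSystem} {A θ K₀ : ℝ}
    (h : S.WellBehaved A θ K₀) {s : ℂ} (hs : 1 < s.re) (K : ℕ) :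
    ∑' n : sieved (K + 1), (S.val n : ℂ) ^ (-s) =
      (1 - (S.p K : ℂ) ^ (-s)) * ∑' n : sieved K, (S.val n : ℂ) ^ (-s) := by
  have hsum := h.summable_val_cpow hs
  have h1 := Summable.tsum_union_disjoint (f := fun n => (S.val n : ℂ) ^ (-s))
    (disjoint_sieved_image K) (hsum.subtype _) (hsum.subtype _)
  rw [← sieved_eq_union, tsum_image (fun n => (S.val n : ℂ) ^ (-s))
    (add_left_injective _).injOn] at h1
  simp_rw [val_add_single, Complex.ofReal_mul,
    Complex.mul_cpow_ofReal_nonneg (S.val_pos _).le (S.p_pos _).le, tsum_mul_right] at h1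
  rw [sub_mul, one_mul]
  linear_combination -h1

/-- The zeta function `ζ` with the Euler factors of the first `K` generalized primes removed. -/
noncomputable def sievedZeta (ζ : ℂ → ℂ) (K : ℕ) (s : ℂ) : ℂ :=
  ζ s * ∏ k ∈ Finset.range K, (1 - (S.p k : ℂ) ^ (-s))

theorem IsZeta.sievedZeta_eq_tsum {S : BeurlingSystem} {A θ K₀ : ℝ} (h : S.WellBehaved A θ K₀)
    {ζ : ℂ → ℂ} (hζ : S.IsZeta θ ζ) (K : ℕ) {s : ℂ} (hs : 1 < s.re) :
    S.sievedZeta ζ K s = ∑' n : sieved K, (S.val n : ℂ) ^ (-s) := by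
  induction K with
  | zero =>
    rw [sieved_zero, tsum_univ (fun n => (S.val n : ℂ) ^ (-s)), sievedZeta, hζ.2 s hs]
    simp
  | succ K ih =>
    rw [h.tsum_sieved_succ hs, ← ih, sievedZeta, sievedZeta, Finset.prod_range_succ]
    ring

theorem IsZeta.differentiableOn_sievedZeta {S : BeurlingSystem} {θ : ℝ} {ζ : ℂ → ℂ}
    (hζ : S.IsZeta θ ζ) (K : ℕ) :
    DifferentiableOn ℂ (S.sievedZeta ζ K) {s : ℂ | θ < s.re ∧ s ≠ 1} := by
  refine hζ.1.mul (DifferentiableOn.fun_finsetProd fun k _ => ?_)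
  have : Differentiable ℂ fun s : ℂ => 1 - (S.p k : ℂ) ^ (-s) := fun s =>
    (differentiableAt_id.neg.const_cpow
      (Or.inl (by exact_mod_cast (S.p_pos k).ne'))).const_sub 1
  exact this.differentiableOn

theorem WellBehaved.exists_sum_sieved_le {S : BeurlingSystem} {A θ K₀ : ℝ}
    (h : S.WellBehaved A θ K₀) {σ : ℝ} (hσ : 1 < σ) {ε : ℝ} (hε : 0 < ε) :
    ∃ K, ∀ F : Finset (ℕ →₀ ℕ), (∀ n ∈ F, n ∈ sieved K ∧ n ≠ 0) →
      ∑ n ∈ F, S.val n ^ (-σ) ≤ ε := by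
  classical
  obtain ⟨s, hs⟩ := summable_iff_vanishing_norm.1 (h.summable_val_rpow hσ) ε hε
  refine ⟨(s.biUnion Finsupp.support).sup id + 1, fun F hF => ?_⟩
  refine (le_abs_self _).trans (hs F (Finset.disjoint_left.2 fun n hn hns => ?_)).le
  refine (hF n hn).2 (Finsupp.ext fun k => ?_)
  by_contra hk
  have hmem : k ∈ s.biUnion Finsupp.support :=
    Finset.mem_biUnion.2 ⟨n, hns, Finsupp.mem_support_iff.2 hk⟩
  exact hk ((hF n hn).1 k (Nat.lt_succ_of_le (Finset.le_sup (f := id) hmem)))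

end BeurlingSystem

namespace BeurlingSystem

theorem WellBehaved.integral_normSq_sum_val_le {S : BeurlingSystem} {A θ K₀ : ℝ}
    (h : S.WellBehaved A θ K₀) (F : Finset (ℕ →₀ ℕ)) (σ : ℝ) {T : ℝ} (hT : 1 ≤ T) :
    ∫ t in (-T)..T, ‖∑ n ∈ F, (S.val n : ℂ) ^ (-(σ + t * Complex.I : ℂ))‖ ^ 2 ≤
      Real.exp 1 * √Real.pi * (4 * Real.exp 12 * (K₀ + A)) *
        (∑ n ∈ F, S.val n ^ (1 - 2 * σ) + T * ∑ n ∈ F, S.val n ^ (θ - 2 * σ)) := by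
  have hfin := h.finite_val_le
  obtain ⟨hA, hθ, hθ1, hK, hc⟩ := h
  have hT0 : 0 < T := by linarith
  have h1 := integral_normSq_sum_le F (fun n => S.val n ^ (-σ)) (fun n => Real.log (S.val n)) hT0
    (fun n => 4 * Real.exp 12 * (K₀ + A) * (S.val n / T + S.val n ^ θ)) fun n _ =>
      sum_gaussian_log_le S.one_le_val hfin hA.le hK hθ hθ1.le hc F (S.one_le_val n) hT
  have h2 : ∀ (n : ℕ →₀ ℕ) (t : ℝ), (S.val n : ℂ) ^ (-(σ + t * Complex.I : ℂ)) =
      ((S.val n ^ (-σ) : ℝ) : ℂ) * Complex.exp (-(Complex.I * t * Real.log (S.val n))) := by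
    intro n t
    have h0 : (S.val n : ℂ) ≠ 0 := by exact_mod_cast (S.val_pos n).ne'
    rw [neg_add, Complex.cpow_add _ _ h0, Complex.ofReal_cpow (S.val_pos n).le,
      Complex.ofReal_neg]
    congr 1
    rw [Complex.cpow_def_of_ne_zero h0, Complex.ofReal_log (S.val_pos n).le]
    congr 1
    ring
  simp_rw [h2]
  refine h1.trans_eq ?_
  rw [Finset.mul_sum, Finset.mul_sum, ← Finset.sum_add_distrib, Finset.mul_sum]
  refine Finset.sum_congr rfl fun n _ => ?_
  have h0 := S.val_pos n
  have e1 : S.val n ^ (1 - 2 * σ) = (S.val n ^ (-σ)) ^ 2 * S.val n := by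
    rw [sq, ← Real.rpow_add h0, ← Real.rpow_add_one h0.ne']; ring_nf
  have e2 : S.val n ^ (θ - 2 * σ) = (S.val n ^ (-σ)) ^ 2 * S.val n ^ θ := by
    rw [sq, ← Real.rpow_add h0, ← Real.rpow_add h0]; ring_nf
  rw [e1, e2]
  field_simp

theorem IsZeta.continuousOn_sievedZeta_line {S : BeurlingSystem} {θ : ℝ} {ζ : ℂ → ℂ}
    (hζ : S.IsZeta θ ζ) (K : ℕ) {σ : ℝ} (hσ : θ < σ) {s : Set ℝ} (hs : ∀ t ∈ s, t ≠ 0) :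
    ContinuousOn (fun t : ℝ => S.sievedZeta ζ K (σ + t * Complex.I)) s := by
  refine (hζ.differentiableOn_sievedZeta K).continuousOn.comp (by fun_prop) fun t ht => ?_
  refine ⟨by simpa using hσ, fun h => hs t ht ?_⟩
  simpa using congrArg Complex.im h

set_option maxHeartbeats 1000000 in
theorem IsZeta.exists_normSq_sievedZeta_sub_one_le {S : BeurlingSystem} {A θ K₀ : ℝ}
    (h : S.WellBehaved A θ K₀) {ζ : ℂ → ℂ} (hζ : S.IsZeta θ ζ) (K : ℕ) {σ₁ : ℝ} (hσ₁ : θ < σ₁)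
    (σ₂ : ℝ) : ∃ B : ℝ, 0 ≤ B ∧ ∀ X T : ℝ, 1 ≤ X → 1 ≤ T → ∃ F : Finset (ℕ →₀ ℕ),
      (∀ n ∈ F, n ∈ sieved K ∧ n ≠ 0 ∧ S.val n ≤ X) ∧
      ∀ σ t : ℝ, σ₁ ≤ σ → σ ≤ σ₂ → 1 ≤ |t| → |t| ≤ T →
        ‖S.sievedZeta ζ K (σ + t * Complex.I) - 1‖ ^ 2 ≤
          2 * ‖∑ n ∈ F, (S.val n : ℂ) ^ (-(σ + t * Complex.I : ℂ))‖ ^ 2 +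
          B * (T ^ 2 * X ^ (2 * (θ - σ₁)) + X ^ (2 * (1 - σ₁)) * (1 + t ^ 2)⁻¹) := by
  classical
  obtain ⟨A', hA', C, hC, hb⟩ := h.exists_sieved K
  have hfin := h.finite_val_sieved_le K
  have hθ := h.2.1
  set B := C + A' + (|σ₂| + 1) * C / (σ₁ - θ) with hB
  have hgap : 0 < σ₁ - θ := sub_pos.2 hσ₁
  have hB0 : 0 ≤ B := by positivity
  refine ⟨8 * B ^ 2, by positivity, fun X T hX hT => ?_⟩
  have h0 : (0 : ℕ →₀ ℕ) ∈ sieved K := fun k _ => rfl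
  set G := (hfin X).toFinset.erase ⟨0, h0⟩ with hG
  refine ⟨G.map (Function.Embedding.subtype _), fun n hn => ?_, fun σ t hσ hσ' ht1 htT => ?_⟩
  · obtain ⟨m, hm, rfl⟩ := Finset.mem_map.1 hn
    rw [hG, Finset.mem_erase, Set.Finite.mem_toFinset] at hm
    exact ⟨m.2, fun h => hm.1 (Subtype.ext h), hm.2⟩
  set s : ℂ := σ + t * Complex.I with hs
  have hre : s.re = σ := by simp [hs]
  have him : s.im = t := by simp [hs]
  have ht0 : 0 < |t| := by linarith
  have hX0 : 0 < X := by linarith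
  have hmain := norm_continuation_sub_sum_le (fun n : sieved K => S.one_le_val n) hfin hA' hC
    h.2.2.1.le hb (hζ.differentiableOn_sievedZeta K)
    (fun s hs => hζ.sievedZeta_eq_tsum h K hs) hX (s := s) (by rw [hre]; linarith)
    (by rw [him]; exact abs_pos.1 ht0)
  have hmem : (⟨0, h0⟩ : sieved K) ∈ (hfin X).toFinset := by
    simpa [S.val_zero] using hX
  rw [← Finset.add_sum_erase _ _ hmem, S.val_zero, Complex.ofReal_one, Complex.one_cpow, ← hG,
    hre, him, ← sub_sub] at hmain
  rw [Finset.sum_map]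
  simp only [Function.Embedding.subtype_apply]
  set D := ∑ n ∈ G, (S.val n : ℂ) ^ (-s)
  set Z := S.sievedZeta ζ K s
  have hns : ‖s‖ ≤ (|σ₂| + 1) * T := by
    have h1 : ‖s‖ ≤ |s.re| + |s.im| := Complex.norm_le_abs_re_add_abs_im s
    rw [hre, him, abs_of_nonneg (by linarith)] at h1
    have h2 := le_abs_self σ₂
    have h3 := abs_nonneg σ₂
    nlinarith
  have hXθ : X ^ (θ - σ) ≤ X ^ (θ - σ₁) := Real.rpow_le_rpow_of_exponent_le hX (by linarith)
  have hX1 : X ^ (1 - σ) ≤ X ^ (1 - σ₁) := Real.rpow_le_rpow_of_exponent_le hX (by linarith)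
  set u := X ^ (θ - σ₁) with hu
  set w := X ^ (1 - σ₁) with hw
  have hu0 : 0 ≤ u := by positivity
  have hw0 : 0 ≤ w := by positivity
  have herr : ‖Z - 1 - D‖ ≤ B * (T * u + w / |t|) := by
    refine hmain.trans ?_
    have e1 : C * X ^ (θ - σ) ≤ C * (T * u) := by
      have : u ≤ T * u := le_mul_of_one_le_left hu0 hT
      gcongr
      linarith
    have e2 : A' * X ^ (1 - σ) / |t| ≤ A' * (w / |t|) := by
      rw [← mul_div_assoc]; gcongr
    have e3 : ‖s‖ * (C * (X ^ (θ - σ) / (σ - θ))) ≤ (|σ₂| + 1) * T * (C * (u / (σ₁ - θ))) := by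
      have : 0 < σ - θ := by linarith
      gcongr
    have e4 : (|σ₂| + 1) * T * (C * (u / (σ₁ - θ))) = (|σ₂| + 1) * C / (σ₁ - θ) * (T * u) := by
      field_simp
    have p1 : 0 ≤ T * u := by positivity
    have p2 : 0 ≤ w / |t| := by positivity
    have p3 : 0 ≤ (|σ₂| + 1) * C / (σ₁ - θ) := by positivity
    rw [hB]
    nlinarith [mul_nonneg hC p2, mul_nonneg hA' p1, mul_nonneg p3 p2]
  have hsq : (w / |t|) ^ 2 ≤ 2 * (w ^ 2 * (1 + t ^ 2)⁻¹) := by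
    rw [div_pow, sq_abs]
    have : 1 ≤ t ^ 2 := by rw [← sq_abs]; nlinarith
    rw [← div_eq_mul_inv, ← mul_div_assoc, div_le_div_iff₀ (by positivity) (by positivity)]
    nlinarith [sq_nonneg w]
  have hu2 : X ^ (2 * (θ - σ₁)) = u ^ 2 := by
    rw [hu, mul_comm, Real.rpow_mul hX0.le]; norm_cast
  have hw2 : X ^ (2 * (1 - σ₁)) = w ^ 2 := by
    rw [hw, mul_comm, Real.rpow_mul hX0.le]; norm_cast
  rw [hu2, hw2]
  have hE2 : ‖Z - 1 - D‖ ^ 2 ≤ B ^ 2 * (2 * (T ^ 2 * u ^ 2) + 2 * (w / |t|) ^ 2) := by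
    calc _ ≤ (B * (T * u + w / |t|)) ^ 2 := by gcongr
      _ = B ^ 2 * (T * u + w / |t|) ^ 2 := by ring
      _ ≤ _ := by
        gcongr
        nlinarith [sq_nonneg (T * u - w / |t|)]
  have hZ : ‖Z - 1‖ ≤ ‖D‖ + ‖Z - 1 - D‖ := by
    simpa using norm_add_le D (Z - 1 - D)
  calc ‖Z - 1‖ ^ 2 ≤ (‖D‖ + ‖Z - 1 - D‖) ^ 2 := by gcongr
    _ ≤ 2 * ‖D‖ ^ 2 + 2 * ‖Z - 1 - D‖ ^ 2 := by nlinarith [sq_nonneg (‖D‖ - ‖Z - 1 - D‖)]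
    _ ≤ 2 * ‖D‖ ^ 2 + 2 * (B ^ 2 * (2 * (T ^ 2 * u ^ 2) + 2 * (2 * (w ^ 2 * (1 + t ^ 2)⁻¹)))) := by
      gcongr
      exact hE2.trans (by gcongr)
    _ ≤ _ := by
      have : 0 ≤ B ^ 2 * (T ^ 2 * u ^ 2) := by positivity
      nlinarith

end BeurlingSystem

theorem eventually_mul_rpow_le {a : ℝ} (ha : a < 1) (c : ℝ) {η : ℝ} (hη : 0 < η) :
    ∀ᶠ T : ℝ in atTop, c * T ^ a ≤ η * T := by
  have h0 : Tendsto (fun y : ℝ => c * y ^ (-(1 - a))) atTop (𝓝 (c * 0)) :=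
    (tendsto_rpow_neg_atTop (sub_pos.2 ha)).const_mul _
  rw [mul_zero] at h0
  filter_upwards [h0.eventually_le_const hη, eventually_gt_atTop 0] with T hT hT0
  have : T ^ a = T ^ (-(1 - a)) * T := by
    rw [← Real.rpow_add_one hT0.ne']; ring_nf
  rw [this, ← mul_assoc]
  gcongr

namespace BeurlingSystem

/-- Mean square of the sieved zeta function minus one along vertical segments. -/
theorem IsZeta.exists_eventually_integral_normSq_le {S : BeurlingSystem} {A θ K₀ : ℝ}
    (h : S.WellBehaved A θ K₀) {ζ : ℂ → ℂ} (hζ : S.IsZeta θ ζ) {σ₁ : ℝ}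
    (hσ₁ : (θ + 2) / 3 < σ₁) (hσ₁' : σ₁ < 1) (σ₂ : ℝ) :
    ∃ C : ℝ, 0 ≤ C ∧ ∀ (η : ℝ) (K : ℕ), 0 < η →
      (∀ F : Finset (ℕ →₀ ℕ), (∀ n ∈ F, n ∈ sieved K ∧ n ≠ 0) →
        ∑ n ∈ F, S.val n ^ (-(2 * σ₁ - θ)) ≤ η) →
      ∀ᶠ T : ℝ in atTop, ∀ σ a b : ℝ, σ₁ ≤ σ → σ ≤ σ₂ → -T ≤ a → a ≤ b → b ≤ T →
        (1 ≤ a ∨ b ≤ -1) →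
        ∫ t in a..b, ‖S.sievedZeta ζ K (σ + t * Complex.I) - 1‖ ^ 2 ≤ C * η * T := by
  have hθ0 : 0 ≤ θ := h.2.1
  have hθ1 : θ < 1 := h.2.2.1
  have hθσ : θ < σ₁ := by linarith
  obtain ⟨κ, hκ1, hκ2⟩ : ∃ κ, 1 / (σ₁ - θ) < κ ∧ κ < 1 / (2 - 2 * σ₁) :=
    exists_between (one_div_lt_one_div_of_lt (by linarith) (by linarith))
  have hκ0 : 0 < κ := lt_trans (one_div_pos.2 (by linarith)) hκ1
  obtain ⟨e, he1, he2⟩ : ∃ e, 2 - 2 * σ₁ < e ∧ e < 1 / κ :=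
    exists_between ((lt_one_div hκ0 (by linarith)).1 hκ2)
  have hκe : κ * e < 1 := by rwa [lt_div_iff₀ hκ0, mul_comm] at he2
  have hκθ : 1 < κ * (σ₁ - θ) := (div_lt_iff₀ (by linarith)).1 hκ1
  have hκσ : κ * (2 - 2 * σ₁) < 1 := (lt_div_iff₀ (by linarith)).1 hκ2
  have hsum : Summable fun n => S.val n ^ (1 - 2 * σ₁ - e) :=
    (h.summable_val_rpow (σ := e + 2 * σ₁ - 1) (by linarith)).congr fun n => by ring_nf
  set S₁ := ∑' n, S.val n ^ (1 - 2 * σ₁ - e) with hS₁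
  set M := Real.exp 1 * √Real.pi * (4 * Real.exp 12 * (K₀ + A)) with hM
  have hM0 : 0 ≤ M := by
    have := h.1
    have := h.2.2.2.1
    positivity
  refine ⟨2 * M + 3, by positivity, fun η K hη hK => ?_⟩
  obtain ⟨B, hB, hmain⟩ := hζ.exists_normSq_sievedZeta_sub_one_le h K hθσ σ₂
  filter_upwards [eventually_ge_atTop 1, eventually_mul_rpow_le hκe (2 * M * S₁) hη,
    eventually_mul_rpow_le (a := 3 + κ * (2 * (θ - σ₁))) (by nlinarith) (2 * B) hη,
    eventually_mul_rpow_le (a := κ * (2 * (1 - σ₁))) (by nlinarith) (4 * B) hη]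
    with T hT1 hT2 hT3 hT4 σ a b hσ hσ' haT hab hbT hor
  have hT0 : 0 < T := by linarith
  have hX1 : 1 ≤ T ^ κ := Real.one_le_rpow hT1 hκ0.le
  obtain ⟨F, hF, hFb⟩ := hmain (T ^ κ) T hX1 hT1
  set X := T ^ κ with hX
  have habs : ∀ t ∈ Set.Icc a b, 1 ≤ |t| ∧ |t| ≤ T := fun t ht => by
    refine ⟨?_, abs_le.2 ⟨by linarith [ht.1], by linarith [ht.2]⟩⟩
    rcases hor with hor | hor
    · exact le_abs.2 (Or.inl (hor.trans ht.1))
    · exact le_abs.2 (Or.inr (by linarith [ht.2]))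
  set D : ℝ → ℝ := fun t => ‖∑ n ∈ F, (S.val n : ℂ) ^ (-(σ + t * Complex.I : ℂ))‖ ^ 2 with hD
  have hDc : Continuous D := by
    refine (continuous_finsetSum _ fun n _ => ?_).norm.pow 2
    exact Continuous.const_cpow (by fun_prop) (Or.inl (by exact_mod_cast (S.val_pos n).ne'))
  have hinv : Continuous fun t : ℝ => (1 + t ^ 2)⁻¹ :=
    (by fun_prop : Continuous fun t : ℝ => 1 + t ^ 2).inv₀ fun t => by positivity
  have hZc : ContinuousOn (fun t : ℝ => ‖S.sievedZeta ζ K (σ + t * Complex.I) - 1‖ ^ 2)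
      (Set.Icc a b) :=
    ((hζ.continuousOn_sievedZeta_line K (by linarith) fun t ht h0 => by
      have := (habs t ht).1
      rw [h0, abs_zero] at this
      linarith).sub continuousOn_const).norm.pow 2
  have hstep : ∫ t in a..b, ‖S.sievedZeta ζ K (σ + t * Complex.I) - 1‖ ^ 2 ≤
      ∫ t in a..b, (2 * D t + B * (T ^ 2 * X ^ (2 * (θ - σ₁)) +
        X ^ (2 * (1 - σ₁)) * (1 + t ^ 2)⁻¹)) := by
    refine intervalIntegral.integral_mono_on hab
      (ContinuousOn.intervalIntegrable (by rwa [Set.uIcc_of_le hab]))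
      (Continuous.intervalIntegrable (by fun_prop) _ _) fun t ht => ?_
    exact hFb σ t hσ hσ' (habs t ht).1 (habs t ht).2
  refine hstep.trans ?_
  rw [intervalIntegral.integral_add ((hDc.const_mul 2).intervalIntegrable _ _)
    (Continuous.intervalIntegrable (by fun_prop) _ _), intervalIntegral.integral_const_mul 2,
    intervalIntegral.integral_const_mul B, intervalIntegral.integral_add (by simp)
    ((hinv.const_mul _).intervalIntegrable _ _),
    intervalIntegral.integral_const_mul (X ^ (2 * (1 - σ₁))), intervalIntegral.integral_const, smul_eq_mul, integral_inv_one_add_sq]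
  have hD1 : ∫ t in a..b, D t ≤ ∫ t in (-T)..T, D t :=
    intervalIntegral.integral_mono_interval haT hab hbT (MeasureTheory.ae_of_all _ fun t => by positivity)
      (hDc.intervalIntegrable _ _)
  have hD2 := hD1.trans (h.integral_normSq_sum_val_le F σ hT1)
  have hs1 : ∑ n ∈ F, S.val n ^ (1 - 2 * σ) ≤ X ^ e * S₁ := by
    refine le_trans ?_ (mul_le_mul_of_nonneg_left (hsum.sum_le_tsum F fun n _ =>
      Real.rpow_nonneg (S.val_pos n).le _) (by positivity))
    rw [Finset.mul_sum]
    refine Finset.sum_le_sum fun n hn => ?_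
    calc S.val n ^ (1 - 2 * σ) ≤ S.val n ^ (e + (1 - 2 * σ₁ - e)) :=
          Real.rpow_le_rpow_of_exponent_le (S.one_le_val n) (by linarith)
      _ = S.val n ^ e * S.val n ^ (1 - 2 * σ₁ - e) := Real.rpow_add (S.val_pos n) _ _
      _ ≤ _ := by
        have := S.val_pos n
        gcongr
        · linarith
        · exact (hF n hn).2.2
  have hs2 : ∑ n ∈ F, S.val n ^ (θ - 2 * σ) ≤ η := by
    refine (Finset.sum_le_sum fun n hn => ?_).trans (hK F fun n hn => ⟨(hF n hn).1, (hF n hn).2.1⟩)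
    exact Real.rpow_le_rpow_of_exponent_le (S.one_le_val n) (by linarith)
  have hX2 : X ^ e = T ^ (κ * e) := (Real.rpow_mul hT0.le _ _).symm
  have hX3 : T ^ 3 * X ^ (2 * (θ - σ₁)) = T ^ (3 + κ * (2 * (θ - σ₁))) := by
    rw [Real.rpow_add hT0, Real.rpow_mul hT0.le κ]; norm_cast
  have hX4 : X ^ (2 * (1 - σ₁)) = T ^ (κ * (2 * (1 - σ₁))) := (Real.rpow_mul hT0.le _ _).symm
  rw [← hX2] at hT2
  rw [← hX3] at hT3
  rw [← hX4] at hT4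
  have harc : Real.arctan b - Real.arctan a ≤ 4 := by
    linarith [Real.arctan_lt_pi_div_two b, Real.neg_pi_div_two_lt_arctan a, Real.pi_le_four]
  have hw : 0 ≤ X ^ (2 * (1 - σ₁)) := by positivity
  have hu : 0 ≤ X ^ (2 * (θ - σ₁)) := by positivity
  calc _ ≤ 2 * (M * (X ^ e * S₁ + T * η)) + B * (2 * T * (T ^ 2 * X ^ (2 * (θ - σ₁))) +
        X ^ (2 * (1 - σ₁)) * 4) := by
        gcongr
        · exact hD2.trans (by gcongr)
        · linarith
    _ = 2 * M * S₁ * X ^ e + 2 * B * (T ^ 3 * X ^ (2 * (θ - σ₁))) +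
        4 * B * X ^ (2 * (1 - σ₁)) + 2 * M * (η * T) := by ring
    _ ≤ _ := by linarith

end BeurlingSystem

theorem integral_circleAverage_le {f : ℂ → ℝ} {c R p q M : ℝ} (hR : 0 ≤ R) (hpq : p ≤ q)
    (hf : ContinuousOn f {z | |z.re - c| ≤ R ∧ p - R ≤ z.im ∧ z.im ≤ q + R})
    (hM : ∀ σ y : ℝ, |σ - c| ≤ R → |y| ≤ R →
      ∫ t in (p + y)..(q + y), f (σ + t * Complex.I) ≤ M) :
    MeasureTheory.IntegrableOn (fun t : ℝ => Real.circleAverage f (c + t * Complex.I) R)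
      (Set.Ioc p q) ∧
    ∫ t in Set.Ioc p q, Real.circleAverage f (c + t * Complex.I) R ≤ M := by
  have hcos : ∀ φ : ℝ, |R * Real.cos φ| ≤ R := fun φ => by
    rw [abs_mul, abs_of_nonneg hR]
    exact mul_le_of_le_one_right hR (Real.abs_cos_le_one φ)
  have hsin : ∀ φ : ℝ, |R * Real.sin φ| ≤ R := fun φ => by
    rw [abs_mul, abs_of_nonneg hR]
    exact mul_le_of_le_one_right hR (Real.abs_sin_le_one φ)
  have hmap : ∀ t φ : ℝ, circleMap (c + t * Complex.I) R φ =
      ((c + R * Real.cos φ : ℝ) : ℂ) + ((t + R * Real.sin φ : ℝ) : ℂ) * Complex.I := fun t φ => by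
    rw [circleMap, Complex.exp_mul_I]
    push_cast
    ring
  have hint : MeasureTheory.Integrable
      (Function.uncurry fun t φ : ℝ => f (circleMap (c + t * Complex.I) R φ))
      ((MeasureTheory.volume.restrict (Set.Ioc p q)).prod
        (MeasureTheory.volume.restrict (Set.Ioc 0 (2 * Real.pi)))) := by
    rw [MeasureTheory.Measure.prod_restrict]
    refine MeasureTheory.IntegrableOn.mono_set (ContinuousOn.integrableOn_compact
      (K := Set.Icc p q ×ˢ Set.Icc 0 (2 * Real.pi)) (isCompact_Icc.prod isCompact_Icc) ?_)
      (Set.prod_mono Set.Ioc_subset_Icc_self Set.Ioc_subset_Icc_self)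
    refine hf.comp (by unfold circleMap; fun_prop) fun z hz => ?_
    have h1 := abs_le.1 (hsin z.2)
    have h2 := hcos z.2
    simp only [hmap, Set.mem_ofPred_eq, Complex.add_re, Complex.ofReal_re, Complex.mul_re,
      Complex.I_re, Complex.ofReal_im, Complex.I_im, Complex.add_im, Complex.mul_im]
    refine ⟨by simpa using h2, ?_, ?_⟩
    · linarith [hz.1.1]
    · linarith [hz.1.2]
  have heq : ∀ t : ℝ, Real.circleAverage f (c + t * Complex.I) R = (2 * Real.pi)⁻¹ *
      ∫ φ in Set.Ioc 0 (2 * Real.pi), f (circleMap (c + t * Complex.I) R φ) := fun t => by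
    rw [Real.circleAverage, intervalIntegral.integral_of_le Real.two_pi_pos.le, smul_eq_mul]
  simp_rw [heq]
  refine ⟨hint.integral_prod_left.const_mul _, ?_⟩
  rw [MeasureTheory.integral_const_mul, MeasureTheory.integral_integral_swap hint,
    inv_mul_le_iff₀ Real.two_pi_pos]
  have hle : ∀ φ : ℝ, ∫ t in Set.Ioc p q, f (circleMap (c + t * Complex.I) R φ) ≤ M := fun φ => by
    have h1 := hM (c + R * Real.cos φ) (R * Real.sin φ) (by simpa using hcos φ) (hsin φ)
    rw [← intervalIntegral.integral_comp_add_right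
      (fun t : ℝ => f (((c + R * Real.cos φ : ℝ) : ℂ) + t * Complex.I))] at h1
    simpa only [hmap, intervalIntegral.integral_of_le hpq] using h1
  calc _ ≤ ∫ φ in Set.Ioc 0 (2 * Real.pi), M :=
        MeasureTheory.integral_mono hint.integral_prod_right (by simp) hle
    _ = 2 * Real.pi * M := by simp [Real.pi_pos.le]

/-- Zeros counted by integrating the Jensen inequality over discs whose centres run along a
vertical segment. -/
theorem card_zeros_mul_log_le_of_integral_le {g : ℂ → ℂ} {c r R δ a b M : ℝ} (hr : 0 < r)
    (hrR : r < R) (hδ : 0 < δ) (hab : a ≤ b)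
    (hg : AnalyticOnNhd ℂ g {z | |z.re - c| ≤ R ∧ a - δ - R ≤ z.im ∧ z.im ≤ b + δ + R})
    (hg1 : ∀ t : ℝ, ‖g (c + t * Complex.I) - 1‖ ≤ 1 / 2)
    (hM : ∀ σ y : ℝ, |σ - c| ≤ R → |y| ≤ R →
      ∫ t in (a - δ + y)..(b + δ + y), ‖g (σ + t * Complex.I) - 1‖ ^ 2 ≤ M)
    (F : Finset ℂ) (hF : ∀ ρ ∈ F, g ρ = 0 ∧ |ρ.re - c| ≤ r - δ ∧ a ≤ ρ.im ∧ ρ.im ≤ b) :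
    F.card * (2 * δ * Real.log (R / r)) ≤ 14 * M := by
  have hR : 0 < R := hr.trans hrR
  have hlog : 0 ≤ Real.log (R / r) := Real.log_nonneg ((one_le_div hr).2 hrR.le)
  obtain ⟨hint, hle⟩ := integral_circleAverage_le (f := fun z => ‖g z - 1‖ ^ 2) hR.le
    (by linarith : a - δ ≤ b + δ) ((hg.continuousOn.sub continuousOn_const).norm.pow 2) hM
  have hpt : ∀ t ∈ Set.Ioc (a - δ) (b + δ),
      ∑ ρ ∈ F, (Set.Ioc (ρ.im - δ) (ρ.im + δ)).indicator (fun _ => Real.log (R / r)) t ≤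
        14 * Real.circleAverage (fun z => ‖g z - 1‖ ^ 2) (c + t * Complex.I) R := by
    intro t ht
    classical
    refine le_trans (le_of_eq ?_) (card_zeros_mul_log_le_circleAverage hr hrR (hg.mono ?_) (hg1 t)
      (F.filter fun ρ => t ∈ Set.Ioc (ρ.im - δ) (ρ.im + δ)) ?_)
    · simp only [Set.indicator_apply]
      rw [← Finset.sum_filter, Finset.sum_const, nsmul_eq_mul]
    · intro z hz
      rw [Metric.mem_closedBall, Complex.dist_eq] at hz
      have h1 := (Complex.abs_re_le_norm _).trans hz
      have h2 := abs_le.1 ((Complex.abs_im_le_norm _).trans hz)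
      simp at h1 h2
      exact ⟨h1, by linarith [ht.1], by linarith [ht.2]⟩
    · intro ρ hρ
      obtain ⟨hρF, hρt⟩ := Finset.mem_filter.1 hρ
      obtain ⟨h0, h1, -, -⟩ := hF ρ hρF
      refine ⟨h0, (Complex.norm_le_abs_re_add_abs_im _).trans ?_⟩
      have h2 : |ρ.im - t| ≤ δ := abs_le.2 ⟨by linarith [hρt.2], by linarith [hρt.1]⟩
      simp
      linarith
  have hI : ∀ ρ ∈ F, MeasureTheory.Integrable
      ((Set.Ioc (ρ.im - δ) (ρ.im + δ)).indicator fun _ => Real.log (R / r))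
      (MeasureTheory.volume.restrict (Set.Ioc (a - δ) (b + δ))) := fun ρ _ =>
    (MeasureTheory.integrable_const _).indicator measurableSet_Ioc
  have hmono := MeasureTheory.setIntegral_mono_on
    (MeasureTheory.integrable_finsetSum F hI) (hint.const_mul 14) measurableSet_Ioc hpt
  rw [MeasureTheory.integral_const_mul, MeasureTheory.integral_finsetSum _ hI] at hmono
  have hval : ∀ ρ ∈ F, ∫ t in Set.Ioc (a - δ) (b + δ),
      (Set.Ioc (ρ.im - δ) (ρ.im + δ)).indicator (fun _ => Real.log (R / r)) t =
        2 * δ * Real.log (R / r) := fun ρ hρ => by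
    obtain ⟨-, -, h1, h2⟩ := hF ρ hρ
    rw [MeasureTheory.setIntegral_indicator measurableSet_Ioc,
      Set.inter_eq_right.2 (Set.Ioc_subset_Ioc (by linarith) (by linarith)),
      MeasureTheory.setIntegral_const, smul_eq_mul, MeasureTheory.measureReal_def,
      Real.volume_Ioc, ENNReal.toReal_ofReal (by linarith)]
    ring
  rw [Finset.sum_congr rfl hval, Finset.sum_const, nsmul_eq_mul] at hmono
  linarith

namespace BeurlingSystem

theorem IsZeta.norm_sievedZeta_sub_one_le {S : BeurlingSystem} {A θ K₀ : ℝ}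
    (h : S.WellBehaved A θ K₀) {ζ : ℂ → ℂ} (hζ : S.IsZeta θ ζ) {σ η : ℝ} (hσ : 1 < σ) {K : ℕ}
    (hK : ∀ F : Finset (ℕ →₀ ℕ), (∀ n ∈ F, n ∈ sieved K ∧ n ≠ 0) →
      ∑ n ∈ F, S.val n ^ (-σ) ≤ η) {s : ℂ} (hs : σ ≤ s.re) :
    ‖S.sievedZeta ζ K s - 1‖ ≤ η := by
  classical
  have hs1 : 1 < s.re := hσ.trans_le hs
  have hsum : HasSum (fun n : sieved K => (S.val n : ℂ) ^ (-s)) (S.sievedZeta ζ K s) := by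
    rw [hζ.sievedZeta_eq_tsum h K hs1]
    exact ((h.summable_val_cpow hs1).subtype _).hasSum
  refine le_of_tendsto (hsum.sub_const 1).norm ?_
  have h0 : (0 : ℕ →₀ ℕ) ∈ sieved K := fun k _ => rfl
  filter_upwards [eventually_ge_atTop {(⟨0, h0⟩ : sieved K)}] with F hF
  rw [← Finset.add_sum_erase F _ (hF (Finset.mem_singleton_self _)), S.val_zero,
    Complex.ofReal_one, Complex.one_cpow, add_sub_cancel_left]
  refine le_trans ?_ (hK ((F.erase ⟨0, h0⟩).map (Function.Embedding.subtype _)) fun n hn => ?_)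
  · rw [Finset.sum_map]
    refine (norm_sum_le _ _).trans (Finset.sum_le_sum fun n _ => ?_)
    rw [Complex.norm_cpow_eq_rpow_re_of_pos (S.val_pos n)]
    exact Real.rpow_le_rpow_of_exponent_le (S.one_le_val n) (by simpa using hs)
  · obtain ⟨m, hm, rfl⟩ := Finset.mem_map.1 hn
    exact ⟨m.2, fun h => (Finset.mem_erase.1 hm).1 (Subtype.ext h)⟩

theorem IsZeta.exists_eventually_card_zeros_le {S : BeurlingSystem} {A θ K₀ : ℝ}
    (h : S.WellBehaved A θ K₀) {ζ : ℂ → ℂ} (hζ : S.IsZeta θ ζ) {α : ℝ} (hα : (θ + 2) / 3 < α) :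
    ∃ t₀ : ℝ, ∀ ε > 0, ∀ᶠ T : ℝ in atTop, ∀ F : Finset ℂ,
      (∀ ρ ∈ F, ζ ρ = 0 ∧ α ≤ ρ.re ∧ t₀ ≤ |ρ.im| ∧ |ρ.im| ≤ T) → (F.card : ℝ) ≤ ε * T := by
  classical
  have hθ0 : 0 ≤ θ := h.2.1
  have hθ1 : θ < 1 := h.2.2.1
  obtain ⟨σ₁, hσ₁, hσα⟩ : ∃ σ₁, (θ + 2) / 3 < σ₁ ∧ σ₁ < min α 1 :=
    exists_between (lt_min hα (by linarith))
  obtain ⟨hσα, hσ1⟩ := lt_min_iff.1 hσα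
  set δ := (α - σ₁) / 2 with hδ
  have hδ0 : 0 < δ := by rw [hδ]; linarith
  set r := 2 + δ with hr
  set R := 2 + 2 * δ with hR
  have hrR : r < R := by linarith
  set L := 2 * δ * Real.log (R / r) with hL
  have hL0 : 0 < L :=
    mul_pos (by linarith) (Real.log_pos ((one_lt_div (by linarith)).2 hrR))
  obtain ⟨C, hC, hmean⟩ := hζ.exists_eventually_integral_normSq_le h hσ₁ hσ1 (α + 2 + R)
  refine ⟨1 + δ + R, fun ε hε => ?_⟩
  set η := min (1 / 2) (ε * L / (56 * C + 1)) with hη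
  have hη0 : 0 < η := by positivity
  have hηC : 56 * C * η ≤ ε * L := by
    have h1 : η * (56 * C + 1) ≤ ε * L := (le_div_iff₀ (by positivity)).1 (min_le_right _ _)
    linarith
  have hτ : 1 < 2 * σ₁ - θ := by linarith
  obtain ⟨K, hK⟩ := h.exists_sum_sieved_le hτ hη0
  have hone : ∀ s : ℂ, α + 2 ≤ s.re → ‖S.sievedZeta ζ K s - 1‖ ≤ 1 / 2 := fun s hs =>
    (hζ.norm_sievedZeta_sub_one_le h hτ hK (by linarith)).trans (min_le_left _ _)
  have han : AnalyticOnNhd ℂ (S.sievedZeta ζ K) {s : ℂ | θ < s.re ∧ s ≠ 1} :=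
    (hζ.differentiableOn_sievedZeta K).analyticOnNhd
      ((isOpen_lt continuous_const Complex.continuous_re).inter isOpen_ne)
  have hmean2 := (tendsto_id.const_mul_atTop two_pos).eventually (hmean η K hη0 hK)
  filter_upwards [hmean2, eventually_ge_atTop (1 + δ + R)] with T hT hT0 F hF
  simp only [id] at hT
  have hzero : ∀ ρ ∈ F, S.sievedZeta ζ K ρ = 0 := fun ρ hρ => by
    rw [sievedZeta, (hF ρ hρ).1, zero_mul]
  have hre : ∀ ρ ∈ F, |ρ.re - (α + 2)| ≤ r - δ := fun ρ hρ => by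
    have h1 : ρ.re < α + 2 := by
      by_contra! h1
      have h2 := hone ρ h1
      rw [hzero ρ hρ] at h2
      norm_num at h2
    exact abs_le.2 ⟨by linarith [(hF ρ hρ).2.1], by linarith⟩
  have hcount : ∀ a b : ℝ, a ≤ b → -T ≤ a → b ≤ T → (1 + δ + R ≤ a ∨ b ≤ -(1 + δ + R)) →
      ((F.filter fun ρ => a ≤ ρ.im ∧ ρ.im ≤ b).card : ℝ) * L ≤ 14 * (C * η * (2 * T)) := by
    intro a b hab haT hbT hor
    refine card_zeros_mul_log_le_of_integral_le (g := S.sievedZeta ζ K) (c := α + 2) (a := a)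
      (b := b) (by linarith) hrR hδ0 hab (han.mono ?_) (fun t => hone _ (by simp)) ?_ _ ?_
    · rintro z ⟨hz1, hz2, hz3⟩
      refine ⟨by linarith [(abs_le.1 hz1).1], ?_⟩
      rintro rfl
      simp only [Complex.one_im] at hz2 hz3
      rcases hor with hor | hor <;> linarith
    · intro σ y hσ hy
      have h1 := abs_le.1 hσ
      have h2 := abs_le.1 hy
      refine hT σ _ _ (by linarith) (by linarith) (by linarith) (by linarith) (by linarith) ?_
      rcases hor with hor | hor
      · exact Or.inl (by linarith)
      · exact Or.inr (by linarith)
    · intro ρ hρ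
      obtain ⟨hρF, hρ⟩ := Finset.mem_filter.1 hρ
      exact ⟨hzero ρ hρF, hre ρ hρF, hρ⟩
  have h1 := hcount (1 + δ + R) T hT0 (by linarith) le_rfl (Or.inl le_rfl)
  have h2 := hcount (-T) (-(1 + δ + R)) (by linarith) le_rfl (by linarith) (Or.inr le_rfl)
  have hsub : F ⊆ (F.filter fun ρ => 1 + δ + R ≤ ρ.im ∧ ρ.im ≤ T) ∪
      F.filter fun ρ => -T ≤ ρ.im ∧ ρ.im ≤ -(1 + δ + R) := fun ρ hρ => by
    obtain ⟨-, -, h3, h4⟩ := hF ρ hρ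
    obtain ⟨h5, h6⟩ := abs_le.1 h4
    rcases le_abs.1 h3 with h3 | h3
    · exact Finset.mem_union_left _ (Finset.mem_filter.2 ⟨hρ, h3, h6⟩)
    · exact Finset.mem_union_right _ (Finset.mem_filter.2 ⟨hρ, h5, by linarith⟩)
  have h3 : (F.card : ℝ) ≤ _ := Nat.cast_le.2
    ((Finset.card_le_card hsub).trans (Finset.card_union_le _ _))
  rw [Nat.cast_add] at h3
  have h4 : (F.card : ℝ) * L ≤ ε * T * L := by
    have h5 := mul_le_mul_of_nonneg_right h3 hL0.le
    have h6 := mul_le_mul_of_nonneg_right hηC (by linarith : 0 ≤ T)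
    linarith
  exact le_of_mul_le_mul_right h4 hL0

end BeurlingSystem

/-- **Corollary to the zero-density estimate.** For a `θ`-well-behaved Beurling
system, `N(α, T) = o(T)` as `T → ∞` for every `α > (θ+2)/3`. -/
theorem beurling_zero_count_littleO
    (S : BeurlingSystem) (A θ K₀ : ℝ) (hWB : S.WellBehaved A θ K₀)
    (ζ : ℂ → ℂ) (hζ : S.IsZeta θ ζ) :
    ∀ α : ℝ, (θ + 2) / 3 < α →
      Filter.Tendsto (fun T : ℝ => zeroCount ζ α T / T) Filter.atTop (nhds 0) := by
  intro α hα
  obtain ⟨t₀, ht₀⟩ := hζ.exists_eventually_card_zeros_le hWB hα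
  set low : Set ℂ := {ρ | ζ ρ = 0 ∧ ρ ≠ 1 ∧ α ≤ ρ.re ∧ |ρ.im| ≤ t₀} with hlow
  rw [Metric.tendsto_atTop']
  intro ε hε
  obtain ⟨T₀, hT₀⟩ := eventually_atTop.1 ((ht₀ (ε / 2) (half_pos hε)).and
    ((eventually_ge_atTop t₀).and ((eventually_gt_atTop 0).and
      (eventually_gt_atTop (low.ncard / (ε / 2))))))
  refine ⟨T₀, fun T hT => ?_⟩
  obtain ⟨hcard, hTt, hT0, hTlow⟩ := hT₀ T hT.le
  have hTlow' : (low.ncard : ℝ) < T * (ε / 2) := (div_lt_iff₀ (half_pos hε)).1 hTlow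
  have hle : zeroCount ζ α T ≤ low.ncard + ε / 2 * T := by
    rw [zeroCount]
    set Z : Set ℂ := {ρ | ζ ρ = 0 ∧ ρ ≠ 1 ∧ α ≤ ρ.re ∧ |ρ.im| ≤ T} with hZ
    rcases Z.finite_or_infinite with hfin | hinf
    · have hlowfin : low.Finite := hfin.subset fun ρ hρ =>
        ⟨hρ.1, hρ.2.1, hρ.2.2.1, hρ.2.2.2.trans hTt⟩
      have h1 : (Z.ncard : ℝ) ≤ _ := Nat.cast_le.2 (Set.ncard_le_ncard_sdiff_add_ncard Z low hlowfin)
      have h2 := hcard (hfin.sdiff (t := low)).toFinset fun ρ hρ => by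
        rw [Set.Finite.mem_toFinset] at hρ
        obtain ⟨⟨a, b, c, d⟩, hn⟩ := hρ
        refine ⟨a, c, ?_, d⟩
        by_contra! hlt
        exact hn ⟨a, b, c, hlt.le⟩
      rw [← Set.ncard_eq_toFinset_card _ hfin.sdiff] at h2
      push_cast at h1
      linarith
    · rw [hinf.ncard]
      simp only [Nat.cast_zero]
      positivity
  have h0 : 0 ≤ zeroCount ζ α T / T := div_nonneg (Nat.cast_nonneg _) hT0.le
  rw [Real.dist_eq, sub_zero, abs_of_nonneg h0, div_lt_iff₀ hT0]
  linarith
end
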